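/- Let K be a field of characteristic zero and Γ a subgroup of K^* of finite rank. Fix integers n, m ≥ 2 and r with n ≥ m ≥ r > 0. Then there exists a constant C > 0, depending only on m, n and the rank of Γ, such that for every finite subset A of Γ of cardinality A = #A, the number of m×n matrices over A of rank exactly r satisfies: #R_{m,n}(A; r) ≤ C·A^{nr + m − r} if 2m ≤ n + r, and #R_{m,n}(A; r) ≤ C·A^{nr + m − r + ⌊(r−1)/2⌋·(2m − n − r)} if 2m > n + r. -/

import Mathlib

/-- A subgroup `Γ` of a (commutative) group has finite rank `ρ` if there is a finitely
generated subgroup `Γ₀ ≤ Γ`, generated by `ρ` elements, such that every `x ∈ Γ` has a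
positive power lying in `Γ₀`. -/
def FinRank {G : Type*} [CommGroup G] (Γ : Subgroup G) (ρ : ℕ) : Prop :=
  ∃ S : Finset G, S.card = ρ ∧ (S : Set G) ⊆ (Γ : Set G) ∧
    ∀ x ∈ Γ, ∃ k : ℕ, 0 < k ∧ x ^ k ∈ Subgroup.closure (S : Set G)

universe u

theorem sum_card_filter_eq {G : Type*} (A : Finset G) (φ : G → ℤ) :
    ∑ c ∈ A.image φ, ((A.filter fun a => φ a = c).card : ℝ) = A.card := by
  rw [Finset.card_eq_sum_card_image φ A]; push_cast; rfl

section Energy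

variable {G : Type*} [AddCommGroup G]

/-- The involution of the group algebra induced by `x ↦ -x`. -/
noncomputable def algRev : AddMonoidAlgebra ℝ G →+* AddMonoidAlgebra ℝ G :=
  AddMonoidAlgebra.mapDomainRingHom ℝ (negAddMonoidHom : G →+ G)

theorem algRev_single (x : G) (c : ℝ) :
    algRev (AddMonoidAlgebra.single x c) = AddMonoidAlgebra.single (-x) c := by
  simp [algRev]

theorem algRev_algRev (f : AddMonoidAlgebra ℝ G) : algRev (algRev f) = f := by
  induction f using AddMonoidAlgebra.induction_linear with
  | zero => simp
  | add f g hf hg => simp [hf, hg]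
  | single x c => simp [algRev_single]

theorem coeff_algRev (f : AddMonoidAlgebra ℝ G) (x : G) :
    (algRev f).coeff x = f.coeff (-x) := by
  classical
  induction f using AddMonoidAlgebra.induction_linear with
  | zero => simp
  | add f g hf hg => simp [hf, hg]
  | single y c =>
    simp only [algRev_single, AddMonoidAlgebra.coeff_single, Finsupp.single_apply,
      neg_eq_iff_eq_neg]

theorem coeff_zero_mul (f g : AddMonoidAlgebra ℝ G) :
    (f * g).coeff 0 = f.coeff.sum fun x r => r * g.coeff (-x) := by
  classical
  induction f using AddMonoidAlgebra.induction_linear with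
  | zero => simp
  | add f f' hf hf' =>
    rw [add_mul, AddMonoidAlgebra.coeff_add, Finsupp.add_apply, hf, hf',
      AddMonoidAlgebra.coeff_add, Finsupp.sum_add_index']
    · simp
    · intros; ring
  | single y c =>
    rw [AddMonoidAlgebra.coeff_single, Finsupp.sum_single_index (by simp)]
    induction g using AddMonoidAlgebra.induction_linear with
    | zero => simp
    | add f f' hf hf' => rw [mul_add]; simp [hf, hf', mul_add]
    | single z d =>
      rw [AddMonoidAlgebra.single_mul_single]
      simp only [AddMonoidAlgebra.coeff_single, Finsupp.single_apply]
      have : y + z = 0 ↔ z = -y := by rw [add_comm, add_eq_zero_iff_eq_neg]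
      simp [this]

theorem coeff_zero_mul_sq_le (f g : AddMonoidAlgebra ℝ G) :
    (f * g).coeff 0 ^ 2 ≤ (f * algRev f).coeff 0 * (g * algRev g).coeff 0 := by
  classical
  set s : Finset G := f.coeff.support ∪ g.coeff.support.image (fun x => -x)
  have h1 : (f * g).coeff 0 = ∑ x ∈ s, f.coeff x * g.coeff (-x) := by
    rw [coeff_zero_mul, Finsupp.sum]
    exact Finset.sum_subset Finset.subset_union_left (fun x _ hx => by simp_all)
  have h2 : (f * algRev f).coeff 0 = ∑ x ∈ s, f.coeff x ^ 2 := by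
    rw [coeff_zero_mul, Finsupp.sum]
    simp only [coeff_algRev, neg_neg, ← sq]
    exact Finset.sum_subset Finset.subset_union_left (fun x _ hx => by simp_all)
  have h3 : (g * algRev g).coeff 0 = ∑ x ∈ s, g.coeff (-x) ^ 2 := by
    rw [coeff_zero_mul, Finsupp.sum]
    simp only [coeff_algRev, neg_neg, ← sq]
    have : ∑ x ∈ g.coeff.support, g.coeff x ^ 2 =
        ∑ x ∈ g.coeff.support.image (fun x => -x), g.coeff (-x) ^ 2 := by
      rw [Finset.sum_image (by simp)]; simp
    rw [this]
    refine Finset.sum_subset Finset.subset_union_right (fun x _ hx => ?_)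
    simp only [Finset.mem_image, Finsupp.mem_support_iff, not_exists, not_and] at hx
    by_contra h
    exact hx (-x) (by simpa using h) (by simp)
  rw [h1, h2, h3]
  exact Finset.sum_mul_sq_le_sq_mul_sq _ _ _

theorem coeff_zero_mul_algRev_nonneg (f : AddMonoidAlgebra ℝ G) :
    0 ≤ (f * algRev f).coeff 0 := by
  rw [coeff_zero_mul, Finsupp.sum]
  exact Finset.sum_nonneg fun x _ => by rw [coeff_algRev, neg_neg]; exact mul_self_nonneg _

/-- Hölder's inequality with `2 ^ (l + 1)` factors for the trace of the group algebra. -/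
theorem coeff_zero_prod_pow_le {ι : Type*} (l : ℕ) (s : Finset ι) (hs : s.card = 2 ^ (l + 1))
    (f : ι → AddMonoidAlgebra ℝ G) :
    |(∏ i ∈ s, f i).coeff 0| ^ 2 ^ (l + 1) ≤
      ∏ i ∈ s, ((f i * algRev (f i)) ^ 2 ^ l).coeff 0 := by
  classical
  induction l generalizing s f with
  | zero =>
    obtain ⟨i, j, hij, rfl⟩ := Finset.card_eq_two.1 (by simpa using hs)
    simp only [zero_add, pow_one, pow_zero, sq_abs, Finset.prod_pair hij]
    exact coeff_zero_mul_sq_le _ _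
  | succ l ih =>
    obtain ⟨t, hts, ht⟩ := Finset.exists_subset_card_eq (s := s) (n := 2 ^ (l + 1))
      (by rw [hs]; exact Nat.pow_le_pow_right (by norm_num) (by omega))
    have ht' : (s \ t).card = 2 ^ (l + 1) := by
      rw [Finset.card_sdiff_of_subset hts, hs, ht]
      have := pow_succ 2 (l + 1); omega
    have key : ∀ u : Finset ι, u.card = 2 ^ (l + 1) →
        ((∏ i ∈ u, f i) * algRev (∏ i ∈ u, f i)).coeff 0 ^ 2 ^ (l + 1) ≤
          ∏ i ∈ u, ((f i * algRev (f i)) ^ 2 ^ (l + 1)).coeff 0 := by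
      intro u hu
      have := ih u hu (fun i => f i * algRev (f i))
      rw [Finset.prod_mul_distrib, ← map_prod, abs_of_nonneg (coeff_zero_mul_algRev_nonneg _)]
        at this
      refine this.trans (le_of_eq (Finset.prod_congr rfl fun i _ => ?_))
      rw [map_mul, algRev_algRev, mul_comm (algRev (f i)) (f i), ← sq, ← pow_mul, pow_succ']
    rw [← Finset.prod_sdiff hts, ← Finset.prod_sdiff hts, pow_succ' 2 (l + 1), pow_mul, sq_abs]
    calc _ ≤ (((∏ i ∈ s \ t, f i) * algRev (∏ i ∈ s \ t, f i)).coeff 0 *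
          ((∏ i ∈ t, f i) * algRev (∏ i ∈ t, f i)).coeff 0) ^ 2 ^ (l + 1) :=
        pow_le_pow_left₀ (sq_nonneg _) (coeff_zero_mul_sq_le _ _) _
      _ ≤ _ := by
        rw [mul_pow]
        exact mul_le_mul (key _ ht') (key _ ht)
          (pow_nonneg (coeff_zero_mul_algRev_nonneg _) _)
          (le_trans (pow_nonneg (coeff_zero_mul_algRev_nonneg _) _) (key _ ht'))

/-- The additive energy of a finite set: the number of solutions of
`x₁ + ⋯ + x_K = y₁ + ⋯ + y_K` in the set, with `K = 2 ^ l`. -/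
noncomputable def addNrg (l : ℕ) (A : Finset G) : ℕ := by
  classical exact
    ((Fintype.piFinset fun _ : Fin (2 ^ l) × Bool => A).filter
      fun x => ∑ i, (if i.2 then x i else - x i) = 0).card

theorem coeff_zero_prod_sum_single {ι : Type*} [Fintype ι] [DecidableEq ι] [DecidableEq G]
    (T : ι → G → G) (A : ι → Finset G) :
    (∏ i, ∑ x ∈ A i, AddMonoidAlgebra.single (T i x) (1 : ℝ)).coeff 0 =
      (((Fintype.piFinset A).filter fun x => ∑ i, T i (x i) = 0).card : ℝ) := by
  rw [Finset.prod_univ_sum, Finset.card_filter]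
  simp only [AddMonoidAlgebra.prod_single, Finset.prod_const_one]
  simp [AddMonoidAlgebra.coeff_sum, Finsupp.single_apply, Finsupp.finsetSum_apply]

theorem coeff_zero_pow_sum_single (l : ℕ) (T : G →+ G) (hT : Function.Injective T)
    (A : Finset G) :
    (((∑ x ∈ A, AddMonoidAlgebra.single (T x) (1 : ℝ)) *
      algRev (∑ x ∈ A, AddMonoidAlgebra.single (T x) (1 : ℝ))) ^ 2 ^ l).coeff 0 =
      (addNrg l A : ℝ) := by
  classical
  have h := coeff_zero_prod_sum_single
    (fun (i : Fin (2 ^ l) × Bool) x => if i.2 then T x else - T x) (fun _ => A)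
  have h2 : ∀ x : Fin (2 ^ l) × Bool → G,
      ∑ i, (if i.2 then T (x i) else - T (x i)) = T (∑ i, if i.2 then x i else - x i) := by
    intro x
    rw [map_sum]
    refine Finset.sum_congr rfl fun i _ => ?_
    split_ifs <;> simp
  simp only [h2, map_eq_zero_iff T hT] at h
  rw [addNrg, ← h, Fintype.prod_prod_type]
  simp [algRev_single, map_sum]

/-- The energy bounds the number of solutions of a linear equation in several sets. -/
theorem card_solutions_pow_le {ι : Type*} [Fintype ι] [DecidableEq ι] [DecidableEq G] (l : ℕ)
    (hι : Fintype.card ι = 2 ^ (l + 1)) (T : ι → G →+ G) (hT : ∀ i, Function.Injective (T i))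
    (A : ι → Finset G) :
    (((Fintype.piFinset A).filter fun x => ∑ i, T i (x i) = 0).card : ℝ) ^ 2 ^ (l + 1) ≤
      ∏ i, (addNrg l (A i) : ℝ) := by
  have h := coeff_zero_prod_pow_le l Finset.univ (by simpa using hι)
    (fun i => ∑ x ∈ A i, AddMonoidAlgebra.single (T i x) (1 : ℝ))
  rw [coeff_zero_prod_sum_single (fun i x => T i x), Nat.abs_cast] at h
  exact h.trans (le_of_eq (Finset.prod_congr rfl fun i _ => coeff_zero_pow_sum_single l _ (hT i) _))

/-- The `L ^ (2 ^ (l + 1))`-norm attached to the additive energy. -/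
noncomputable def nrgNorm (l : ℕ) (A : Finset G) : ℝ :=
  (addNrg l A : ℝ) ^ ((2 ^ (l + 1) : ℕ) : ℝ)⁻¹

theorem nrgNorm_nonneg (l : ℕ) (A : Finset G) : 0 ≤ nrgNorm l A :=
  Real.rpow_nonneg (Nat.cast_nonneg _) _

theorem nrgNorm_pow (l : ℕ) (A : Finset G) : nrgNorm l A ^ 2 ^ (l + 1) = addNrg l A :=
  Real.rpow_inv_natCast_pow (Nat.cast_nonneg _) (by positivity)

theorem card_solutions_le {ι : Type*} [Fintype ι] [DecidableEq ι] [DecidableEq G] (l : ℕ)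
    (hι : Fintype.card ι = 2 ^ (l + 1)) (T : ι → G →+ G) (hT : ∀ i, Function.Injective (T i))
    (A : ι → Finset G) :
    (((Fintype.piFinset A).filter fun x => ∑ i, T i (x i) = 0).card : ℝ) ≤
      ∏ i, nrgNorm l (A i) := by
  refine le_of_pow_le_pow_left₀ (n := 2 ^ (l + 1)) (by positivity)
    (Finset.prod_nonneg fun i _ => nrgNorm_nonneg _ _) ?_
  rw [← Finset.prod_pow]
  simp only [nrgNorm_pow]
  exact card_solutions_pow_le l hι T hT A

theorem card_fin_pow_prod_bool (l : ℕ) : Fintype.card (Fin (2 ^ l) × Bool) = 2 ^ (l + 1) := by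
  simp [pow_succ]

theorem addNrg_le_card_pow (l : ℕ) (A : Finset G) : addNrg l A ≤ A.card ^ 2 ^ (l + 1) := by
  classical
  refine (Finset.card_filter_le _ _).trans (le_of_eq ?_)
  rw [Fintype.card_piFinset, Finset.prod_const, Finset.card_univ, card_fin_pow_prod_bool]

theorem nrgNorm_le_card (l : ℕ) (A : Finset G) : nrgNorm l A ≤ A.card := by
  refine le_of_pow_le_pow_left₀ (n := 2 ^ (l + 1)) (by positivity) (by positivity) ?_
  rw [nrgNorm_pow]
  exact_mod_cast addNrg_le_card_pow l A

theorem sum_near_mul_le (s : Finset ℤ) (W : ℕ) (e : ℤ → ℝ) :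
    ∑ c ∈ s, ∑ d ∈ s.filter (fun d => |c - d| ≤ W), e c * e d ≤
      (2 * W + 1) * ∑ c ∈ s, e c ^ 2 := by
  have hc : ∀ c : ℤ, (((s.filter (fun d => |c - d| ≤ W)).card : ℕ) : ℝ) ≤ 2 * W + 1 := by
    intro c
    have : s.filter (fun d => |c - d| ≤ W) ⊆ Finset.Icc (c - W) (c + W) := by
      intro d hd
      have := abs_le.1 (Finset.mem_filter.1 hd).2
      simp only [Finset.mem_Icc]; constructor <;> linarith
    have := Finset.card_le_card this
    rw [Int.card_Icc] at this
    have h2 : (c + (W : ℤ) + 1 - (c - W)).toNat = 2 * W + 1 := by omega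
    rw [h2] at this
    exact_mod_cast this
  have h1 : ∑ c ∈ s, ∑ d ∈ s.filter (fun d => |c - d| ≤ W), e c ^ 2 ≤
      (2 * W + 1) * ∑ c ∈ s, e c ^ 2 := by
    rw [Finset.mul_sum]
    refine Finset.sum_le_sum fun c _ => ?_
    rw [Finset.sum_const, nsmul_eq_mul]
    exact mul_le_mul_of_nonneg_right (hc c) (sq_nonneg _)
  have h2 : ∑ c ∈ s, ∑ d ∈ s.filter (fun d => |c - d| ≤ W), e d ^ 2 =
      ∑ c ∈ s, ∑ d ∈ s.filter (fun d => |c - d| ≤ W), e c ^ 2 := by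
    simp only [Finset.sum_filter]
    rw [Finset.sum_comm]
    refine Finset.sum_congr rfl fun c _ => Finset.sum_congr rfl fun d _ => ?_
    rw [abs_sub_comm]
  have h3 : ∑ c ∈ s, ∑ d ∈ s.filter (fun d => |c - d| ≤ W), 2 * (e c * e d) ≤
      ∑ c ∈ s, ∑ d ∈ s.filter (fun d => |c - d| ≤ W), (e c ^ 2 + e d ^ 2) :=
    Finset.sum_le_sum fun c _ => Finset.sum_le_sum fun d _ => by
      nlinarith [sq_nonneg (e c - e d)]
  simp only [Finset.sum_add_distrib, ← Finset.mul_sum, h2] at h3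
  simp only [← Finset.mul_sum] at h1 ⊢
  linarith

/-- If in every solution two of the variables have nearby labels, the energy decouples into the
fibres of the labelling. -/
theorem nrgNorm_sq_le_sum (l : ℕ) (A : Finset G) (φ : G → ℤ) (W : ℕ)
    (h : ∀ x : Fin (2 ^ l) × Bool → G, (∀ i, x i ∈ A) →
      ∑ i, (if i.2 then x i else - x i) = 0 → ∃ i j, i ≠ j ∧ |φ (x i) - φ (x j)| ≤ W) :
    nrgNorm l A ^ 2 ≤ (2 ^ (l + 1)) ^ 2 * (2 * W + 1) *
      ∑ c ∈ A.image φ, nrgNorm l (A.filter fun a => φ a = c) ^ 2 := by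
  classical
  set ι := Fin (2 ^ l) × Bool
  set e : ℤ → ℝ := fun c => nrgNorm l (A.filter fun a => φ a = c)
  set s := A.image φ
  have hS : 0 ≤ ∑ c ∈ s, e c ^ 2 := Finset.sum_nonneg fun _ _ => sq_nonneg _
  rcases (nrgNorm_nonneg l A).eq_or_lt with h0 | h0
  · rw [← h0, zero_pow two_ne_zero]; exact mul_nonneg (by positivity) hS
  let B : ι → ι → ℤ → ℤ → ι → Finset G := fun i j c d u =>
    if u = i then A.filter fun a => φ a = c else if u = j then A.filter fun a => φ a = d else A
  let T : ι → G →+ G := fun i => if i.2 then AddMonoidHom.id G else negAddMonoidHom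
  have hT : ∀ i, Function.Injective (T i) := by
    intro i
    by_cases hi : i.2 = true
    · simp only [T, hi, if_true]; exact fun _ _ h => h
    · simp only [T, hi]; exact neg_injective
  have hTx : ∀ i x, T i x = if i.2 then x else -x := by
    intro i x; by_cases hi : i.2 = true <;> simp [T, hi]
  have hB : ∀ i j c d, i ≠ j →
      (((Fintype.piFinset (B i j c d)).filter fun x => ∑ i, T i (x i) = 0).card : ℝ) ≤
        e c * e d * nrgNorm l A ^ (2 ^ (l + 1) - 2) := by
    intro i j c d hij
    refine (card_solutions_le l (card_fin_pow_prod_bool l) T hT _).trans (le_of_eq ?_)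
    rw [← Finset.mul_prod_erase _ _ (Finset.mem_univ i),
      ← Finset.mul_prod_erase _ _ (Finset.mem_erase.2 ⟨hij.symm, Finset.mem_univ j⟩), ← mul_assoc]
    congr 1
    · simp [B, e, hij.symm]
    · rw [Finset.prod_congr rfl (g := fun _ => nrgNorm l A)]
      · rw [Finset.prod_const, Finset.card_erase_of_mem (by simp [hij.symm]),
          Finset.card_erase_of_mem (by simp), Finset.card_univ, card_fin_pow_prod_bool]
        congr 1
      · intro u hu
        simp only [Finset.mem_erase] at hu
        simp [B, hu.1, hu.2.1]
  have hcover : ((Fintype.piFinset fun _ : ι => A).filter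
      fun x => ∑ i, (if i.2 then x i else - x i) = 0) ⊆
      (Finset.univ : Finset ι).offDiag.biUnion fun p => s.biUnion fun c =>
        (s.filter fun d => |c - d| ≤ W).biUnion fun d =>
          (Fintype.piFinset (B p.1 p.2 c d)).filter fun x => ∑ i, T i (x i) = 0 := by
    intro x hx
    simp only [Finset.mem_filter, Fintype.mem_piFinset] at hx
    obtain ⟨i, j, hij, hle⟩ := h x hx.1 hx.2
    simp only [Finset.mem_biUnion, Finset.mem_filter, Fintype.mem_piFinset, hTx]
    refine ⟨(i, j), by simpa using hij, φ (x i), Finset.mem_image_of_mem _ (hx.1 i), φ (x j),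
      ⟨Finset.mem_image_of_mem _ (hx.1 j), hle⟩, fun u => ?_, hx.2⟩
    simp only [B]
    split_ifs with h1 h2
    · subst h1; simp [hx.1]
    · subst h2; simp [hx.1]
    · exact hx.1 u
  have hmain : (addNrg l A : ℝ) ≤ ∑ p ∈ (Finset.univ : Finset ι).offDiag, ∑ c ∈ s,
      ∑ d ∈ s.filter (fun d => |c - d| ≤ W), e c * e d * nrgNorm l A ^ (2 ^ (l + 1) - 2) := by
    have h1 : addNrg l A ≤ ∑ p ∈ (Finset.univ : Finset ι).offDiag, ∑ c ∈ s,
      ∑ d ∈ s.filter (fun d => |c - d| ≤ W),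
        ((Fintype.piFinset (B p.1 p.2 c d)).filter fun x => ∑ i, T i (x i) = 0).card := by
      rw [addNrg]
      refine (Finset.card_le_card (by convert hcover)).trans ?_
      refine Finset.card_biUnion_le.trans (Finset.sum_le_sum fun p _ => ?_)
      refine Finset.card_biUnion_le.trans (Finset.sum_le_sum fun c _ => ?_)
      exact Finset.card_biUnion_le
    have h2 := (Nat.cast_le (α := ℝ)).2 h1
    push_cast at h2
    refine h2.trans (Finset.sum_le_sum fun p hp => Finset.sum_le_sum fun c _ =>
      Finset.sum_le_sum fun d _ => hB _ _ _ _ (by simpa using hp))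
  rw [Finset.sum_const, nsmul_eq_mul] at hmain
  simp only [← Finset.sum_mul] at hmain
  have hcard : (((Finset.univ : Finset ι).offDiag.card : ℕ) : ℝ) ≤ (2 ^ (l + 1)) ^ 2 := by
    rw [Finset.offDiag_card, Finset.card_univ, card_fin_pow_prod_bool]
    have : 2 ^ (l + 1) * 2 ^ (l + 1) - 2 ^ (l + 1) ≤ (2 ^ (l + 1)) ^ 2 := by
      rw [sq]; exact Nat.sub_le _ _
    exact_mod_cast this
  have hk : 2 ≤ 2 ^ (l + 1) := by
    have := Nat.pow_le_pow_right (n := 2) (by norm_num) (show 1 ≤ l + 1 by omega); simpa using this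
  have hsum := sum_near_mul_le s W e
  have hp : (0 : ℝ) < nrgNorm l A ^ (2 ^ (l + 1) - 2) := pow_pos h0 _
  refine le_of_mul_le_mul_right ?_ hp
  rw [← pow_add, Nat.add_sub_cancel' hk, nrgNorm_pow]
  refine hmain.trans ?_
  calc _ ≤ (2 ^ (l + 1)) ^ 2 * (((2 * W + 1) * ∑ c ∈ s, e c ^ 2) *
        nrgNorm l A ^ (2 ^ (l + 1) - 2)) := by
        refine mul_le_mul hcard (mul_le_mul_of_nonneg_right hsum hp.le) ?_ (by positivity)
        refine mul_nonneg (Finset.sum_nonneg fun c _ => Finset.sum_nonneg fun d _ =>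
          mul_nonneg (nrgNorm_nonneg _ _) (nrgNorm_nonneg _ _)) hp.le
    _ = _ := by ring

/-- Iterated decoupling along a list of labellings. -/
theorem nrgNorm_sq_le_of_list (l W : ℕ) (D : ℝ) (Φ : List (G → ℤ)) (A : Finset G)
    (h : ∀ φ ∈ Φ, ∀ x : Fin (2 ^ l) × Bool → G, (∀ i, x i ∈ A) →
      ∑ i, (if i.2 then x i else - x i) = 0 → ∃ i j, i ≠ j ∧ |φ (x i) - φ (x j)| ≤ W)
    (hD : ∀ B ⊆ A, (∀ φ ∈ Φ, ∀ x ∈ B, ∀ y ∈ B, φ x = φ y) → nrgNorm l B ^ 2 ≤ D * B.card) :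
    nrgNorm l A ^ 2 ≤ ((2 ^ (l + 1)) ^ 2 * (2 * W + 1)) ^ Φ.length * D * A.card := by
  classical
  induction Φ generalizing A with
  | nil => simpa using hD A subset_rfl (by simp)
  | cons φ Φ ih =>
    refine (nrgNorm_sq_le_sum l A φ W (h φ (by simp))).trans ?_
    generalize hκ : ((2 : ℝ) ^ (l + 1)) ^ 2 * (2 * W + 1) = κ at ih ⊢
    have hκ0 : 0 ≤ κ := by rw [← hκ]; positivity
    rw [List.length_cons, pow_succ', mul_assoc κ, mul_assoc κ]
    refine mul_le_mul_of_nonneg_left ?_ hκ0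
    rw [← sum_card_filter_eq A φ, Finset.mul_sum]
    refine Finset.sum_le_sum fun c _ => ih _ ?_ ?_
    · intro ψ hψ x hx
      exact h ψ (by simp [hψ]) x (fun i => (Finset.mem_filter.1 (hx i)).1)
    · intro B hB hB'
      refine hD B (hB.trans (Finset.filter_subset _ _)) ?_
      intro ψ hψ x hx y hy
      rcases List.mem_cons.1 hψ with rfl | hψ
      · rw [(Finset.mem_filter.1 (hB hx)).2, (Finset.mem_filter.1 (hB hy)).2]
      · exact hB' ψ hψ x hx y hy

end Energy

/-- A finite family of weighted absolute values on a field, together with a subring of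
"integers" on which the product of the absolute values is at least one. -/
structure PlaceSystem (L : Type u) [Field L] where
  V : Type u
  fin : Fintype V
  w : V → ℝ
  w_pos : ∀ v, 0 < w v
  abv : V → AbsoluteValue L ℝ
  arch : Finset V
  nonarch : ∀ v ∉ arch, IsNonarchimedean (abv v)
  sum_arch : ∑ v ∈ arch, w v = 1
  abv_natCast : ∀ v ∈ arch, ∀ n : ℕ, abv v n = n
  O : Subring L
  one_le_prod : ∀ x ∈ O, x ≠ 0 → 1 ≤ ∏ v, abv v x ^ w v

attribute [instance] PlaceSystem.fin

namespace PlaceSystem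

variable {L : Type u} [Field L] (P : PlaceSystem L)

/-- The group of units of the ring of integers, as nonzero field elements. -/
def IsU (x : L) : Prop := x ≠ 0 ∧ x ∈ P.O ∧ x⁻¹ ∈ P.O

variable {P}

theorem IsU.mul {x y : L} (hx : P.IsU x) (hy : P.IsU y) : P.IsU (x * y) :=
  ⟨mul_ne_zero hx.1 hy.1, mul_mem hx.2.1 hy.2.1, by rw [mul_inv]; exact mul_mem hx.2.2 hy.2.2⟩

theorem IsU.inv {x : L} (hx : P.IsU x) : P.IsU x⁻¹ :=
  ⟨inv_ne_zero hx.1, hx.2.2, by rw [inv_inv]; exact hx.2.1⟩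

theorem IsU.div {x y : L} (hx : P.IsU x) (hy : P.IsU y) : P.IsU (x / y) := by
  rw [div_eq_mul_inv]; exact hx.mul hy.inv

theorem IsU.neg {x : L} (hx : P.IsU x) : P.IsU (-x) :=
  ⟨neg_ne_zero.2 hx.1, neg_mem hx.2.1, by rw [inv_neg]; exact neg_mem hx.2.2⟩

theorem IsU.pow {x : L} (hx : P.IsU x) (k : ℕ) : P.IsU (x ^ k) :=
  ⟨pow_ne_zero _ hx.1, pow_mem hx.2.1 _, by rw [← inv_pow]; exact pow_mem hx.2.2 _⟩

theorem IsU.prod_eq_one {x : L} (hx : P.IsU x) : ∏ v, P.abv v x ^ P.w v = 1 := by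
  refine le_antisymm ?_ (P.one_le_prod x hx.2.1 hx.1)
  have h := P.one_le_prod _ hx.2.2 (inv_ne_zero hx.1)
  have h2 : ∏ v, P.abv v x⁻¹ ^ P.w v = (∏ v, P.abv v x ^ P.w v)⁻¹ := by
    rw [← Finset.prod_inv_distrib]
    refine Finset.prod_congr rfl fun v _ => ?_
    rw [map_inv₀, Real.inv_rpow (AbsoluteValue.nonneg _ _)]
  rw [h2] at h
  have hpos : 0 < ∏ v, P.abv v x ^ P.w v :=
    Finset.prod_pos fun v _ => Real.rpow_pos_of_pos ((P.abv v).pos hx.1) _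
  exact (one_le_inv₀ hpos).1 h

theorem exists_sum_pow_prime_eq {R : Type*} [CommRing R] {p : ℕ} (hp : p.Prime) {ι : Type*}
    (s : Finset ι) (t : ι → R) : ∃ r, (∑ i ∈ s, t i) ^ p = ∑ i ∈ s, t i ^ p + p * r := by
  classical
  induction s using Finset.induction_on with
  | empty => exact ⟨0, by simp [hp.ne_zero]⟩
  | insert a s ha ih =>
    obtain ⟨r, hr⟩ := ih
    obtain ⟨r', hr'⟩ := exists_add_pow_prime_eq hp (t a) (∑ i ∈ s, t i)
    rw [Finset.sum_insert ha, Finset.sum_insert ha]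
    exact ⟨r + t a * (∑ i ∈ s, t i) * r', by rw [hr', hr]; ring⟩

theorem abv_sum_pow_le (v : P.V) (hv : v ∉ P.arch) {p : ℕ} (hp : p.Prime) {ι : Type*}
    [Fintype ι] [Nonempty ι] (z : ι → L) (hz : ∑ i, z i = 0) (M : ℝ) (hM : ∀ i, P.abv v (z i) ≤ M) :
    P.abv v (∑ i, z i ^ p) ≤ P.abv v p * M ^ p := by
  classical
  obtain ⟨i₀, hi₀⟩ := Finite.exists_max fun i => P.abv v (z i)
  have hna := P.nonarch v hv
  have hM' : P.abv v (∑ i, z i ^ p) ≤ P.abv v p * P.abv v (z i₀) ^ p := by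
    by_cases h0 : z i₀ = 0
    · have : ∀ i, z i = 0 := fun i => (P.abv v).eq_zero.1
        (le_antisymm (by simpa [h0] using hi₀ i) ((P.abv v).nonneg _))
      simp [this, hp.ne_zero]
    let Ov : Subring L :=
      { carrier := {x | P.abv v x ≤ 1}
        mul_mem' := fun {a b} ha hb => by
          simp only [Set.mem_ofPred_eq, map_mul] at *
          exact mul_le_one₀ ha ((P.abv v).nonneg _) hb
        one_mem' := by simp
        add_mem' := fun {a b} ha hb => by
          simp only [Set.mem_ofPred_eq] at *
          exact (hna a b).trans (max_le ha hb)
        zero_mem' := by simp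
        neg_mem' := fun {a} ha => by simpa using ha }
    have ht : ∀ i, z i / z i₀ ∈ Ov := fun i => by
      change P.abv v _ ≤ 1
      rw [map_div₀]
      exact div_le_one_of_le₀ (hi₀ i) ((P.abv v).nonneg _)
    obtain ⟨r, hr⟩ := exists_sum_pow_prime_eq hp Finset.univ fun i => (⟨_, ht i⟩ : Ov)
    have hr2 := congrArg (Subtype.val) hr
    push_cast at hr2
    rw [← Finset.sum_div, hz, zero_div, zero_pow hp.ne_zero] at hr2
    have hr3 : ∑ i, z i ^ p = -(p * r) * z i₀ ^ p := by
      simp only [div_pow, ← Finset.sum_div] at hr2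
      field_simp at hr2
      linear_combination -hr2
    rw [hr3, map_mul, map_pow, AbsoluteValue.map_neg, map_mul]
    refine mul_le_mul_of_nonneg_right ?_ (pow_nonneg ((P.abv v).nonneg _) _)
    exact mul_le_of_le_one_right ((P.abv v).nonneg _) r.2
  refine hM'.trans (mul_le_mul_of_nonneg_left ?_ ((P.abv v).nonneg _))
  exact pow_le_pow_left₀ ((P.abv v).nonneg _) (hM i₀) _

theorem sum_pow_prime_eq_zero {ι : Type*} [Fintype ι] [Nonempty ι] {p : ℕ} (hp : p.Prime)
    (hpU : P.IsU (p : L)) (y : ι → L) (hyO : ∀ i, y i ∈ P.O) (hy : ∑ i, y i = 0) (M : P.V → ℝ)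
    (hM : ∀ v i, P.abv v (y i) ≤ M v)
    (hH : Fintype.card ι * (∏ v, M v ^ P.w v) ^ p < p) : ∑ i, y i ^ p = 0 := by
  classical
  by_contra hne
  have hM0 : ∀ v, 0 ≤ M v := fun v =>
    ((P.abv v).nonneg _).trans (hM v (Classical.arbitrary ι))
  have hp0 : (0 : ℝ) < p := by exact_mod_cast hp.pos
  have h1 := P.one_le_prod _ (sum_mem fun i _ => pow_mem (hyO i) p) hne
  have hv : ∀ v, P.abv v (∑ i, y i ^ p) ≤
      (P.abv v p * M v ^ p) * (if v ∈ P.arch then (Fintype.card ι / p : ℝ) else 1) := by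
    intro v
    split_ifs with h
    · rw [P.abv_natCast v h]
      calc _ ≤ ∑ i, P.abv v (y i ^ p) := (P.abv v).sum_le _ _
        _ ≤ ∑ _i : ι, M v ^ p := Finset.sum_le_sum fun i _ => by
            rw [map_pow]; exact pow_le_pow_left₀ ((P.abv v).nonneg _) (hM v i) _
        _ = _ := by
            rw [Finset.sum_const, Finset.card_univ, nsmul_eq_mul]; field_simp
    · rw [mul_one]
      exact abv_sum_pow_le v h hp y hy _ (hM v)
  have h2 : ∏ v, P.abv v (∑ i, y i ^ p) ^ P.w v ≤
      (∏ v, M v ^ P.w v) ^ p * (Fintype.card ι / p : ℝ) := by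
    calc _ ≤ ∏ v, ((P.abv v p * M v ^ p) *
          (if v ∈ P.arch then (Fintype.card ι / p : ℝ) else 1)) ^ P.w v :=
          Finset.prod_le_prod (fun v _ => Real.rpow_nonneg ((P.abv v).nonneg _) _)
            fun v _ => Real.rpow_le_rpow ((P.abv v).nonneg _) (hv v) (P.w_pos v).le
      _ = ∏ v, ((P.abv v p ^ P.w v * (M v ^ P.w v) ^ p) *
          (if v ∈ P.arch then (Fintype.card ι / p : ℝ) ^ P.w v else 1)) := by
          refine Finset.prod_congr rfl fun v _ => ?_
          rw [Real.mul_rpow (mul_nonneg ((P.abv v).nonneg _) (pow_nonneg (hM0 v) _))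
            (by split_ifs <;> positivity), Real.mul_rpow ((P.abv v).nonneg _)
            (pow_nonneg (hM0 v) _), ← Real.rpow_natCast, ← Real.rpow_natCast,
            ← Real.rpow_mul (hM0 v), ← Real.rpow_mul (hM0 v), mul_comm (p : ℝ)]
          congr 1
          split_ifs <;> simp
      _ = _ := by
          rw [Finset.prod_mul_distrib, Finset.prod_mul_distrib, hpU.prod_eq_one, one_mul,
            Finset.prod_pow, Finset.prod_ite_mem, Finset.univ_inter,
            ← Real.rpow_sum_of_pos (by positivity), P.sum_arch, Real.rpow_one]
  have h3 := h1.trans h2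
  rw [mul_div_assoc', le_div_iff₀ hp0, one_mul, mul_comm] at h3
  exact absurd h3 (not_le.2 hH)

theorem one_le_prod_of_le {ι : Type*} (y : ι → L) (i : ι) (hyO : y i ∈ P.O)
    (hy0 : y i ≠ 0) (M : P.V → ℝ) (hM : ∀ v, P.abv v (y i) ≤ M v) :
    1 ≤ ∏ v, M v ^ P.w v :=
  (P.one_le_prod _ hyO hy0).trans <| Finset.prod_le_prod
    (fun v _ => Real.rpow_nonneg ((P.abv v).nonneg _) _)
    fun v _ => Real.rpow_le_rpow ((P.abv v).nonneg _) (hM v) (P.w_pos v).le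

theorem sum_pow_eq_zero {ι : Type*} [Fintype ι] [Nonempty ι] (B : ℕ)
    (hB : ∀ p ≤ B, p.Prime → P.IsU (p : L)) (y : ι → L) (hyO : ∀ i, y i ∈ P.O)
    (hy0 : ∀ i, y i ≠ 0) (hy : ∑ i, y i = 0) (M : P.V → ℝ) (hM : ∀ v i, P.abv v (y i) ≤ M v)
    (hH : Fintype.card ι * (∏ v, M v ^ P.w v) ^ B < Fintype.card ι + 1) (q : ℕ) (hq0 : q ≠ 0)
    (hqB : q ≤ B) (hq : ∀ p, p.Prime → p ∣ q → Fintype.card ι < p) : ∑ i, y i ^ q = 0 := by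
  have hM0 : ∀ v, 0 ≤ M v := fun v =>
    ((P.abv v).nonneg _).trans (hM v (Classical.arbitrary ι))
  have hH1 := one_le_prod_of_le (P := P) y (Classical.arbitrary ι) (hyO _) (hy0 _) M
    fun v => hM v _
  induction q using induction_on_primes with
  | zero => exact absurd rfl hq0
  | one => simpa using hy
  | prime_mul p a hp ih =>
    have ha0 : a ≠ 0 := right_ne_zero_of_mul hq0
    have hpB : p ≤ B := le_trans (Nat.le_mul_of_pos_right _ (Nat.pos_of_ne_zero ha0)) hqB
    have haB : a ≤ B := le_trans (Nat.le_mul_of_pos_left _ hp.pos) hqB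
    have := ih ha0 haB fun r hr hra => hq r hr (hra.mul_left p)
    have h := sum_pow_prime_eq_zero hp (hB p hpB hp) (fun i => y i ^ a)
      (fun i => pow_mem (hyO i) _) this (fun v => M v ^ a)
      (fun v i => by
        rw [map_pow]; exact pow_le_pow_left₀ ((P.abv v).nonneg _) (hM v i) _) ?_
    · simpa only [← pow_mul, mul_comm a p] using h
    · have e : ∏ v, (M v ^ a) ^ P.w v = (∏ v, M v ^ P.w v) ^ a := by
        rw [← Finset.prod_pow]
        refine Finset.prod_congr rfl fun v _ => ?_
        rw [← Real.rpow_natCast, ← Real.rpow_natCast, ← Real.rpow_mul (hM0 v),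
          ← Real.rpow_mul (hM0 v), mul_comm]
      rw [e, ← pow_mul, mul_comm a p]
      have h1 : (Fintype.card ι : ℝ) + 1 ≤ p := by exact_mod_cast hq p hp (dvd_mul_right _ _)
      refine lt_of_lt_of_le (lt_of_le_of_lt ?_ hH) h1
      exact mul_le_mul_of_nonneg_left (pow_le_pow_right₀ hH1 hqB) (Nat.cast_nonneg _)

/-- Small solutions of a unit equation split into subsums with equal `n !`-th powers. -/
theorem sum_filter_pow_eq_zero [DecidableEq L] {ι : Type*} [Fintype ι] (n : ℕ)
    (hn : Fintype.card ι = n)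
    (hB : ∀ p ≤ 1 + n * n.factorial, p.Prime → P.IsU (p : L)) (y : ι → L)
    (hyO : ∀ i, y i ∈ P.O) (hy0 : ∀ i, y i ≠ 0) (hy : ∑ i, y i = 0) (M : P.V → ℝ)
    (hM : ∀ v i, P.abv v (y i) ≤ M v)
    (hH : n * (∏ v, M v ^ P.w v) ^ (1 + n * n.factorial) < n + 1) (z : L) :
    ∑ i with y i ^ n.factorial = z, y i = 0 := by
  classical
  rcases isEmpty_or_nonempty ι with hι | hι
  · simp
  by_cases hz : ∃ i, y i ^ n.factorial = z
  swap
  · rw [Finset.filter_false_of_mem (fun i _ h => hz ⟨i, h⟩)]; simp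
  obtain ⟨i₀, hi₀⟩ := hz
  set m := n.factorial
  have hpow : ∀ i < n, ∑ j, y j * (y j ^ m) ^ i = 0 := by
    intro i hi
    have := sum_pow_eq_zero (1 + n * m) hB y hyO hy0 hy M hM (by simpa only [hn] using hH)
      (1 + i * m) (by omega) (by gcongr) ?_
    · rw [← this]
      refine Finset.sum_congr rfl fun j _ => ?_
      rw [pow_add, pow_one, mul_comm i m, pow_mul]
    · intro p hp hd
      rw [hn]
      by_contra hle
      have h1 : p ∣ m := hp.dvd_factorial.2 (not_lt.1 hle)
      have h2 : p ∣ 1 := (Nat.dvd_add_left (h1.mul_left i)).1 hd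
      exact hp.one_lt.ne' (Nat.dvd_one.1 h2)
  have hpoly : ∀ f : Polynomial L, f.natDegree < n → ∑ j, y j * f.eval (y j ^ m) = 0 := by
    intro f hf
    simp only [Polynomial.eval_eq_sum_range' hf, Finset.mul_sum]
    rw [Finset.sum_comm]
    refine Finset.sum_eq_zero fun i hi => ?_
    have := hpow i (Finset.mem_range.1 hi)
    calc _ = f.coeff i * ∑ j, y j * (y j ^ m) ^ i := by
          rw [Finset.mul_sum]; exact Finset.sum_congr rfl fun j _ => by ring
      _ = 0 := by rw [this, mul_zero]
  set Z : Finset L := (Finset.univ.image fun i => y i ^ m).erase z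
  have hZcard : Z.card < n := by
    have hmem : z ∈ Finset.univ.image fun i => y i ^ m := by simp [← hi₀]
    have h1 := Finset.card_erase_lt_of_mem hmem
    have h2 : (Finset.univ.image fun i => y i ^ m).card ≤ n := by
      rw [← hn]; exact Finset.card_image_le
    exact lt_of_lt_of_le h1 h2
  let f : Polynomial L := ∏ c ∈ Z, (Polynomial.X - Polynomial.C c)
  have hf := hpoly f (by rw [Polynomial.natDegree_finsetProd_X_sub_C_eq_card]; exact hZcard)
  have hfz : f.eval z ≠ 0 := by
    simp only [f, Polynomial.eval_prod, Polynomial.eval_sub, Polynomial.eval_X,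
      Polynomial.eval_C]
    refine Finset.prod_ne_zero_iff.2 fun c hc => sub_ne_zero.2 fun h => ?_
    exact (Finset.mem_erase.1 hc).1 h.symm
  have hsplit : ∑ j, y j * f.eval (y j ^ m) = (∑ i with y i ^ m = z, y i) * f.eval z := by
    rw [Finset.sum_mul, Finset.sum_filter]
    refine Finset.sum_congr rfl fun j _ => ?_
    split_ifs with h
    · rw [h]
    · have : f.eval (y j ^ m) = 0 := by
        simp only [f, Polynomial.eval_prod, Polynomial.eval_sub, Polynomial.eval_X,
          Polynomial.eval_C]
        exact Finset.prod_eq_zero (i := y j ^ m) (by simp [Z, h]) (sub_self _)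
      rw [this, mul_zero]
  rw [hsplit] at hf
  exact (mul_eq_zero.1 hf).resolve_right hfz

end PlaceSystem

open NumberField in
/-- Every finite set of nonzero elements of a number field consists of units for a suitable
finite system of places. -/
theorem exists_placeSystem (L : Type u) [Field L] [NumberField L] (F : Finset L)
    (hF : ∀ x ∈ F, x ≠ 0) : ∃ P : PlaceSystem L, ∀ x ∈ F, P.IsU x := by
  classical
  have hfin : ∀ x : L, x ≠ 0 → {w : FinitePlace L | w x ≠ 1}.Finite := fun x hx =>
    FinitePlace.hasFiniteMulSupport hx
  have hSfin : (⋃ x ∈ F, {w : FinitePlace L | w x ≠ 1}).Finite :=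
    Set.Finite.biUnion F.finite_toSet fun x hx => hfin x (hF x hx)
  let S : Finset (FinitePlace L) := hSfin.toFinset
  have hS : ∀ w ∉ S, ∀ x ∈ F, w x = 1 := by
    intro w hw x hx
    by_contra h
    exact hw (hSfin.mem_toFinset.2 (Set.mem_biUnion hx h))
  set d : ℝ := ((Module.finrank ℚ L : ℕ) : ℝ)
  have hd : 0 < d := Nat.cast_pos.2 (Module.finrank_pos (R := ℚ) (M := L))
  let O : Subring L :=
    { carrier := {x | ∀ w ∉ S, w x ≤ 1}
      mul_mem' := fun {a b} ha hb w hw => by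
        rw [map_mul]; exact mul_le_one₀ (ha w hw) (apply_nonneg w _) (hb w hw)
      one_mem' := fun w hw => by simp
      add_mem' := fun {a b} ha hb w hw =>
        (FinitePlace.add_le w a b).trans (max_le (ha w hw) (hb w hw))
      zero_mem' := fun w hw => by simp
      neg_mem' := fun {a} ha w hw => by
        rw [map_neg_eq_map w]; exact ha w hw }
  refine ⟨
    { V := InfinitePlace L ⊕ {w : FinitePlace L // w ∈ S}
      fin := inferInstance
      w := Sum.elim (fun v => v.mult / d) (fun _ => 1 / d)
      w_pos := ?_
      abv := Sum.elim (fun v => v.1) (fun v => v.1.1)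
      arch := Finset.univ.image Sum.inl
      nonarch := ?_
      sum_arch := ?_
      abv_natCast := ?_
      O := O
      one_le_prod := ?_ }, ?_⟩
  · rintro (v | v)
    · exact div_pos (by exact_mod_cast InfinitePlace.mult_pos) hd
    · exact div_pos one_pos hd
  · rintro (v | v) hv
    · simp at hv
    · exact FinitePlace.add_le v.1
  · rw [Finset.sum_image (fun _ _ _ _ h => Sum.inl_injective h)]
    simp only [Sum.elim_inl]
    rw [← Finset.sum_div, div_eq_one_iff_eq hd.ne']
    rw [← Nat.cast_sum, InfinitePlace.sum_mult_eq]
  · rintro (v | v) hv n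
    · change v (n : L) = n
      simp
    · simp at hv
  · intro x hx hx0
    rw [Fintype.prod_sum_type]
    have h1 : ∏ᶠ w : FinitePlace L, w x ≤ ∏ w : {w : FinitePlace L // w ∈ S}, w.1 x := by
      rw [finprod_eq_prod_of_mulSupport_subset (s := (hfin x hx0).toFinset ∪ S) _
        (by intro w hw; simp only [Finset.coe_union, Set.mem_union]; left
            exact (hfin x hx0).mem_toFinset.2 hw),
        Finset.prod_coe_sort S (fun w : FinitePlace L => w x),
        ← Finset.prod_sdiff (s₁ := S) Finset.subset_union_right]
      refine mul_le_of_le_one_left (Finset.prod_nonneg fun w _ => apply_nonneg w _) ?_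
      exact Finset.prod_le_one (fun w _ => apply_nonneg w _)
        fun w hw => hx w (Finset.mem_sdiff.1 hw).2
    have h2 := prod_abs_eq_one hx0
    have h3 : 1 ≤ (∏ w : InfinitePlace L, w x ^ w.mult) *
        ∏ w : {w : FinitePlace L // w ∈ S}, w.1 x := by
      rw [← h2]
      exact mul_le_mul_of_nonneg_left h1
         (Finset.prod_nonneg fun w _ => pow_nonneg (apply_nonneg w _) _)
    have h4 := Real.one_le_rpow h3 (z := 1 / d) (by positivity)
    rw [Real.mul_rpow
         (Finset.prod_nonneg fun w _ => pow_nonneg (apply_nonneg w _) _)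
      (Finset.prod_nonneg fun w _ => apply_nonneg w.1 _),
      ← Real.finsetProd_rpow _ _ (fun w _ => pow_nonneg (apply_nonneg w _) _),
      ← Real.finsetProd_rpow _ _ (fun w _ => apply_nonneg w.1 _)] at h4
    refine h4.trans (le_of_eq ?_)
    congr 1
    refine Finset.prod_congr rfl fun v _ => ?_
    simp only [Sum.elim_inl]
    rw [← Real.rpow_natCast, ← Real.rpow_mul (apply_nonneg v _), mul_one_div]
    rfl
  · intro x hx
    refine ⟨hF x hx, fun w hw => (hS w hw x hx).le, fun w hw => ?_⟩
    rw [map_inv₀, hS w hw x hx, inv_one]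

theorem exists_numberField_hom (R : Type u) [CommRing R] [Nontrivial R] [Algebra ℚ R]
    [Algebra.FiniteType ℚ R] :
    ∃ (L : Type u) (_ : Field L) (_ : NumberField L), Nonempty (R →+* L) := by
  obtain ⟨m, hm⟩ := Ideal.exists_maximal R
  let : Field (R ⧸ m) := Ideal.Quotient.field m
  have hfin : Module.Finite ℚ (R ⧸ m) := finite_of_finite_type_of_isJacobsonRing ℚ (R ⧸ m)
  have h0 : CharZero (R ⧸ m) := algebraRat.charZero _
  refine ⟨R ⧸ m, inferInstance, @NumberField.mk _ _ h0 ?_, ⟨Ideal.Quotient.mk m⟩⟩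
  convert hfin
  exact Subsingleton.elim _ _

/-- Specialization of a finite set of nonzero elements of a field of characteristic zero to
units of a number field. -/
theorem exists_specialization {K : Type u} [Field K] [CharZero K] (F : Finset K)
    (hF : ∀ x ∈ F, x ≠ 0) (B : ℕ) :
    ∃ (L : Type u) (_ : Field L) (_ : CharZero L) (P : PlaceSystem L) (R : Subring K)
      (σ : R →+* L), (∀ x ∈ F, ∃ h : x ∈ R, P.IsU (σ ⟨x, h⟩)) ∧
        ∀ p : ℕ, p ≠ 0 → p ≤ B → P.IsU (p : L) := by
  classical
  let R := Algebra.adjoin ℚ ((F ∪ F.image (fun x => x⁻¹) : Finset K) : Set K)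
  have : Algebra.FiniteType ℚ R :=
    (Subalgebra.fg_iff_finiteType R).1 (Subalgebra.fg_adjoin_finset _)
  obtain ⟨L, _, _, ⟨σ⟩⟩ := exists_numberField_hom R
  have hmem : ∀ x ∈ F, x ∈ R := fun x hx => Algebra.subset_adjoin (by simp [hx])
  have hmem' : ∀ x ∈ F, x⁻¹ ∈ R := fun x hx => Algebra.subset_adjoin (by
    simp only [Finset.coe_union, Finset.coe_image]; right; exact ⟨x, hx, rfl⟩)
  have hσ : ∀ x (hx : x ∈ F), σ ⟨x, hmem x hx⟩ ≠ 0 := by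
    intro x hx h
    have h1 : σ ⟨x, hmem x hx⟩ * σ ⟨x⁻¹, hmem' x hx⟩ = 1 := by
      rw [← map_mul, ← map_one σ]
      congr 1
      exact Subtype.ext (mul_inv_cancel₀ (hF x hx))
    rw [h, zero_mul] at h1
    exact zero_ne_one h1
  let τ : {x // x ∈ F} → L := fun x => σ ⟨x.1, hmem x.1 x.2⟩
  have hne : ∀ x ∈ F.attach.image τ ∪ (Finset.Icc 1 B).image (fun n : ℕ => (n : L)), x ≠ 0 := by
    intro x hx
    rcases Finset.mem_union.1 hx with hx | hx
    · obtain ⟨y, -, rfl⟩ := Finset.mem_image.1 hx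
      exact hσ y.1 y.2
    · obtain ⟨n, hn, rfl⟩ := Finset.mem_image.1 hx
      exact Nat.cast_ne_zero.2 (by have := (Finset.mem_Icc.1 hn).1; omega)
  obtain ⟨P, hP⟩ := exists_placeSystem L _ hne
  refine ⟨L, inferInstance, inferInstance, P, R.toSubring, σ, fun x hx => ⟨hmem x hx, ?_⟩, ?_⟩
  · refine hP _ (Finset.mem_union_left _ ?_)
    exact Finset.mem_image.2 ⟨⟨x, hx⟩, Finset.mem_attach _ _, rfl⟩
  · intro p hp hpB
    refine hP _ (Finset.mem_union_right _ ?_)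
    exact Finset.mem_image.2 ⟨p, Finset.mem_Icc.2 ⟨Nat.one_le_iff_ne_zero.2 hp, hpB⟩, rfl⟩

/-- `a` is multiplicatively dependent on the family `g`, up to a positive power. -/
def RankLE {K : Type*} [Field K] {ρ : ℕ} (g : Fin ρ → K) (a : K) : Prop :=
  ∃ k : ℕ, 0 < k ∧ ∃ e f : Fin ρ → ℕ, a ^ k * ∏ i, g i ^ e i = ∏ i, g i ^ f i

theorem exists_list_dominating (ρ : ℕ) : ∀ {V : Type*} [Finite V] (τ : V → Fin ρ → ℝ),
    ∃ J : List V, J.length ≤ ρ ∧ ∀ (d : Fin ρ → ℝ) (w : ℝ),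
      (∀ j ∈ J, |∑ i, d i * τ j i| ≤ w) → 0 ≤ w → ∀ v, |∑ i, d i * τ v i| ≤ 3 ^ ρ * w := by
  induction ρ with
  | zero => exact fun τ => ⟨[], by simp, fun d w _ hw v => by simpa using hw⟩
  | succ ρ ih =>
    intro V _ τ
    rcases isEmpty_or_nonempty V with hV | hV
    · exact ⟨[], by simp, fun d w _ _ v => (hV.false v).elim⟩
    obtain ⟨v₀, hv₀⟩ := Finite.exists_max fun v => |τ v 0|
    obtain ⟨c, hc, hc1⟩ : ∃ c : V → ℝ, (∀ v, τ v 0 = c v * τ v₀ 0) ∧ ∀ v, |c v| ≤ 1 := by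
      refine ⟨fun v => τ v 0 / τ v₀ 0, fun v => ?_, fun v => ?_⟩
      · by_cases h : τ v₀ 0 = 0
        · have := hv₀ v
          rw [h, abs_zero] at this
          rw [h, mul_zero]
          exact abs_eq_zero.1 (le_antisymm this (abs_nonneg _))
        · field_simp
      · rw [abs_div]
        exact div_le_one_of_le₀ (hv₀ v) (abs_nonneg _)
    obtain ⟨J, hJ, h⟩ := ih fun v (i : Fin ρ) => τ v i.succ - c v * τ v₀ i.succ
    have key : ∀ (d : Fin (ρ + 1) → ℝ) v, ∑ i, d i * τ v i =
        ∑ i : Fin ρ, d i.succ * (τ v i.succ - c v * τ v₀ i.succ) + c v * ∑ i, d i * τ v₀ i := by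
      intro d v
      rw [Fin.sum_univ_succ, Fin.sum_univ_succ, hc v, mul_add, Finset.mul_sum]
      simp only [mul_sub, Finset.sum_sub_distrib]
      have : ∑ i : Fin ρ, c v * (d i.succ * τ v₀ i.succ) =
          ∑ i : Fin ρ, d i.succ * (c v * τ v₀ i.succ) :=
        Finset.sum_congr rfl fun i _ => by ring
      rw [this]; ring
    refine ⟨v₀ :: J, by simpa using hJ, fun d w hw hw0 v => ?_⟩
    have h0 : |∑ i, d i * τ v₀ i| ≤ w := hw v₀ (by simp)
    have hcb : ∀ v, |c v * ∑ i, d i * τ v₀ i| ≤ w := fun v => by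
      rw [abs_mul]
      exact (mul_le_of_le_one_left (abs_nonneg _) (hc1 v)).trans h0
    have h1 := h (fun i => d i.succ) (2 * w) (fun j hj => by
      have e := key d j
      have e1 := hw j (by simp [hj])
      have e2 := hcb j
      rw [← sub_eq_iff_eq_add] at e
      rw [← e]
      exact (abs_sub _ _).trans (by linarith)) (by linarith) v
    rw [key d v]
    have h3 : (1 : ℝ) ≤ 3 ^ ρ := one_le_pow₀ (by norm_num)
    calc _ ≤ _ := abs_add_le _ _
      _ ≤ 3 ^ ρ * (2 * w) + w := add_le_add h1 (hcb v)
      _ ≤ 3 ^ (ρ + 1) * w := by rw [pow_succ]; nlinarith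

namespace PlaceSystem

variable {L : Type u} [Field L] {P : PlaceSystem L}

theorem IsU.abv_pos {x : L} (hx : P.IsU x) (v : P.V) : 0 < P.abv v x := (P.abv v).pos hx.1

theorem exists_log_coords {ρ : ℕ} {g : Fin ρ → L} (hg : ∀ i, P.IsU (g i)) {a : L}
    (ha : P.IsU a) (h : RankLE g a) :
    ∃ q : Fin ρ → ℝ, ∀ v, Real.log (P.abv v a) = ∑ i, q i * Real.log (P.abv v (g i)) := by
  obtain ⟨k, hk, e, f, h⟩ := h
  refine ⟨fun i => ((f i : ℝ) - e i) / k, fun v => ?_⟩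
  have h1 := congrArg (fun x => Real.log (P.abv v x)) h
  have hne : ∀ i (m : ℕ), P.abv v (g i) ^ m ≠ 0 := fun i m => pow_ne_zero _ ((hg i).abv_pos v).ne'
  simp only [map_mul, map_pow, map_prod] at h1
  rw [Real.log_mul (pow_ne_zero _ (ha.abv_pos v).ne')
    (Finset.prod_ne_zero_iff.2 fun i _ => hne i _),
    Real.log_prod fun i _ => hne i _, Real.log_prod fun i _ => hne i _, Real.log_pow] at h1
  simp only [Real.log_pow] at h1
  have hk' : (k : ℝ) ≠ 0 := by exact_mod_cast hk.ne'
  have h2 : ∀ i, ((f i : ℝ) - e i) / k * Real.log (P.abv v (g i)) =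
      f i * Real.log (P.abv v (g i)) / k - e i * Real.log (P.abv v (g i)) / k := fun i => by ring
  simp only [h2]
  rw [Finset.sum_sub_distrib, ← Finset.sum_div, ← Finset.sum_div, ← sub_div, eq_div_iff hk']
  linarith

/-- In a vanishing sum, the largest absolute value is nearly attained twice. -/
theorem exists_ne_abv_le {ι : Type*} [Fintype ι] [Nontrivial ι] {x : ι → L} (v : P.V)
    (hx : ∑ i, x i = 0) : ∃ i j, i ≠ j ∧ P.abv v (x j) ≤ P.abv v (x i) ∧
      P.abv v (x i) ≤ (Fintype.card ι) * P.abv v (x j) ∧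
      (v ∉ P.arch → P.abv v (x i) = P.abv v (x j)) := by
  classical
  obtain ⟨i, hi⟩ := Finite.exists_max fun i => P.abv v (x i)
  obtain ⟨j₀, hj₀⟩ := exists_ne i
  obtain ⟨j, hj, hjm⟩ := Finset.exists_max_image (Finset.univ.erase i) (fun i => P.abv v (x i))
    ⟨j₀, by simp [hj₀]⟩
  have hsum : x i = -∑ j ∈ Finset.univ.erase i, x j := by
    rw [eq_neg_iff_add_eq_zero, Finset.add_sum_erase _ _ (Finset.mem_univ i), hx]
  refine ⟨i, j, (Finset.ne_of_mem_erase hj).symm, hi j, ?_, fun hv => ?_⟩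
  · rw [hsum, AbsoluteValue.map_neg]
    refine ((P.abv v).sum_le _ _).trans ((Finset.sum_le_card_nsmul _ _ _ hjm).trans ?_)
    rw [nsmul_eq_mul]
    refine mul_le_mul_of_nonneg_right ?_ ((P.abv v).nonneg _)
    exact_mod_cast Finset.card_le_univ _
  · refine le_antisymm ?_ (hi j)
    rw [hsum, AbsoluteValue.map_neg]
    have hn := P.nonarch v hv
    obtain ⟨k, hk, hk'⟩ := hn.finset_image_add_of_nonempty (t := Finset.univ.erase i) x ⟨j, hj⟩
    exact hk'.trans (hjm k hk)

/-- In a vanishing sum of units of nearly the same size at each place, every term has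
a partner with the same `n !`-th power. -/
theorem exists_ne_pow_eq {ι : Type*} [Fintype ι] (n : ℕ) (hn : Fintype.card ι = n)
    (hB : ∀ p ≤ 1 + n * n.factorial, p.Prime → P.IsU (p : L)) {x : ι → L}
    (hxU : ∀ i, P.IsU (x i)) (hx : ∑ i, x i = 0) (ε : ℝ)
    (harch : ∀ v ∈ P.arch, ∀ i j, P.abv v (x i) ≤ Real.exp ε * P.abv v (x j))
    (hnon : ∀ v ∉ P.arch, ∀ i j, P.abv v (x i) = P.abv v (x j))
    (hε : n * Real.exp ε ^ (1 + n * n.factorial) < n + 1) (i : ι) :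
    ∃ j, j ≠ i ∧ x j ^ n.factorial = x i ^ n.factorial := by
  classical
  have h := sum_filter_pow_eq_zero (P := P) n hn hB (fun j => x j / x i)
    (fun j => ((hxU j).div (hxU i)).2.1) (fun j => ((hxU j).div (hxU i)).1)
    (by rw [← Finset.sum_div, hx, zero_div])
    (fun v => if v ∈ P.arch then Real.exp ε else 1) (fun v j => ?_) ?_ 1
  · by_contra! hcon
    have : (Finset.univ.filter fun j => (x j / x i) ^ n.factorial = 1) = {i} := by
      ext j
      simp only [Finset.mem_filter, Finset.mem_univ, true_and, Finset.mem_singleton]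
      constructor
      · intro hj
        by_contra hne
        refine hcon j hne ?_
        rwa [div_pow, div_eq_one_iff_eq (pow_ne_zero _ (hxU i).1)] at hj
      · rintro rfl
        rw [div_self (hxU j).1, one_pow]
    rw [this, Finset.sum_singleton, div_self (hxU i).1] at h
    exact one_ne_zero h
  · rw [map_div₀]
    split_ifs with hv
    · rw [div_le_iff₀ ((hxU i).abv_pos v)]
      exact harch v hv j i
    · rw [hnon v hv j i, div_self ((hxU i).abv_pos v).ne']
  · have : ∏ v, (if v ∈ P.arch then Real.exp ε else 1) ^ P.w v = Real.exp ε := by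
      have : ∀ v, (if v ∈ P.arch then Real.exp ε else 1) ^ P.w v =
        if v ∈ P.arch then Real.exp ε ^ P.w v else 1 := fun v => by split_ifs <;> simp
      simp only [this]
      rw [Finset.prod_ite_mem, Finset.univ_inter, ← Real.rpow_sum_of_pos (Real.exp_pos _),
        P.sum_arch, Real.rpow_one]
    rw [this]; exact hε

theorem exists_separating_scale (A : Finset L) :
    ∃ t : ℝ, 1 ≤ t ∧ ∀ v : P.V, ∀ x ∈ A, ∀ y ∈ A,
      Real.log (P.abv v x) ≠ Real.log (P.abv v y) →
      1 ≤ t * |Real.log (P.abv v x) - Real.log (P.abv v y)| := by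
  classical
  let f : P.V × L × L → ℝ := fun p =>
    |Real.log (P.abv p.1 p.2.1) - Real.log (P.abv p.1 p.2.2)|⁻¹
  obtain ⟨t, ht⟩ := ((Finset.univ ×ˢ A ×ˢ A).image f).bddAbove
  refine ⟨max t 1, le_max_right _ _, fun v x hx y hy hne => ?_⟩
  have h1 : f (v, x, y) ≤ t := ht (by
    simp only [Finset.coe_image]
    exact ⟨(v, x, y), by simp [hx, hy], rfl⟩)
  have h2 : 0 < |Real.log (P.abv v x) - Real.log (P.abv v y)| := abs_pos.2 (sub_ne_zero.2 hne)
  calc (1 : ℝ) = f (v, x, y) * |Real.log (P.abv v x) - Real.log (P.abv v y)| :=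
        (inv_mul_cancel₀ h2.ne').symm
    _ ≤ _ := mul_le_mul_of_nonneg_right (h1.trans (le_max_left _ _)) h2.le

/-- A set in which every solution of the energy equation has two variables with equal
`M`-th powers has nearly diagonal energy. -/
theorem nrgNorm_sq_le_of_pow_eq (l M : ℕ) (hM : 0 < M) (A : Finset L)
    (h : ∀ x : Fin (2 ^ l) × Bool → L, (∀ i, x i ∈ A) →
      ∑ i, (if i.2 then x i else - x i) = 0 → ∃ i j, i ≠ j ∧ x i ^ M = x j ^ M) :
    nrgNorm l A ^ 2 ≤ (2 ^ (l + 1)) ^ 2 * M * A.card := by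
  classical
  let e := (A.image fun x => x ^ M).equivFin
  let φ : L → ℤ := fun x => if hx : x ^ M ∈ A.image fun x => x ^ M then (e ⟨_, hx⟩ : ℕ) else 0
  have hφ : ∀ x ∈ A, ∀ y ∈ A, φ x = φ y → x ^ M = y ^ M := by
    intro x hx y hy hxy
    have hx' := Finset.mem_image_of_mem (fun x => x ^ M) hx
    have hy' := Finset.mem_image_of_mem (fun x => x ^ M) hy
    simp only [φ, dif_pos hx', dif_pos hy'] at hxy
    have := e.injective (Fin.ext (Nat.cast_injective hxy))
    exact congrArg Subtype.val this
  have hφ' : ∀ x y, x ^ M = y ^ M → φ x = φ y := by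
    intro x y hxy
    simp only [φ, hxy]
  refine (nrgNorm_sq_le_sum l A φ 0 ?_).trans ?_
  · intro x hx hs
    obtain ⟨i, j, hij, hp⟩ := h x hx hs
    exact ⟨i, j, hij, by rw [hφ' _ _ hp]; simp⟩
  · have h1 : ∀ c ∈ A.image φ, nrgNorm l (A.filter fun a => φ a = c) ^ 2 ≤
        M * ((A.filter fun a => φ a = c).card : ℝ) := by
      intro c hc
      obtain ⟨a, ha, rfl⟩ := Finset.mem_image.1 hc
      have hcard : (A.filter fun b => φ b = φ a).card ≤ M := by
        refine (Finset.card_le_card (t := (Polynomial.nthRoots M (a ^ M)).toFinset) ?_).trans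
          ((Multiset.toFinset_card_le _).trans (Polynomial.card_nthRoots _ _))
        intro b hb
        rw [Finset.mem_filter] at hb
        rw [Multiset.mem_toFinset, Polynomial.mem_nthRoots hM]
        exact hφ _ hb.1 _ ha hb.2
      have hle := nrgNorm_le_card l (A.filter fun b => φ b = φ a)
      rw [sq]
      refine (mul_le_mul hle hle (nrgNorm_nonneg _ _) (Nat.cast_nonneg _)).trans ?_
      exact mul_le_mul_of_nonneg_right (by exact_mod_cast hcard) (Nat.cast_nonneg _)
    refine (mul_le_mul_of_nonneg_left (Finset.sum_le_sum h1) (by positivity)).trans (le_of_eq ?_)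
    rw [← Finset.mul_sum, sum_card_filter_eq]
    push_cast; ring

/-- The constant in the energy bound. -/
theorem exists_nrgNorm_bound (l ρ : ℕ) : ∃ (B : ℕ) (C : ℝ), 0 < C ∧
    ∀ (L : Type u) [Field L] (P : PlaceSystem L) (g : Fin ρ → L) (A : Finset L),
      (∀ p ≤ B, p.Prime → P.IsU (p : L)) → (∀ i, P.IsU (g i)) →
      (∀ a ∈ A, P.IsU a ∧ RankLE g a) → nrgNorm l A ^ 2 ≤ C * A.card := by
  classical
  set n : ℕ := 2 ^ (l + 1) with hn
  have hn2 : 2 ≤ n := by rw [hn, pow_succ]; have := Nat.one_le_two_pow (n := l); omega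
  set B : ℕ := 1 + n * n.factorial with hB
  have hn0 : (0 : ℝ) < n := by positivity
  obtain ⟨ε, hε0, hε1, hε⟩ : ∃ ε : ℝ, 0 < ε ∧ ε < 1 ∧ n * Real.exp ε ^ B < n + 1 := by
    have hcont : Filter.Tendsto (fun ε : ℝ => n * Real.exp ε ^ B) (nhdsWithin 0 (Set.Ioi 0))
        (nhds (n * Real.exp 0 ^ B)) :=
      (Continuous.tendsto (by fun_prop) 0).mono_left nhdsWithin_le_nhds
    have h1 := hcont.eventually_lt_const (u := (n : ℝ) + 1) (by simp)
    have h2 : ∀ᶠ ε : ℝ in nhdsWithin 0 (Set.Ioi 0), ε ∈ Set.Ioo (0 : ℝ) 1 :=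
      Ioo_mem_nhdsGT one_pos
    obtain ⟨ε, h1, h2⟩ := (h1.and h2).exists
    exact ⟨ε, h2.1, h2.2, h1⟩
  set w : ℝ := ε / 3 ^ ρ with hw
  have hw0 : 0 < w := by positivity
  obtain ⟨W, hW⟩ := exists_nat_ge (Real.log n / w + 1)
  refine ⟨B, ((n : ℝ) ^ 2 * (2 * W + 1)) ^ ρ * (n ^ 2 * n.factorial), by positivity, ?_⟩
  intro L _ P g A hprime hg hA
  obtain ⟨t, ht1, ht⟩ := P.exists_separating_scale A
  let s : P.V → ℝ := fun v => if v ∈ P.arch then 1 else t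
  have hs : ∀ v, 1 ≤ s v := fun v => by
    by_cases h : v ∈ P.arch <;> simp [s, h, ht1]
  obtain ⟨J, hJ, hdom⟩ := exists_list_dominating ρ
    fun (v : P.V) i => s v * Real.log (P.abv v (g i))
  choose! q hq using fun a (ha : a ∈ A) => exists_log_coords hg (hA a ha).1 (hA a ha).2
  let ψ : P.V → L → ℝ := fun v x => s v * Real.log (P.abv v x)
  have hψ : ∀ v, ∀ x ∈ A, ∀ y ∈ A, ψ v x - ψ v y =
      ∑ i, (q x i - q y i) * (s v * Real.log (P.abv v (g i))) := by
    intro v x hx y hy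
    simp only [ψ, hq x hx, hq y hy, Finset.mul_sum, ← Finset.sum_sub_distrib]
    exact Finset.sum_congr rfl fun i _ => by ring
  have : Nontrivial (Fin (2 ^ l) × Bool) := by
    rw [← Fintype.one_lt_card_iff_nontrivial, card_fin_pow_prod_bool]; omega
  have hU : ∀ x : Fin (2 ^ l) × Bool → L, (∀ i, x i ∈ A) → ∀ i,
      P.IsU (if i.2 then x i else - x i) := by
    intro x hx i
    split_ifs
    · exact (hA _ (hx i)).1
    · exact (hA _ (hx i)).1.neg
  have habv : ∀ (v : P.V) (x : Fin (2 ^ l) × Bool → L) i,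
      P.abv v (if i.2 then x i else - x i) = P.abv v (x i) := by
    intro v x i; split_ifs <;> simp
  have main := nrgNorm_sq_le_of_list l W (n ^ 2 * n.factorial)
    (J.map fun v x => ⌊ψ v x / w⌋) A ?_ ?_
  · refine main.trans ?_
    rw [List.length_map, hn]
    push_cast
    refine mul_le_mul_of_nonneg_right (mul_le_mul_of_nonneg_right ?_ (by positivity))
      (Nat.cast_nonneg _)
    refine pow_le_pow_right₀ ?_ hJ
    have h1 : (1 : ℝ) ≤ (2 ^ (l + 1)) ^ 2 := one_le_pow₀ (one_le_pow₀ (by norm_num))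
    have h2 : (0 : ℝ) ≤ W := Nat.cast_nonneg _
    nlinarith
  · intro φ hφ x hx hsum
    obtain ⟨v, hv, rfl⟩ := List.mem_map.1 hφ
    obtain ⟨i, j, hij, h1, h2, h3⟩ := exists_ne_abv_le (P := P) v hsum
    rw [habv, habv] at h1 h2 h3
    refine ⟨i, j, hij, ?_⟩
    have hi := (hA _ (hx i)).1.abv_pos v
    have hj := (hA _ (hx j)).1.abv_pos v
    have hb : |ψ v (x i) - ψ v (x j)| ≤ Real.log n := by
      by_cases hva : v ∈ P.arch
      · simp only [ψ, s, if_pos hva, one_mul]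
        rw [abs_of_nonneg (sub_nonneg.2 (Real.log_le_log hj h1)), sub_le_iff_le_add,
          ← Real.log_mul hn0.ne' hj.ne']
        refine Real.log_le_log hi ?_
        rwa [card_fin_pow_prod_bool] at h2
      · simp only [ψ, h3 hva, sub_self, abs_zero]
        exact Real.log_natCast_nonneg _
    have hb2 : |ψ v (x i) / w - ψ v (x j) / w| ≤ Real.log n / w := by
      rw [← sub_div, abs_div, abs_of_pos hw0]
      gcongr
    have hb3 := abs_le.1 (hb2.trans (le_sub_iff_add_le.2 hW))
    have f1 := Int.floor_le (ψ v (x i) / w)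
    have f2 := Int.lt_floor_add_one (ψ v (x i) / w)
    have f3 := Int.floor_le (ψ v (x j) / w)
    have f4 := Int.lt_floor_add_one (ψ v (x j) / w)
    change |⌊ψ v (x i) / w⌋ - ⌊ψ v (x j) / w⌋| ≤ (W : ℤ)
    rw [abs_le]
    constructor
    · have : (-(W : ℝ) - 1) < ⌊ψ v (x i) / w⌋ - ⌊ψ v (x j) / w⌋ := by linarith [hb3.1]
      have : (-(W : ℤ) - 1) < ⌊ψ v (x i) / w⌋ - ⌊ψ v (x j) / w⌋ := by exact_mod_cast this
      omega
    · have : ((⌊ψ v (x i) / w⌋ : ℝ) - ⌊ψ v (x j) / w⌋) < W + 1 := by linarith [hb3.2]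
      have : ⌊ψ v (x i) / w⌋ - ⌊ψ v (x j) / w⌋ < (W : ℤ) + 1 := by exact_mod_cast this
      omega
  · intro A' hA' hcell
    have hclose : ∀ v, ∀ x ∈ A', ∀ y ∈ A', |ψ v x - ψ v y| ≤ ε := by
      intro v x hx y hy
      rw [hψ v x (hA' hx) y (hA' hy)]
      have := hdom (fun i => q x i - q y i) w ?_ hw0.le v
      · refine this.trans (le_of_eq ?_)
        rw [hw]; field_simp
      · intro j hj
        rw [← hψ j x (hA' hx) y (hA' hy)]
        have h1 := hcell _ (List.mem_map.2 ⟨j, hj, rfl⟩) x hx y hy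
        have h2 := (Int.abs_sub_lt_one_of_floor_eq_floor h1).le
        rw [← sub_div, abs_div, abs_of_pos hw0, div_le_one hw0] at h2
        exact h2
    have := nrgNorm_sq_le_of_pow_eq l n.factorial n.factorial_pos A' fun x hx hsum => ?_
    · refine this.trans (le_of_eq ?_)
      rw [hn]; push_cast; ring
    · have hxA : ∀ i, x i ∈ A := fun i => hA' (hx i)
      have i₀ : Fin (2 ^ l) × Bool := Classical.arbitrary _
      have harch : ∀ v ∈ P.arch, ∀ i j : Fin (2 ^ l) × Bool,
          P.abv v (if i.2 then x i else - x i) ≤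
            Real.exp ε * P.abv v (if j.2 then x j else - x j) := by
        intro v hv i j
        rw [habv, habv]
        have := hclose v _ (hx i) _ (hx j)
        simp only [ψ, s, if_pos hv, one_mul] at this
        have := (abs_le.1 this).2
        rw [← Real.log_le_log_iff ((hA _ (hxA i)).1.abv_pos v)
          (mul_pos (Real.exp_pos _) ((hA _ (hxA j)).1.abv_pos v)),
          Real.log_mul (Real.exp_pos _).ne' ((hA _ (hxA j)).1.abv_pos v).ne', Real.log_exp]
        linarith
      have hnon : ∀ v ∉ P.arch, ∀ i j : Fin (2 ^ l) × Bool,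
          P.abv v (if i.2 then x i else - x i) = P.abv v (if j.2 then x j else - x j) := by
        intro v hv i j
        rw [habv, habv]
        by_contra hne
        have h1 : Real.log (P.abv v (x i)) ≠ Real.log (P.abv v (x j)) := fun h =>
          hne (Real.log_injOn_pos ((hA _ (hxA i)).1.abv_pos v) ((hA _ (hxA j)).1.abv_pos v) h)
        have h2 := ht v _ (hxA i) _ (hxA j) h1
        have h3 := hclose v _ (hx i) _ (hx j)
        simp only [ψ, s, if_neg hv, ← mul_sub] at h3
        rw [abs_mul, abs_of_pos (by linarith)] at h3
        linarith
      obtain ⟨j, hj, hp⟩ := exists_ne_pow_eq (P := P) n (card_fin_pow_prod_bool l) hprime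
        (hU x hxA) hsum ε harch hnon hε i₀
      refine ⟨j, i₀, hj, ?_⟩
      have heven : Even n.factorial :=
        even_iff_two_dvd.2 (Nat.dvd_factorial two_pos hn2)
      have : ∀ i : Fin (2 ^ l) × Bool, (if i.2 then x i else - x i) ^ n.factorial =
          x i ^ n.factorial := fun i => by
        split_ifs
        · rfl
        · exact heven.neg_pow _
      rw [← this, ← this, hp]

end PlaceSystem

theorem RankLE.map {K L : Type*} [Field K] [Field L] {R : Subring K} (σ : R →+* L) {ρ : ℕ}
    {g : Fin ρ → K} (hg : ∀ i, g i ∈ R) {a : K} (ha : a ∈ R) (h : RankLE g a) :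
    RankLE (fun i => σ ⟨g i, hg i⟩) (σ ⟨a, ha⟩) := by
  obtain ⟨k, hk, e, f, h⟩ := h
  refine ⟨k, hk, e, f, ?_⟩
  have h1 : (⟨a, ha⟩ : R) ^ k * ∏ i, (⟨g i, hg i⟩ : R) ^ e i = ∏ i, (⟨g i, hg i⟩ : R) ^ f i := by
    apply Subtype.ext
    push_cast
    exact h
  simpa only [map_mul, map_pow, map_prod] using congrArg σ h1

theorem addNrg_le_of_map {G H : Type*} [AddCommGroup G] [AddCommGroup H] (l : ℕ) (A : Finset G)
    (B : Finset H) {R : AddSubgroup G} (σ : R →+ H) (hA : ∀ a ∈ A, ∃ h : a ∈ R, σ ⟨a, h⟩ ∈ B)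
    (hinj : ∀ a (ha : a ∈ R) b (hb : b ∈ R), a ∈ A → b ∈ A → σ ⟨a, ha⟩ = σ ⟨b, hb⟩ → a = b) :
    addNrg l A ≤ addNrg l B := by
  classical
  have hR : ∀ a ∈ A, a ∈ R := fun a ha => (hA a ha).1
  let f : G → H := fun a => if h : a ∈ R then σ ⟨a, h⟩ else 0
  have hf : ∀ a (h : a ∈ R), f a = σ ⟨a, h⟩ := fun a h => dif_pos h
  unfold addNrg
  refine Finset.card_le_card_of_injOn (fun x i => f (x i)) ?_ ?_
  · intro x hx
    rw [Finset.mem_coe, Finset.mem_filter, Fintype.mem_piFinset] at hx ⊢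
    have hxR : ∀ i, x i ∈ R := fun i => hR _ (hx.1 i)
    refine ⟨fun i => ?_, ?_⟩
    · obtain ⟨h, h'⟩ := hA _ (hx.1 i)
      change f (x i) ∈ B
      rw [hf _ h]; exact h'
    · have h1 : ∑ i : Fin (2 ^ l) × Bool,
          (if i.2 then (⟨x i, hxR i⟩ : R) else - (⟨x i, hxR i⟩ : R)) = 0 := by
        apply Subtype.ext
        rw [AddSubgroup.val_finsetSum]
        refine Eq.trans (Finset.sum_congr rfl fun i _ => ?_) hx.2
        split_ifs <;> rfl
      have h2 := congrArg σ h1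
      rw [map_sum, map_zero] at h2
      refine Eq.trans (Finset.sum_congr rfl fun i _ => ?_) h2
      simp only [hf _ (hxR i)]
      split_ifs
      · rfl
      · rw [map_neg]
  · intro x hx y hy hxy
    rw [Finset.mem_coe, Finset.mem_filter, Fintype.mem_piFinset] at hx hy
    funext i
    have := congrFun hxy i
    simp only [hf _ (hR _ (hx.1 i)), hf _ (hR _ (hy.1 i))] at this
    exact hinj _ _ _ _ (hx.1 i) (hy.1 i) this

theorem exists_nrgNorm_bound_field (l ρ : ℕ) : ∃ C : ℝ, 0 < C ∧
    ∀ (K : Type u) [Field K] [CharZero K] (g : Fin ρ → K) (A : Finset K),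
      (∀ i, g i ≠ 0) → (∀ a ∈ A, a ≠ 0 ∧ RankLE g a) → nrgNorm l A ^ 2 ≤ C * A.card := by
  classical
  obtain ⟨B, C, hC, h⟩ := PlaceSystem.exists_nrgNorm_bound.{u} l ρ
  refine ⟨C, hC, fun K _ _ g A hg hA => ?_⟩
  let F : Finset K := (A ∪ Finset.univ.image g ∪ (A ×ˢ A).image fun p => p.1 - p.2).erase 0
  obtain ⟨L, _, _, P, R, σ, hσ, hp⟩ := exists_specialization F
    (fun x hx => Finset.ne_of_mem_erase hx) B
  have hAF : ∀ a ∈ A, a ∈ F := fun a ha => by simp [F, (hA a ha).1, ha]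
  have hgF : ∀ i, g i ∈ F := fun i => by simp [F, hg i]
  have hAR : ∀ a ∈ A, a ∈ R := fun a ha => (hσ a (hAF a ha)).1
  have hgR : ∀ i, g i ∈ R := fun i => (hσ _ (hgF i)).1
  let A' : Finset L := A.attach.image fun a => σ ⟨a.1, hAR _ a.2⟩
  have hmem : ∀ a (h : a ∈ A), σ ⟨a, hAR _ h⟩ ∈ A' := fun a h =>
    Finset.mem_image.2 ⟨⟨a, h⟩, Finset.mem_attach _ _, rfl⟩
  have hb := h L P (fun i => σ ⟨g i, hgR i⟩) A' (fun p hpB hpp => hp p hpp.ne_zero hpB)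
    (fun i => (hσ _ (hgF i)).2) (fun a ha => by
      obtain ⟨b, -, rfl⟩ := Finset.mem_image.1 ha
      exact ⟨(hσ _ (hAF _ b.2)).2, (hA _ b.2).2.map σ hgR _⟩)
  have hle : addNrg l A ≤ addNrg l A' := by
    refine addNrg_le_of_map l A A' (R := R.toAddSubgroup) σ.toAddMonoidHom
      (fun a ha => ⟨hAR a ha, hmem a ha⟩) ?_
    intro a ha b hb haA hbA hab
    by_contra hne
    have hd : a - b ∈ F := by
      simp only [F, Finset.mem_erase, sub_ne_zero.2 hne, Finset.mem_union, Finset.mem_image,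
        Finset.mem_product, ne_eq, not_false_eq_true, true_and]
      exact Or.inr ⟨(a, b), ⟨haA, hbA⟩, rfl⟩
    obtain ⟨h1, h2⟩ := hσ _ hd
    refine h2.1 ?_
    have : (⟨a - b, h1⟩ : R) = ⟨a, ha⟩ - ⟨b, hb⟩ := rfl
    rw [this, map_sub, sub_eq_zero]
    exact hab
  have hle2 : nrgNorm l A ≤ nrgNorm l A' :=
    Real.rpow_le_rpow (Nat.cast_nonneg _) (by exact_mod_cast hle) (by positivity)
  calc _ ≤ nrgNorm l A' ^ 2 := pow_le_pow_left₀ (nrgNorm_nonneg _ _) hle2 2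
    _ ≤ C * A'.card := hb
    _ ≤ C * A.card := mul_le_mul_of_nonneg_left
        (by exact_mod_cast Finset.card_image_le.trans_eq A.card_attach) hC.le

/-- Linear equations with nonzero coefficients have at most square-root many solutions in a set
of bounded multiplicative rank. -/
theorem exists_linear_count_bound (N ρ : ℕ) : ∃ C : ℝ, 1 ≤ C ∧
    ∀ (K : Type u) [Field K] [CharZero K] [DecidableEq K] (g : Fin ρ → K) (A : Finset K),
      (∀ i, g i ≠ 0) → (∀ a ∈ A, a ≠ 0 ∧ RankLE g a) →
      ∀ (ι : Type) [Fintype ι] [DecidableEq ι], Fintype.card ι ≤ N → ∀ (c : ι → K),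
        (∀ i, c i ≠ 0) → ∀ v : K,
        (((Fintype.piFinset fun _ : ι => A).filter fun x => ∑ i, c i * x i = v).card : ℝ) ≤
          C * √(A.card) ^ Fintype.card ι := by
  obtain ⟨C, hC, h⟩ := exists_nrgNorm_bound_field.{u} N ρ
  refine ⟨max 1 (√C) ^ N, one_le_pow₀ (le_max_left _ _), ?_⟩
  intro K _ _ _ g A hg hA ι _ _ hι c hc v
  have hA1 : nrgNorm N A ≤ max 1 (√C) * √(A.card) := by
    have := Real.le_sqrt_of_sq_le (h K g A hg hA)
    rw [Real.sqrt_mul hC.le] at this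
    exact this.trans (mul_le_mul_of_nonneg_right (le_max_right _ _) (Real.sqrt_nonneg _))
  have hs : ∀ x : K, nrgNorm N {x} ≤ 1 := fun x => by simpa using nrgNorm_le_card N {x}
  have hlt : N + 1 ≤ 2 ^ (N + 1) := Nat.lt_two_pow_self.le
  let κ := Option ι ⊕ Fin (2 ^ (N + 1) - (Fintype.card ι + 1))
  have hκ : Fintype.card κ = 2 ^ (N + 1) := by
    simp only [κ, Fintype.card_sum, Fintype.card_option, Fintype.card_fin]; omega
  let S : κ → Finset K := Sum.elim (fun o => o.elim {-v} fun _ => A) fun _ => {0}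
  let m : κ → K := Sum.elim (fun o => o.elim 1 c) fun _ => 1
  have hm : ∀ i, m i ≠ 0 := by
    rintro ((_ | i) | i)
    · exact one_ne_zero
    · exact hc i
    · exact one_ne_zero
  have key := card_solutions_le (G := K) N hκ (fun i => AddMonoidHom.mulLeft (m i))
    (fun i => mul_right_injective₀ (hm i)) S
  have hinj : ((Fintype.piFinset fun _ : ι => A).filter fun x => ∑ i, c i * x i = v).card ≤
      ((Fintype.piFinset S).filter fun x => ∑ i, AddMonoidHom.mulLeft (m i) (x i) = 0).card := by
    refine Finset.card_le_card_of_injOn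
      (fun x => Sum.elim (fun o => o.elim (-v) x) fun _ => 0) ?_ ?_
    · intro x hx
      rw [Finset.mem_coe, Finset.mem_filter, Fintype.mem_piFinset] at hx ⊢
      refine ⟨?_, ?_⟩
      · rintro ((_ | i) | i)
        · simp [S]
        · simpa [S] using hx.1 i
        · simp [S]
      · rw [Fintype.sum_sum_type, Fintype.sum_option]
        simp [m, hx.2]
    · intro x _ y _ hxy
      funext i
      exact congrFun hxy (Sum.inl (some i))
  have hprod : ∏ i, nrgNorm N (S i) ≤ (max 1 (√C) * √(A.card)) ^ Fintype.card ι := by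
    rw [Fintype.prod_sum_type, Fintype.prod_option]
    have h1 : ∏ i : ι, nrgNorm N (S (Sum.inl (some i))) ≤
        (max 1 (√C) * √(A.card)) ^ Fintype.card ι := by
      refine (Finset.prod_le_prod (fun _ _ => nrgNorm_nonneg _ _) fun i _ => hA1).trans
        (le_of_eq ?_)
      rw [Finset.prod_const, Finset.card_univ]
    have h0 : nrgNorm N (S (Sum.inl none)) ≤ 1 := hs _
    have h2 : ∏ i, nrgNorm N (S (Sum.inr i)) ≤ 1 :=
      Finset.prod_le_one (fun _ _ => nrgNorm_nonneg _ _) fun i _ => hs _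
    have h3 : 0 ≤ ∏ i : ι, nrgNorm N (S (Sum.inl (some i))) :=
      Finset.prod_nonneg fun _ _ => nrgNorm_nonneg _ _
    calc _ ≤ (1 * ∏ i : ι, nrgNorm N (S (Sum.inl (some i)))) * 1 :=
          mul_le_mul (mul_le_mul_of_nonneg_right h0 h3) h2
            (Finset.prod_nonneg fun _ _ => nrgNorm_nonneg _ _) (by simpa using h3)
      _ ≤ _ := by simpa using h1
  refine (Nat.cast_le.2 hinj).trans (key.trans (hprod.trans ?_))
  rw [mul_pow]
  exact mul_le_mul_of_nonneg_right (pow_le_pow_right₀ (le_max_left _ _) hι) (by positivity)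

section Pade

open Polynomial

theorem exists_derivative_eq {K : Type*} [Field K] [CharZero K] (f : K[X]) :
    ∃ F : K[X], derivative F = f := by
  induction f using Polynomial.induction_on' with
  | add p q hp hq =>
    obtain ⟨P, rfl⟩ := hp
    obtain ⟨Q, rfl⟩ := hq
    exact ⟨P + Q, derivative_add⟩
  | monomial n a =>
    refine ⟨monomial (n + 1) (a / (n + 1)), ?_⟩
    rw [derivative_monomial]
    congr 1
    push_cast
    have : (n : K) + 1 ≠ 0 := Nat.cast_add_one_ne_zero n
    field_simp

theorem eval_sub_eval_of_derivative_eq {K : Type*} [Field K] [CharZero K] {F G : K[X]}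
    (h : derivative F = derivative G) (a b : K) :
    F.eval b - F.eval a = G.eval b - G.eval a := by
  have h1 : derivative (F - G) = 0 := by rw [derivative_sub, h, sub_self]
  obtain ⟨c, hc⟩ := natDegree_eq_zero.1 (derivative_eq_zero.1 h1)
  have hF : F = G + C c := by rw [hc]; ring
  rw [hF]; simp

/-- The Beta integral, for polynomial antiderivatives. -/
theorem beta_antiderivative {K : Type*} [Field K] [CharZero K] (a b : K) (q : ℕ) :
    ∀ (p : ℕ) (F : K[X]), derivative F = (X - C a) ^ p * (X - C b) ^ q →
      ((p + q + 1).factorial : K) * (F.eval b - F.eval a) =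
        (-1) ^ q * p.factorial * q.factorial * (b - a) ^ (p + q + 1) := by
  induction q with
  | zero =>
    intro p F hF
    have hp : (p : K) + 1 ≠ 0 := Nat.cast_add_one_ne_zero p
    have h : derivative (C ((p + 1 : K)⁻¹) * (X - C a) ^ (p + 1)) = derivative F := by
      rw [hF, derivative_C_mul, derivative_X_sub_C_pow, ← mul_assoc, ← Polynomial.C_mul]
      push_cast
      rw [inv_mul_cancel₀ hp]; simp
    rw [← eval_sub_eval_of_derivative_eq h a b]
    simp only [eval_mul, eval_C, eval_pow, eval_sub, eval_X, sub_self, add_zero,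
      Nat.factorial_succ, Nat.factorial_zero]
    push_cast
    rw [zero_pow (Nat.succ_ne_zero p)]
    field_simp
    ring
  | succ q ih =>
    intro p F hF
    have hq : (q : K) + 1 ≠ 0 := Nat.cast_add_one_ne_zero q
    have hp : (p : K) + 1 ≠ 0 := Nat.cast_add_one_ne_zero p
    let G : K[X] := C ((q + 1 : K)⁻¹) *
      ((X - C a) ^ (p + 1) * (X - C b) ^ (q + 1) - C (p + 1 : K) * F)
    have hG : derivative G = (X - C a) ^ (p + 1) * (X - C b) ^ q := by
      simp only [G, derivative_sub, derivative_mul, derivative_X_sub_C_pow, hF, derivative_C,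
        zero_mul, zero_add]
      push_cast
      have : (X - C a) ^ (p + 1) * (X - C b) ^ q =
          C ((q + 1 : K)⁻¹ * (q + 1)) * ((X - C a) ^ (p + 1) * (X - C b) ^ q) := by
        rw [inv_mul_cancel₀ hq]; simp
      rw [this, C_mul]
      simp only [C_add, C_1, map_natCast]
      ring
    have h := ih (p + 1) G hG
    simp only [G, eval_mul, eval_C, eval_sub, eval_pow, eval_X, sub_self,
      zero_pow (Nat.succ_ne_zero _), zero_mul, mul_zero, zero_sub] at h
    rw [show p + 1 + q + 1 = p + (q + 1) + 1 by ring, Nat.factorial_succ p,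
      ← mul_right_inj' (mul_ne_zero hq (neg_ne_zero.2 (inv_ne_zero hp)))] at h
    push_cast at h
    rw [Nat.factorial_succ q]
    push_cast
    field_simp at h
    rw [pow_succ (-1 : K) q]
    linear_combination h

/-- The polynomial part of the integral of `(t - a) ^ p (t - b) ^ q (t - c) ^ r` from `a` to `b`
in terms of `x = a - c`, `y = b - a`. -/
def padeSum {R : Type*} [CommRing R] (p q r : ℕ) (x y : R) : R :=
  ∑ m ∈ Finset.range (r + 1),
    ((p + m).choose m * (p + q + r + 1).choose (r - m) : ℕ) * (x ^ (r - m) * y ^ m)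

theorem pade_antiderivative {K : Type*} [Field K] [CharZero K] (p q r : ℕ) (a b c : K)
    (F : K[X]) (hF : derivative F =
      C (((p + q + r + 1).factorial : K) / (p.factorial * q.factorial * r.factorial)) *
        ((X - C a) ^ p * (X - C b) ^ q * (X - C c) ^ r)) :
    F.eval b - F.eval a = (-1) ^ q * (b - a) ^ (p + q + 1) * padeSum p q r (a - c) (b - a) := by
  have hfac : ∀ k : ℕ, (k.factorial : K) ≠ 0 := fun k => Nat.cast_ne_zero.2 k.factorial_ne_zero
  set κ : K := ((p + q + r + 1).factorial : K) / (p.factorial * q.factorial * r.factorial)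
  choose G hG using fun m : ℕ => exists_derivative_eq ((X - C a) ^ (p + m) * (X - C b) ^ q)
  let H : K[X] := ∑ m ∈ Finset.range (r + 1),
    C (κ * ((a - c) ^ (r - m) * (r.choose m : ℕ))) * G m
  have hH : derivative H = derivative F := by
    have h1 : (X - C c) ^ r = ((X - C a) + C (a - c)) ^ r := by rw [C_sub]; ring
    rw [hF, h1, add_pow, Finset.mul_sum, Finset.mul_sum, derivative_sum]
    refine Finset.sum_congr rfl fun m _ => ?_
    rw [derivative_C_mul, hG, C_mul, C_mul, C_pow, pow_add, map_natCast]
    ring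
  rw [← eval_sub_eval_of_derivative_eq hH a b]
  simp only [H, eval_finsetSum, eval_mul, eval_C, ← Finset.sum_sub_distrib, ← mul_sub]
  rw [padeSum, Finset.mul_sum]
  refine Finset.sum_congr rfl fun m hm => ?_
  have hmr : m ≤ r := Nat.lt_succ_iff.1 (Finset.mem_range.1 hm)
  have hb := beta_antiderivative a b q (p + m) (G m) (hG m)
  have hb' : (G m).eval b - (G m).eval a =
      (-1) ^ q * (p + m).factorial * q.factorial * (b - a) ^ (p + m + q + 1) /
        (p + m + q + 1).factorial := by
    rw [eq_div_iff (hfac _), mul_comm, hb]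
  have hc1 : ((r.choose m : ℕ) : K) = r.factorial / (m.factorial * (r - m).factorial) :=
    Nat.cast_choose K hmr
  have hc2 : (((p + m).choose m : ℕ) : K) = (p + m).factorial / (m.factorial * p.factorial) := by
    rw [Nat.cast_choose K (Nat.le_add_left m p), Nat.add_sub_cancel]
  have hc3 : (((p + q + r + 1).choose (r - m) : ℕ) : K) =
      (p + q + r + 1).factorial / ((r - m).factorial * (p + m + q + 1).factorial) := by
    rw [Nat.cast_choose K (by omega), show p + q + r + 1 - (r - m) = p + m + q + 1 by omega]
  rw [hb', Nat.cast_mul, hc1, hc2, hc3, show p + m + q + 1 = p + q + 1 + m by ring, pow_add]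
  simp only [κ]
  have := hfac p; have := hfac q; have := hfac r; have := hfac m; have := hfac (r - m)
  have := hfac (p + q + 1 + m)
  field_simp

/-- A polynomial whose derivative is divisible by `(X - a) ^ N` and which vanishes at `a` is
divisible by `(X - a) ^ (N + 1)`. -/
theorem pow_succ_dvd_of_derivative {K : Type*} [Field K] [CharZero K] {G : K[X]} {a : K} {N : ℕ}
    (h0 : G.eval a = 0) (h : (X - C a) ^ N ∣ derivative G) (hG : derivative G ≠ 0) :
    (X - C a) ^ (N + 1) ∣ G := by
  have hG0 : G ≠ 0 := by rintro rfl; simp at hG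
  have h1 := derivative_rootMultiplicity_of_root (p := G) (t := a) h0
  have h2 := (le_rootMultiplicity_iff hG).2 h
  have h3 : 0 < G.rootMultiplicity a := (rootMultiplicity_pos hG0).2 h0
  exact (le_rootMultiplicity_iff hG0).1 (by omega)

theorem not_eval_eq_of_derivative {K : Type*} [Field K] [CharZero K] {G l : K[X]} {N : ℕ}
    {a b c : K} (hab : a ≠ b) (hbc : b ≠ c) (hac : a ≠ c) (hl : l ≠ 0) (hl1 : l.natDegree ≤ 1)
    (hG : derivative G = (X - C a) ^ N * (X - C b) ^ N * (X - C c) ^ N * l)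
    (h1 : G.eval b = G.eval a) (h2 : G.eval c = G.eval a) : False := by
  have hX : ∀ a : K, (X - C a) ^ N ≠ 0 := fun a => pow_ne_zero _ (X_sub_C_ne_zero a)
  set H := G - C (G.eval a)
  have hdH : derivative H = derivative G := by simp [H]
  have hne : derivative H ≠ 0 := by
    rw [hdH, hG]
    exact mul_ne_zero (mul_ne_zero (mul_ne_zero (hX _) (hX _)) (hX _)) hl
  have hH0 : H ≠ 0 := by intro h; rw [h] at hne; simp at hne
  have da : (X - C a) ^ (N + 1) ∣ H := pow_succ_dvd_of_derivative (by simp [H])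
    (by rw [hdH, hG]; exact ⟨(X - C b) ^ N * (X - C c) ^ N * l, by ring⟩) hne
  have db : (X - C b) ^ (N + 1) ∣ H := pow_succ_dvd_of_derivative (by simp [H, h1])
    (by rw [hdH, hG]; exact ⟨(X - C a) ^ N * (X - C c) ^ N * l, by ring⟩) hne
  have dc : (X - C c) ^ (N + 1) ∣ H := pow_succ_dvd_of_derivative (by simp [H, h2])
    (by rw [hdH, hG]; exact ⟨(X - C a) ^ N * (X - C b) ^ N * l, by ring⟩) hne
  have cop : ∀ {x y : K}, x ≠ y → IsCoprime ((X - C x) ^ (N + 1)) ((X - C y) ^ (N + 1)) :=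
    fun h => (isCoprime_X_sub_C_of_isUnit_sub (sub_ne_zero.2 h).isUnit).pow
  have hd := (IsCoprime.mul_left (cop hac) (cop hbc)).mul_dvd ((cop hab).mul_dvd da db) dc
  have hdeg := natDegree_le_of_dvd hd hH0
  have hmon : ∀ (a : K) n, ((X - C a) ^ n).natDegree = n := fun a n => by
    rw [natDegree_pow, natDegree_X_sub_C, mul_one]
  have hmn : ∀ (a : K) n, (X - C a) ^ n ≠ 0 := fun a n => pow_ne_zero _ (X_sub_C_ne_zero a)
  rw [natDegree_mul (mul_ne_zero (hmn _ _) (hmn _ _)) (hmn _ _),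
    natDegree_mul (hmn _ _) (hmn _ _), hmon, hmon, hmon] at hdeg
  have hdeg2 : (derivative H).natDegree = H.natDegree - 1 := natDegree_derivative H
  rw [hdH, hG, natDegree_mul (mul_ne_zero (mul_ne_zero (hX _) (hX _)) (hX _)) hl,
    natDegree_mul (mul_ne_zero (hX _) (hX _)) (hX _), natDegree_mul (hX _) (hX _),
    hmon, hmon, hmon] at hdeg2
  omega

end Pade

theorem padeSum_coeff_le (p q r m : ℕ) (hm : m ≤ r) :
    (p + m).choose m * (p + q + r + 1).choose (r - m) ≤ 2 ^ (2 * p + q + 2 * r + 1) := by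
  calc _ ≤ 2 ^ (p + m) * 2 ^ (p + q + r + 1) :=
        Nat.mul_le_mul (Nat.choose_le_two_pow _ _) (Nat.choose_le_two_pow _ _)
    _ = 2 ^ ((p + m) + (p + q + r + 1)) := (pow_add _ _ _).symm
    _ ≤ _ := Nat.pow_le_pow_right two_pos (by omega)

namespace PlaceSystem

variable {L : Type u} [Field L] {P : PlaceSystem L}

theorem padeSum_mem (p q r : ℕ) {x y : L} (hx : x ∈ P.O) (hy : y ∈ P.O) :
    padeSum p q r x y ∈ P.O :=
  sum_mem fun _ _ => mul_mem (natCast_mem _ _) (mul_mem (pow_mem hx _) (pow_mem hy _))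

open Classical in
theorem abv_padeSum_le (v : P.V) (p q r k : ℕ) {x y : L} {M : ℝ} (hM : 1 ≤ M)
    (hx : P.abv v x ≤ M) (hy : P.abv v y ≤ M) (hk : 2 * p + q + 3 * r + 1 ≤ k) :
    P.abv v (padeSum p q r x y) ≤ (if v ∈ P.arch then 2 ^ k else 1) * M ^ r := by
  have hterm : ∀ m ∈ Finset.range (r + 1), P.abv v (x ^ (r - m) * y ^ m) ≤ M ^ r := by
    intro m hm
    have hmr : m ≤ r := Nat.lt_succ_iff.1 (Finset.mem_range.1 hm)
    rw [map_mul, map_pow, map_pow]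
    calc _ ≤ M ^ (r - m) * M ^ m := mul_le_mul (pow_le_pow_left₀ ((P.abv v).nonneg _) hx _)
          (pow_le_pow_left₀ ((P.abv v).nonneg _) hy _) (pow_nonneg ((P.abv v).nonneg _) _)
          (by positivity)
      _ = M ^ r := by rw [← pow_add, Nat.sub_add_cancel hmr]
  split_ifs with hv
  · calc _ ≤ ∑ m ∈ Finset.range (r + 1), P.abv v
          (((p + m).choose m * (p + q + r + 1).choose (r - m) : ℕ) * (x ^ (r - m) * y ^ m)) :=
          (P.abv v).sum_le _ _
      _ ≤ ∑ _m ∈ Finset.range (r + 1), 2 ^ (2 * p + q + 2 * r + 1) * M ^ r := by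
          refine Finset.sum_le_sum fun m hm => ?_
          rw [map_mul, P.abv_natCast v hv]
          refine mul_le_mul ?_ (hterm m hm) ((P.abv v).nonneg _) (by positivity)
          exact_mod_cast padeSum_coeff_le p q r m (Nat.lt_succ_iff.1 (Finset.mem_range.1 hm))
      _ = (r + 1 : ℕ) * 2 ^ (2 * p + q + 2 * r + 1) * M ^ r := by
          rw [Finset.sum_const, Finset.card_range, nsmul_eq_mul, mul_assoc]
      _ ≤ 2 ^ k * M ^ r := by
          refine mul_le_mul_of_nonneg_right ?_ (by positivity)
          have h1 : ((r + 1 : ℕ) : ℝ) ≤ 2 ^ r := by exact_mod_cast Nat.lt_two_pow_self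
          calc _ ≤ (2 : ℝ) ^ r * 2 ^ (2 * p + q + 2 * r + 1) :=
                mul_le_mul_of_nonneg_right h1 (by positivity)
            _ = 2 ^ (r + (2 * p + q + 2 * r + 1)) := (pow_add _ _ _).symm
            _ ≤ 2 ^ k := pow_le_pow_right₀ one_le_two (by omega)
  · have hn := P.nonarch v hv
    obtain ⟨m, hm, h⟩ := hn.finset_image_add_of_nonempty (t := Finset.range (r + 1))
      (fun m => (((p + m).choose m * (p + q + r + 1).choose (r - m) : ℕ) : L) *
        (x ^ (r - m) * y ^ m)) ⟨0, by simp⟩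
    refine h.trans ?_
    rw [map_mul]
    refine mul_le_mul ?_ (hterm m hm) ((P.abv v).nonneg _) zero_le_one
    exact IsNonarchimedean.apply_natCast_le_one hn

open Classical in
theorem exists_pade_vector [CharZero L] {u v : L} (hu : P.IsU u) (hv : P.IsU v)
    (huv : u + v = 1) (N : ℕ) {a b : L} (hab : a * u ^ (2 * N + 1) + b * v ^ (2 * N + 1) = 1) :
    ∃ x y z : L, x ∈ P.O ∧ y ∈ P.O ∧ z ∈ P.O ∧
      x * u ^ (2 * N + 1) + y * v ^ (2 * N + 1) = z ∧ a * y - b * x ≠ 0 ∧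
      ∀ p, ∀ M : ℝ, 1 ≤ M → P.abv p u ≤ M → P.abv p v ≤ M → ∀ t ∈ [x, y, z],
        P.abv p t ≤ (if p ∈ P.arch then 2 ^ (6 * (N + 1)) else 1) * M ^ (N + 1) := by
  open Polynomial in
  let κ : ℕ → L := fun e => ((N + e + N + N + 1).factorial : L) /
    ((N + e).factorial * N.factorial * N.factorial)
  have hfac : ∀ k : ℕ, (k.factorial : L) ≠ 0 := fun k => Nat.cast_ne_zero.2 k.factorial_ne_zero
  have hκ : ∀ e, κ e ≠ 0 := fun e => div_ne_zero (hfac _)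
    (mul_ne_zero (mul_ne_zero (hfac _) (hfac _)) (hfac _))
  have h1u : (1 : L) - u = v := by rw [← huv]; ring
  choose F hF using fun e => exists_derivative_eq
    (C (κ e) * ((X - C 0) ^ (N + e) * (X - C u) ^ N * (X - C (1 : L)) ^ N))
  let x : ℕ → L := fun e => u ^ e * padeSum (N + e) N N (-1) u
  let y : ℕ → L := fun e => padeSum N N (N + e) u v
  let z : ℕ → L := fun e => padeSum (N + e) N N (-u) 1
  have hx : ∀ e, (F e).eval u - (F e).eval 0 = (-1) ^ N * (u ^ (2 * N + 1) * x e) := by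
    intro e
    rw [pade_antiderivative (N + e) N N 0 u 1 (F e) (hF e)]
    simp only [x, sub_zero, zero_sub]
    rw [show N + e + N + 1 = 2 * N + 1 + e by ring, pow_add]
    ring
  have hy : ∀ e, (F e).eval 1 - (F e).eval u = (-1) ^ N * (v ^ (2 * N + 1) * y e) := by
    intro e
    rw [pade_antiderivative N N (N + e) u 1 0 (F e) ?_]
    · simp only [y, sub_zero, h1u]
      rw [show N + N + 1 = 2 * N + 1 by ring]
      ring
    · rw [hF e]
      simp only [κ]
      rw [show N + N + (N + e) + 1 = N + e + N + N + 1 by ring,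
        show (N.factorial : L) * N.factorial * (N + e).factorial =
          (N + e).factorial * N.factorial * N.factorial by ring]
      ring
  have hz : ∀ e, (F e).eval 1 - (F e).eval 0 = (-1) ^ N * z e := by
    intro e
    rw [pade_antiderivative (N + e) N N 0 1 u (F e) ?_]
    · simp only [z, sub_zero, zero_sub, one_pow, mul_one]
    · rw [hF e]; ring
  have hN1 : (-1 : L) ^ N ≠ 0 := pow_ne_zero _ (neg_ne_zero.2 one_ne_zero)
  have hrel : ∀ e, x e * u ^ (2 * N + 1) + y e * v ^ (2 * N + 1) = z e := by
    intro e
    apply mul_left_cancel₀ hN1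
    rw [← hz]
    linear_combination -(hx e) - hy e
  have hex : ∃ e, e ≤ 1 ∧ a * y e - b * x e ≠ 0 := by
    by_contra! hcon
    have hxa : ∀ e, e ≤ 1 → x e = a * z e := fun e he => by
      have := hcon e he
      linear_combination (-x e) * hab + a * hrel e - v ^ (2 * N + 1) * this
    obtain ⟨s, t, hst, h0⟩ : ∃ s t : L, (s ≠ 0 ∨ t ≠ 0) ∧ s * z 0 + t * z 1 = 0 := by
      by_cases h : z 1 = 0 ∧ z 0 = 0
      · exact ⟨1, 0, Or.inl one_ne_zero, by rw [h.1, h.2]; ring⟩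
      · refine ⟨z 1, -z 0, ?_, by ring⟩
        by_contra! h'
        exact h ⟨h'.1, neg_eq_zero.1 h'.2⟩
    refine not_eval_eq_of_derivative (G := C s * F 0 + C t * F 1)
      (l := C (t * κ 1) * X + C (s * κ 0)) (N := N) (a := 0) (b := u) (c := 1)
      hu.1.symm (fun h => hv.1 ?_) zero_ne_one ?_ natDegree_linear_le ?_ ?_ ?_
    · rw [← h1u, h, sub_self]
    · intro h
      have e0 := congrArg (fun f => coeff f 0) h
      have e1 := congrArg (fun f => coeff f 1) h
      simp at e0 e1
      rcases hst with h | h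
      · exact h (e0.resolve_right (hκ 0))
      · exact h (e1.resolve_right (hκ 1))
    · rw [derivative_add, derivative_C_mul, derivative_C_mul, hF, hF, C_mul, C_mul]
      simp only [C_0, sub_zero]
      ring
    · simp only [eval_add, eval_mul, eval_C]
      have e0 := hx 0
      have e1 := hx 1
      rw [hxa 0 zero_le_one] at e0
      rw [hxa 1 le_rfl] at e1
      linear_combination s * e0 + t * e1 + (-1) ^ N * u ^ (2 * N + 1) * a * h0
    · simp only [eval_add, eval_mul, eval_C]
      linear_combination s * hz 0 + t * hz 1 + (-1) ^ N * h0
  obtain ⟨e, he, hne⟩ := hex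
  have hm1 : (-1 : L) ∈ P.O := neg_mem (one_mem _)
  refine ⟨x e, y e, z e, mul_mem (pow_mem hu.2.1 _) (padeSum_mem _ _ _ hm1 hu.2.1),
    padeSum_mem _ _ _ hu.2.1 hv.2.1, padeSum_mem _ _ _ (neg_mem hu.2.1) (one_mem _),
    hrel e, hne, ?_⟩
  intro p M hM hMu hMv t ht
  have hM0 : 0 ≤ M := zero_le_one.trans hM
  have hc : (0 : ℝ) ≤ if p ∈ P.arch then 2 ^ (6 * (N + 1)) else 1 := by split_ifs <;> positivity
  have h1 : P.abv p (-1) ≤ M := by simpa using hM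
  simp only [List.mem_cons, List.not_mem_nil, or_false] at ht
  rcases ht with rfl | rfl | rfl
  · have := abv_padeSum_le (P := P) p (N + e) N N (6 * (N + 1)) hM h1 hMu (by omega)
    simp only [x, map_mul, map_pow]
    calc _ ≤ M ^ e * ((if p ∈ P.arch then 2 ^ (6 * (N + 1)) else 1) * M ^ N) :=
          mul_le_mul (pow_le_pow_left₀ ((P.abv p).nonneg _) hMu _) this ((P.abv p).nonneg _)
            (by positivity)
      _ = (if p ∈ P.arch then 2 ^ (6 * (N + 1)) else 1) * M ^ (N + e) := by
          rw [pow_add]; ring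
      _ ≤ _ := mul_le_mul_of_nonneg_left (pow_le_pow_right₀ hM (by omega)) hc
  · exact (abv_padeSum_le (P := P) p N N (N + e) (6 * (N + 1)) hM hMu hMv (by omega)).trans
      (mul_le_mul_of_nonneg_left (pow_le_pow_right₀ hM (show N + e ≤ N + 1 by omega)) hc)
  · exact (abv_padeSum_le (P := P) p (N + e) N N (6 * (N + 1)) hM (by simpa using hMu)
      (by simpa using hM) (by omega)).trans
      (mul_le_mul_of_nonneg_left (pow_le_pow_right₀ hM (by omega)) hc)

end PlaceSystem

theorem exists_sign_sum_eq {I : Type*} [Fintype I] (f : I → ℝ) :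
    ∃ ε : I → Bool, ∑ i, (if ε i then f i else -f i) = ∑ i, |f i| := by
  classical
  refine ⟨fun i => decide (0 ≤ f i), Finset.sum_congr rfl fun i _ => ?_⟩
  by_cases h : 0 ≤ f i
  · simp [h, abs_of_nonneg h]
  · simp [h, abs_of_neg (not_le.1 h)]

theorem abs_sign_sum_le {I : Type*} [Fintype I] (f : I → ℝ) (ε : I → Bool) :
    |∑ i, (if ε i then f i else -f i)| ≤ ∑ i, |f i| := by
  refine (Finset.abs_sum_le_sum_abs _ _).trans (Finset.sum_le_sum fun i _ => ?_)
  split_ifs <;> simp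

/-- The bounded part of a `d`-dimensional space of vectors, in the `ℓ¹`-norm, is covered by
boundedly many pieces of diameter at most `δ`. -/
theorem exists_packing (d : ℕ) (δ R : ℝ) (hδ : 0 < δ) : ∃ K : ℕ, ∀ (I : Type u) [Fintype I]
    (T : Fin d → I → ℝ), ∃ Λ : (I → ℝ) → (Fin d → ℤ),
      (∀ f : I → ℝ, ∑ i, |f i| ≤ R →
        Λ f ∈ Fintype.piFinset fun _ => Finset.Icc (-K : ℤ) K) ∧
      ∀ p q : Fin d → ℝ, Λ (fun i => ∑ j, p j * T j i) = Λ (fun i => ∑ j, q j * T j i) →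
        ∑ i, |∑ j, p j * T j i - ∑ j, q j * T j i| ≤ δ := by
  set w : ℝ := δ / 3 ^ d with hw
  have hw0 : 0 < w := by positivity
  refine ⟨⌈R / w⌉₊ + 1, fun I _ T => ?_⟩
  obtain ⟨J, hJ, h⟩ := exists_list_dominating d
    fun (ε : I → Bool) j => ∑ i, (if ε i then T j i else -T j i)
  refine ⟨fun f k => ⌊(∑ i, (if J.getD k (fun _ => true) i then f i else -f i)) / w⌋, ?_, ?_⟩
  · intro f hf
    rw [Fintype.mem_piFinset]
    intro k
    have h1 := (abs_sign_sum_le f (J.getD k fun _ => true)).trans hf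
    have h2 := abs_le.1 h1
    have h3 : R / w ≤ ⌈R / w⌉₊ := Nat.le_ceil _
    rw [Finset.mem_Icc]
    constructor
    · rw [Int.le_floor, le_div_iff₀ hw0]
      push_cast
      rw [div_le_iff₀ hw0] at h3
      nlinarith
    · refine Int.floor_le_iff.2 ?_
      rw [div_lt_iff₀ hw0]
      push_cast
      rw [div_le_iff₀ hw0] at h3
      nlinarith
  · intro p q hpq
    have key : ∀ (ε : I → Bool) (p : Fin d → ℝ),
        ∑ j, p j * ∑ i, (if ε i then T j i else -T j i) =
        ∑ i, (if ε i then ∑ j, p j * T j i else -∑ j, p j * T j i) := by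
      intro ε p
      simp only [Finset.mul_sum]
      rw [Finset.sum_comm]
      refine Finset.sum_congr rfl fun i _ => ?_
      split_ifs
      · rfl
      · simp
    have hsub : ∀ i, ∑ j, p j * T j i - ∑ j, q j * T j i = ∑ j, (p j - q j) * T j i := fun i => by
      simp only [sub_mul, Finset.sum_sub_distrib]
    simp only [hsub]
    obtain ⟨ε, hε⟩ := exists_sign_sum_eq fun i => ∑ j, (p j - q j) * T j i
    rw [← hε, ← key]
    refine (le_abs_self _).trans ((h (fun j => p j - q j) w ?_ hw0.le ε).trans_eq ?_)
    · intro ε' hε'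
      obtain ⟨k, hk, hkε⟩ := List.getElem_of_mem hε'
      have := congrFun hpq ⟨k, hk.trans_le hJ⟩
      simp only [List.getD_eq_getElem _ _ hk, hkε] at this
      have h1 := Int.abs_sub_lt_one_of_floor_eq_floor this
      rw [← sub_div, abs_div, abs_of_pos hw0, div_lt_one hw0, ← key, ← key,
        ← Finset.sum_sub_distrib] at h1
      simp only [sub_mul]
      exact h1.le
    · rw [hw]; field_simp

namespace PlaceSystem

variable {L : Type u} [Field L] (P : PlaceSystem L)

/-- The logarithmic height of the projective point `(a : b : 1)`. -/
noncomputable def ht (a b : L) : ℝ :=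
  ∑ v, P.w v * Real.log (max 1 (max (P.abv v a) (P.abv v b)))

/-- The weighted logarithmic vector. -/
noncomputable def lvec (a : L) (v : P.V) : ℝ := P.w v * Real.log (P.abv v a)

/-- The `ℓ¹`-size of the logarithmic vectors of a pair. -/
noncomputable def lsize (a b : L) : ℝ := ∑ v, |P.lvec a v| + ∑ v, |P.lvec b v|

variable {P}

theorem sum_lvec_nonneg {x : L} (hx : x ∈ P.O) (hx0 : x ≠ 0) : 0 ≤ ∑ v, P.lvec x v := by
  have h := Real.log_nonneg (P.one_le_prod x hx hx0)
  have hp : ∀ v, 0 < P.abv v x := fun v => (P.abv v).pos hx0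
  rw [Real.log_prod fun v _ => (Real.rpow_pos_of_pos (hp v) _).ne'] at h
  simpa only [lvec, Real.log_rpow (hp _)] using h

theorem lvec_mul {x y : L} (hx : x ≠ 0) (hy : y ≠ 0) (v : P.V) :
    P.lvec (x * y) v = P.lvec x v + P.lvec y v := by
  simp only [lvec, map_mul]
  rw [Real.log_mul ((P.abv v).ne_zero hx) ((P.abv v).ne_zero hy), mul_add]

theorem lvec_inv (x : L) (v : P.V) : P.lvec x⁻¹ v = -P.lvec x v := by
  simp only [lvec, map_inv₀, Real.log_inv, mul_neg]

theorem lvec_pow (x : L) (k : ℕ) (v : P.V) : P.lvec (x ^ k) v = k * P.lvec x v := by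
  simp only [lvec, map_pow, Real.log_pow]; ring

theorem IsU.sum_lvec {x : L} (hx : P.IsU x) : ∑ v, P.lvec x v = 0 := by
  refine le_antisymm ?_ (sum_lvec_nonneg hx.2.1 hx.1)
  have := sum_lvec_nonneg hx.inv.2.1 hx.inv.1
  simp only [lvec_inv, Finset.sum_neg_distrib] at this
  linarith

theorem log_max_eq {x y : ℝ} (hx : 0 < x) (hy : 0 < y) :
    Real.log (max 1 (max x y)) = max 0 (max (Real.log x) (Real.log y)) := by
  have hm : ∀ {s t : ℝ}, 0 < s → 0 < t → Real.log (max s t) = max (Real.log s) (Real.log t) := by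
    intro s t hs ht
    rcases le_total s t with h | h
    · rw [max_eq_right h, max_eq_right (Real.log_le_log hs h)]
    · rw [max_eq_left h, max_eq_left (Real.log_le_log ht h)]
  rw [hm one_pos (lt_max_of_lt_left hx), hm hx hy, Real.log_one]

theorem ht_term_eq {a b : L} (ha : a ≠ 0) (hb : b ≠ 0) (v : P.V) :
    P.w v * Real.log (max 1 (max (P.abv v a) (P.abv v b))) =
      max 0 (max (P.lvec a v) (P.lvec b v)) := by
  have hw := (P.w_pos v).le
  rw [log_max_eq ((P.abv v).pos ha) ((P.abv v).pos hb), mul_max_of_nonneg _ _ hw,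
    mul_max_of_nonneg _ _ hw, mul_zero, lvec, lvec]

theorem sum_abs_eq {ι : Type*} [Fintype ι] (f : ι → ℝ) (hf : ∑ i, f i = 0) :
    ∑ i, |f i| = 2 * ∑ i, max 0 (f i) := by
  have : ∀ i, |f i| = 2 * max 0 (f i) - f i := fun i => by
    rcases le_total 0 (f i) with h | h
    · rw [max_eq_right h, abs_of_nonneg h]; ring
    · rw [max_eq_left h, abs_of_nonpos h]; ring
  simp only [this]
  rw [Finset.sum_sub_distrib, hf, sub_zero, Finset.mul_sum]

theorem two_mul_ht_le {a b : L} (ha : P.IsU a) (hb : P.IsU b) : 2 * P.ht a b ≤ P.lsize a b := by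
  rw [lsize, sum_abs_eq _ ha.sum_lvec, sum_abs_eq _ hb.sum_lvec, ← mul_add,
    ← Finset.sum_add_distrib]
  refine mul_le_mul_of_nonneg_left (Finset.sum_le_sum fun v _ => ?_) two_pos.le
  rw [ht_term_eq ha.1 hb.1]
  have h1 := le_max_left 0 (P.lvec a v)
  have h2 := le_max_left 0 (P.lvec b v)
  have h3 := le_max_right 0 (P.lvec a v)
  have h4 := le_max_right 0 (P.lvec b v)
  exact max_le (by linarith) (max_le (by linarith) (by linarith))

theorem lsize_le {a b : L} (ha : P.IsU a) (hb : P.IsU b) : P.lsize a b ≤ 4 * P.ht a b := by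
  rw [lsize, sum_abs_eq _ ha.sum_lvec, sum_abs_eq _ hb.sum_lvec]
  have h1 : ∑ v, max 0 (P.lvec a v) ≤ P.ht a b := Finset.sum_le_sum fun v _ => by
    rw [ht_term_eq ha.1 hb.1]
    exact max_le_max le_rfl (le_max_left _ _)
  have h2 : ∑ v, max 0 (P.lvec b v) ≤ P.ht a b := Finset.sum_le_sum fun v _ => by
    rw [ht_term_eq ha.1 hb.1]
    exact max_le_max le_rfl (le_max_right _ _)
  linarith

theorem ht_pow {a b : L} (ha : a ≠ 0) (hb : b ≠ 0) (k : ℕ) :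
    P.ht (a ^ k) (b ^ k) = k * P.ht a b := by
  rw [ht, ht, Finset.mul_sum]
  refine Finset.sum_congr rfl fun v _ => ?_
  rw [ht_term_eq (pow_ne_zero _ ha) (pow_ne_zero _ hb), ht_term_eq ha hb, lvec_pow, lvec_pow,
    mul_max_of_nonneg _ _ k.cast_nonneg, mul_max_of_nonneg _ _ k.cast_nonneg, mul_zero]

open Classical in
theorem ht_le_of_det_ne_zero {x y z a b U V : L} (hx : x ∈ P.O) (hy : y ∈ P.O)
    (ha : a ∈ P.O) (hb : b ∈ P.O) (h1 : a * U + b * V = 1) (h2 : x * U + y * V = z)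
    (hμ : a * y - b * x ≠ 0) (E : P.V → ℝ) (hE0 : ∀ v, 0 < E v)
    (hE : ∀ v, ∀ t ∈ [x, y, z], P.abv v t ≤ E v) :
    P.ht U V ≤ P.ht a b + ∑ v, P.w v * Real.log (E v) + Real.log 2 := by
  have hloc : ∀ v, P.abv v (a * y - b * x) * max 1 (max (P.abv v U) (P.abv v V)) ≤
      (if v ∈ P.arch then 2 else 1) * (max 1 (max (P.abv v a) (P.abv v b)) * E v) := by
    intro v
    set A := max 1 (max (P.abv v a) (P.abv v b))
    have hA0 : 0 ≤ A := zero_le_one.trans (le_max_left _ _)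
    have hE' : P.abv v x ≤ E v ∧ P.abv v y ≤ E v ∧ P.abv v z ≤ E v := by
      simpa using hE v
    have hprod : ∀ {c t : L}, P.abv v c ≤ A → P.abv v t ≤ E v → P.abv v (c * t) ≤ A * E v := by
      intro c t hc ht
      rw [map_mul]
      exact mul_le_mul hc ht ((P.abv v).nonneg _) hA0
    have hsub : ∀ s t : L, P.abv v s ≤ A * E v → P.abv v t ≤ A * E v →
        P.abv v (s - t) ≤ (if v ∈ P.arch then 2 else 1) * (A * E v) := by
      intro s t hs ht
      split_ifs with hv
      · refine (P.abv v).sub_le_add s t |>.trans ?_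
        linarith
      · rw [one_mul, sub_eq_add_neg]
        exact (P.nonarch v hv s (-t)).trans (max_le hs (by rwa [AbsoluteValue.map_neg]))
    have ha1 : P.abv v a ≤ A := (le_max_left _ _).trans (le_max_right _ _)
    have hb1 : P.abv v b ≤ A := (le_max_right _ _).trans (le_max_right _ _)
    have h11 : P.abv v 1 ≤ A := by rw [map_one]; exact le_max_left _ _
    have e0 := hsub _ _ (hprod ha1 hE'.2.1) (hprod hb1 hE'.1)
    have e1 := hsub _ _ (hprod h11 hE'.2.1) (hprod hb1 hE'.2.2)
    have e2 := hsub _ _ (hprod ha1 hE'.2.2) (hprod h11 hE'.1)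
    rw [show 1 * y - b * z = (a * y - b * x) * U by
      linear_combination (-y) * h1 + b * h2, map_mul] at e1
    rw [show a * z - 1 * x = (a * y - b * x) * V by
      linear_combination x * h1 - a * h2, map_mul] at e2
    rw [mul_max_of_nonneg _ _ ((P.abv v).nonneg _), mul_max_of_nonneg _ _ ((P.abv v).nonneg _),
      mul_one]
    exact max_le e0 (max_le e1 e2)
  have hlog : ∀ v, P.lvec (a * y - b * x) v +
      P.w v * Real.log (max 1 (max (P.abv v U) (P.abv v V))) ≤
      P.w v * Real.log (max 1 (max (P.abv v a) (P.abv v b))) + P.w v * Real.log (E v) +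
        if v ∈ P.arch then P.w v * Real.log 2 else 0 := by
    intro v
    have hp := (P.abv v).pos hμ
    have hm1 : (0 : ℝ) < max 1 (max (P.abv v U) (P.abv v V)) := lt_max_of_lt_left one_pos
    have hm2 : (0 : ℝ) < max 1 (max (P.abv v a) (P.abv v b)) := lt_max_of_lt_left one_pos
    have := Real.log_le_log (mul_pos hp hm1) (hloc v)
    rw [Real.log_mul hp.ne' hm1.ne', Real.log_mul (by split_ifs <;> norm_num)
      (mul_pos hm2 (hE0 v)).ne', Real.log_mul hm2.ne' (hE0 v).ne'] at this
    have h3 := mul_le_mul_of_nonneg_left this (P.w_pos v).le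
    have h4 : (if v ∈ P.arch then P.w v * Real.log 2 else 0) =
        P.w v * Real.log (if v ∈ P.arch then 2 else 1) := by split_ifs <;> simp
    rw [h4, lvec]
    linarith
  have hsum := Finset.sum_le_sum fun v (_ : v ∈ Finset.univ) => hlog v
  simp only [Finset.sum_add_distrib] at hsum
  rw [Finset.sum_ite_mem, Finset.univ_inter, ← Finset.sum_mul, P.sum_arch, one_mul] at hsum
  have h5 := sum_lvec_nonneg (P := P) (sub_mem (mul_mem ha hy) (mul_mem hb hx)) hμ
  rw [ht, ht]
  linarith

theorem ht_gap {u v u' v' : L} (hu : P.IsU u) (hv : P.IsU v) (hu' : P.IsU u') (hv' : P.IsU v')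
    (h : u + v = 1) (h' : u' + v' = 1) (hne : u ≠ u') :
    P.ht u v ≤ P.ht (u' / u) (v' / v) + Real.log 2 := by
  have h1 : u' / u * u + v' / v * v = 1 := by
    rw [div_mul_cancel₀ _ hu.1, div_mul_cancel₀ _ hv.1, h']
  have := ht_le_of_det_ne_zero (P := P) (x := 1) (y := 1) (z := 1) (U := u) (V := v)
    (one_mem _) (one_mem _) (hu'.div hu).2.1 (hv'.div hv).2.1 h1 (by simpa using h) ?_
    (fun _ => 1) (fun _ => one_pos) (fun v t ht => by
      simp only [List.mem_cons, List.not_mem_nil, or_false, or_self] at ht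
      rw [ht, map_one])
  · simpa using this
  · rw [mul_one, mul_one, sub_ne_zero]
    intro hab
    rw [← hab, ← mul_add, h, mul_one] at h1
    exact hne ((div_eq_one_iff_eq hu.1).1 h1).symm

theorem ht_pade [CharZero L] {u v u' v' : L} (hu : P.IsU u) (hv : P.IsU v) (hu' : P.IsU u')
    (hv' : P.IsU v') (h : u + v = 1) (h' : u' + v' = 1) (N : ℕ) :
    N * P.ht u v ≤ P.ht (u' / u ^ (2 * N + 1)) (v' / v ^ (2 * N + 1)) +
      7 * (N + 1) * Real.log 2 := by
  classical
  have h1 : u' / u ^ (2 * N + 1) * u ^ (2 * N + 1) +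
      v' / v ^ (2 * N + 1) * v ^ (2 * N + 1) = 1 := by
    rw [div_mul_cancel₀ _ (hu.pow _).1, div_mul_cancel₀ _ (hv.pow _).1, h']
  obtain ⟨x, y, z, hx, hy, hz, hxyz, hμ, hE⟩ := exists_pade_vector hu hv h N h1
  have hM : ∀ p : P.V, (0 : ℝ) < max 1 (max (P.abv p u) (P.abv p v)) := fun p =>
    lt_max_of_lt_left one_pos
  have hc : ∀ p : P.V, (0 : ℝ) < if p ∈ P.arch then 2 ^ (6 * (N + 1)) else 1 := fun p => by
    split_ifs <;> positivity
  have key := ht_le_of_det_ne_zero hx hy (hu'.div (hu.pow _)).2.1 (hv'.div (hv.pow _)).2.1 h1 hxyz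
    hμ (fun p => (if p ∈ P.arch then 2 ^ (6 * (N + 1)) else 1) *
      max 1 (max (P.abv p u) (P.abv p v)) ^ (N + 1))
    (fun p => mul_pos (hc p) (pow_pos (hM p) _))
    (fun p t ht => hE p _ (le_max_left _ _) ((le_max_left _ _).trans (le_max_right _ _))
      ((le_max_right _ _).trans (le_max_right _ _)) t ht)
  have hs : ∀ p, P.w p * Real.log ((if p ∈ P.arch then 2 ^ (6 * (N + 1)) else 1) *
      max 1 (max (P.abv p u) (P.abv p v)) ^ (N + 1)) =
      (if p ∈ P.arch then P.w p * ((6 * (N + 1) : ℕ) * Real.log 2) else 0) +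
      (N + 1 : ℕ) * (P.w p * Real.log (max 1 (max (P.abv p u) (P.abv p v)))) := by
    intro p
    rw [Real.log_mul (hc p).ne' (pow_pos (hM p) _).ne', Real.log_pow]
    split_ifs
    · rw [Real.log_pow]; ring
    · rw [Real.log_one]; ring
  simp only [hs, Finset.sum_add_distrib] at key
  rw [Finset.sum_ite_mem, Finset.univ_inter, ← Finset.sum_mul, P.sum_arch, one_mul,
    ← Finset.mul_sum, ht_pow hu.1 hv.1] at key
  change _ ≤ _ + (_ + (N + 1 : ℕ) * P.ht u v) + _ at key
  push_cast at key
  have hl : 0 ≤ Real.log 2 := Real.log_nonneg one_le_two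
  have hN : (0 : ℝ) ≤ N := N.cast_nonneg
  nlinarith [mul_nonneg hN hl]

end PlaceSystem

theorem sum_abs_sub_mul_le {I : Type*} [Fintype I] (f f' : I → ℝ) {n n' : ℝ} (k : ℝ) (hn : 0 < n)
    (hn' : 0 < n') : ∑ i, |f' i - k * f i| ≤
      n' * ∑ i, |f i / n - f' i / n'| + |n' - k * n| * ((∑ i, |f i|) / n) := by
  rw [Finset.mul_sum, Finset.sum_div, Finset.mul_sum, ← Finset.sum_add_distrib]
  refine Finset.sum_le_sum fun i _ => ?_
  have : f' i - k * f i = -(n' * (f i / n - f' i / n')) + (n' - k * n) * (f i / n) := by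
    field_simp; ring
  rw [this]
  refine (abs_add_le _ _).trans (le_of_eq ?_)
  rw [abs_neg, abs_mul, abs_mul, abs_of_pos hn', abs_div (f i), abs_of_pos hn]

namespace PlaceSystem

variable {L : Type u} [Field L] {P : PlaceSystem L}

theorem lsize_div_pow {u v u' v' : L} (hu : P.IsU u) (hv : P.IsU v) (hu' : P.IsU u')
    (hv' : P.IsU v') (k : ℕ) : P.lsize (u' / u ^ k) (v' / v ^ k) =
      ∑ p, |P.lvec u' p - k * P.lvec u p| + ∑ p, |P.lvec v' p - k * P.lvec v p| := by
  simp only [lsize, div_eq_mul_inv]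
  congr 1 <;> refine Finset.sum_congr rfl fun p _ => ?_
  · rw [lvec_mul hu'.1 (hu.pow k).inv.1, lvec_inv, lvec_pow, sub_eq_add_neg]
  · rw [lvec_mul hv'.1 (hv.pow k).inv.1, lvec_inv, lvec_pow, sub_eq_add_neg]

variable (P) in
/-- Closeness of the directions of two pairs. -/
def Near (δ : ℝ) (x y : L × L) : Prop :=
  ∑ p, |P.lvec x.1 p / P.lsize x.1 x.2 - P.lvec y.1 p / P.lsize y.1 y.2| +
    ∑ p, |P.lvec x.2 p / P.lsize x.1 x.2 - P.lvec y.2 p / P.lsize y.1 y.2| ≤ δ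

variable (P) in
/-- The solutions of the unit equation. -/
def IsSol (x : L × L) : Prop := P.IsU x.1 ∧ P.IsU x.2 ∧ x.1 + x.2 = 1

theorem two_mul_ht_le_of_near {x y : L × L} (hx : P.IsSol x) (hy : P.IsSol y) {δ : ℝ}
    (h : P.Near δ x y) (hn : 0 < P.lsize x.1 x.2) (hn' : 0 < P.lsize y.1 y.2) (k : ℕ) :
    2 * P.ht (y.1 / x.1 ^ k) (y.2 / x.2 ^ k) ≤
      P.lsize y.1 y.2 * δ + |P.lsize y.1 y.2 - k * P.lsize x.1 x.2| := by
  refine (two_mul_ht_le (hy.1.div (hx.1.pow k)) (hy.2.1.div (hx.2.1.pow k))).trans ?_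
  rw [lsize_div_pow hx.1 hx.2.1 hy.1 hy.2.1]
  have h1 := sum_abs_sub_mul_le (P.lvec x.1) (P.lvec y.1) (k : ℝ) hn hn'
  have h2 := sum_abs_sub_mul_le (P.lvec x.2) (P.lvec y.2) (k : ℝ) hn hn'
  have h3 : (∑ p, |P.lvec x.1 p|) / P.lsize x.1 x.2 + (∑ p, |P.lvec x.2 p|) / P.lsize x.1 x.2 =
      1 := by
    rw [← add_div]; exact div_self hn.ne'
  have h4 := mul_le_mul_of_nonneg_left h hn'.le
  have h5 := congrArg (fun t => |P.lsize y.1 y.2 - k * P.lsize x.1 x.2| * t) h3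
  simp only [mul_add, mul_one] at h4 h5
  linarith

theorem lsize_gap {x y : L × L} (hx : P.IsSol x) (hy : P.IsSol y) (h : P.Near (1 / 100) x y)
    (hn : 2000 ≤ P.lsize x.1 x.2) (hle : P.lsize x.1 x.2 ≤ P.lsize y.1 y.2) (hne : x ≠ y) :
    P.lsize x.1 x.2 * (7 / 5) ≤ P.lsize y.1 y.2 := by
  have hne' : x.1 ≠ y.1 := by
    intro h1
    refine hne (Prod.ext h1 ?_)
    have := hx.2.2.trans hy.2.2.symm
    rw [h1] at this
    exact add_left_cancel this
  have h1 := ht_gap hx.1 hx.2.1 hy.1 hy.2.1 hx.2.2 hy.2.2 hne'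
  have h2 := two_mul_ht_le_of_near hx hy h (by linarith) (by linarith) 1
  rw [pow_one, pow_one, Nat.cast_one, one_mul, abs_of_nonneg (sub_nonneg.2 hle)] at h2
  have h3 := lsize_le hx.1 hx.2.1
  have h4 := Real.log_two_lt_d9
  linarith

theorem lsize_lt {x y : L × L} [CharZero L] (hx : P.IsSol x) (hy : P.IsSol y)
    (h : P.Near (1 / 100) x y) (hn : 2000 ≤ P.lsize x.1 x.2)
    (hle : P.lsize x.1 x.2 ≤ P.lsize y.1 y.2) :
    P.lsize y.1 y.2 < P.lsize x.1 x.2 * 6 := by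
  set n := P.lsize x.1 x.2
  set n' := P.lsize y.1 y.2
  have hn0 : 0 < n := by linarith
  obtain ⟨N, hN1, hN2⟩ : ∃ N : ℕ, 2 * (N : ℝ) * n ≤ n' ∧ n' < (2 * (N : ℝ) + 2) * n := by
    refine ⟨⌊n' / (2 * n)⌋₊, ?_, ?_⟩
    · have := Nat.floor_le (show 0 ≤ n' / (2 * n) from
        div_nonneg (by linarith) (by linarith))
      rw [le_div_iff₀ (by positivity)] at this
      linarith
    · have := Nat.lt_floor_add_one (n' / (2 * n))
      rw [div_lt_iff₀ (by positivity)] at this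
      linarith
  have h1 := ht_pade hx.1 hx.2.1 hy.1 hy.2.1 hx.2.2 hy.2.2 N
  have h2 := two_mul_ht_le_of_near hx hy h hn0 (by linarith) (2 * N + 1)
  have h3 := lsize_le hx.1 hx.2.1
  have h4 := Real.log_two_lt_d9
  have h5 : |n' - ((2 * N + 1 : ℕ) : ℝ) * n| ≤ n := by
    rw [abs_le]; push_cast; constructor <;> linarith
  have hNn : (0 : ℝ) ≤ N := N.cast_nonneg
  have h6 : (N : ℝ) * n ≤ 4 * (N * P.ht x.1 x.2) := by
    have := mul_le_mul_of_nonneg_left h3 hNn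
    linarith
  have h7 : 7 * ((N : ℝ) + 1) * Real.log 2 ≤ 5 * (N + 1) := by nlinarith
  have h8 : (N : ℝ) + 1 ≤ (N + 1) * n / 2000 := by
    rw [le_div_iff₀ (by norm_num)]; nlinarith
  have h9 : (N : ℝ) * n < 3 * n := by nlinarith
  have h10 : (N : ℝ) < 3 := lt_of_mul_lt_mul_right h9 hn0.le
  have h11 : N ≤ 2 := by
    have : N < 3 := by exact_mod_cast h10
    omega
  have h12 : (N : ℝ) ≤ 2 := by exact_mod_cast h11
  nlinarith

theorem card_le_of_near [CharZero L] (S : Finset (L × L)) (hS : ∀ x ∈ S, P.IsSol x)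
    (hn : ∀ x ∈ S, 2000 ≤ P.lsize x.1 x.2)
    (h : ∀ x ∈ S, ∀ y ∈ S, P.Near (1 / 100) x y) : S.card ≤ 16 := by
  classical
  rcases S.eq_empty_or_nonempty with rfl | hne
  · simp
  obtain ⟨x₀, hx₀, hmin⟩ := S.exists_min_image (fun x => P.lsize x.1 x.2) hne
  set n := P.lsize x₀.1 x₀.2 with hn_def
  have hn0 : 0 < n := by have := hn _ hx₀; linarith
  have hc : 0 < 2 / 5 * n := by positivity
  have := Finset.card_le_card_of_injOn (s := S) (t := Finset.range 16)
    (fun x => ⌊P.lsize x.1 x.2 / (2 / 5 * n)⌋₊) ?_ ?_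
  · simpa using this
  · intro x hx
    rw [Finset.mem_coe, Finset.mem_range]
    have h1 := lsize_lt (hS _ hx₀) (hS _ hx) (h _ hx₀ _ hx) (hn _ hx₀) (hmin _ hx)
    rw [Nat.floor_lt (div_nonneg (by linarith [hmin _ hx]) hc.le), div_lt_iff₀ hc]
    push_cast
    linarith
  · have key : ∀ x ∈ S, ∀ y ∈ S, P.lsize x.1 x.2 ≤ P.lsize y.1 y.2 →
        ⌊P.lsize x.1 x.2 / (2 / 5 * n)⌋₊ = ⌊P.lsize y.1 y.2 / (2 / 5 * n)⌋₊ → x = y := by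
      intro x hx y hy hle hfl
      by_contra hne
      have h1 := lsize_gap (hS _ hx) (hS _ hy) (h _ hx _ hy) (hn _ hx) hle hne
      have h2 := hmin _ hx
      have h3 := Nat.floor_le (show 0 ≤ P.lsize x.1 x.2 / (2 / 5 * n) from
        div_nonneg (by linarith) hc.le)
      have h4 := Nat.lt_floor_add_one (P.lsize y.1 y.2 / (2 / 5 * n))
      rw [← hfl] at h4
      have h5 : P.lsize y.1 y.2 / (2 / 5 * n) < P.lsize x.1 x.2 / (2 / 5 * n) + 1 := by linarith
      rw [div_add_one hc.ne', div_lt_div_iff_of_pos_right hc] at h5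
      linarith
    intro x hx y hy hxy
    rcases le_total (P.lsize x.1 x.2) (P.lsize y.1 y.2) with hle | hle
    · exact key x hx y hy hle hxy
    · exact (key y hy x hx hle hxy.symm).symm

end PlaceSystem

namespace PlaceSystem

variable {L : Type u} [Field L] {P : PlaceSystem L}

theorem pow_cases_of_small [DecidableEq L]
    (hB : ∀ p ≤ 1 + 6 * Nat.factorial 6, p.Prime → P.IsU (p : L)) {x y z : L × L}
    (hx : P.IsSol x) (hy : P.IsSol y) (hz : P.IsSol z) (hxz : x ≠ z) {ε : ℝ}
    (hε : 6 * Real.exp ε ^ (1 + 6 * Nat.factorial 6) < 7)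
    (hsmall : P.ht (y.1 / x.1) (y.2 / x.2) + P.ht (z.1 / x.1) (z.2 / x.2) ≤ ε) :
    (y.1 / x.1) ^ Nat.factorial 6 = (z.1 / x.1) ^ Nat.factorial 6 ∨
    ((y.1 / x.1) * (z.2 / x.2)) ^ Nat.factorial 6 = (z.1 / x.1) ^ Nat.factorial 6 ∨
    (y.2 / x.2) ^ Nat.factorial 6 = (z.1 / x.1) ^ Nat.factorial 6 ∨
    ((z.1 / x.1) * (y.2 / x.2)) ^ Nat.factorial 6 = (z.1 / x.1) ^ Nat.factorial 6 := by
  set a := y.1 / x.1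
  set b := y.2 / x.2
  set U := z.1 / x.1
  set V := z.2 / x.2
  have ha : P.IsU a := hy.1.div hx.1
  have hb : P.IsU b := hy.2.1.div hx.2.1
  have hU : P.IsU U := hz.1.div hx.1
  have hV : P.IsU V := hz.2.1.div hx.2.1
  have e1 : x.1 * a + x.2 * b = 1 := by
    rw [mul_div_cancel₀ _ hx.1.1, mul_div_cancel₀ _ hx.2.1.1, hy.2.2]
  have e2 : x.1 * U + x.2 * V = 1 := by
    rw [mul_div_cancel₀ _ hx.1.1, mul_div_cancel₀ _ hx.2.1.1, hz.2.2]
  have hdet : a - a * V - b + U * b + V - U = 0 := by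
    apply mul_left_cancel₀ hx.1.1
    linear_combination (1 - V) * e1 - (1 - b) * e2 + (V - b) * hx.2.2
  have hUV : U ≠ V := by
    intro h
    rw [← h, ← add_mul, hx.2.2, one_mul] at e2
    refine hxz (Prod.ext ?_ ?_)
    · exact ((div_eq_one_iff_eq hx.1.1).1 e2).symm
    · exact ((div_eq_one_iff_eq hx.2.1.1).1 (h.symm.trans e2)).symm
  have heven : ∀ t : L, (-t) ^ Nat.factorial 6 = t ^ Nat.factorial 6 := fun t =>
    Even.neg_pow (by decide) t
  by_contra! hcon
  obtain ⟨c1, c2, c3, c4⟩ := hcon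
  have key := sum_filter_pow_eq_zero (P := P) 6 (Fintype.card_fin 6) hB
    ![a, -(a * V), -b, U * b, V, -U] ?_ ?_ ?_
    (fun v => max 1 (max (P.abv v a) (P.abv v b)) * max 1 (max (P.abv v U) (P.abv v V))) ?_ ?_
    (U ^ Nat.factorial 6)
  · rw [Finset.sum_filter, Fin.sum_univ_six] at key
    change (((((if a ^ Nat.factorial 6 = U ^ Nat.factorial 6 then a else 0) +
      if (-(a * V)) ^ Nat.factorial 6 = U ^ Nat.factorial 6 then -(a * V) else 0) +
      if (-b) ^ Nat.factorial 6 = U ^ Nat.factorial 6 then -b else 0) +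
      if (U * b) ^ Nat.factorial 6 = U ^ Nat.factorial 6 then U * b else 0) +
      if V ^ Nat.factorial 6 = U ^ Nat.factorial 6 then V else 0) +
      (if (-U) ^ Nat.factorial 6 = U ^ Nat.factorial 6 then -U else 0) = 0 at key
    rw [heven, heven, heven] at key
    rw [if_neg c1, if_neg c2, if_neg c3, if_neg c4, if_pos rfl] at key
    split_ifs at key with hVU
    · exact hUV (by linear_combination -key)
    · exact hU.1 (by linear_combination -key)
  · intro i
    fin_cases i
    exacts [ha.2.1, (ha.mul hV).neg.2.1, hb.neg.2.1, (hU.mul hb).2.1, hV.2.1, hU.neg.2.1]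
  · intro i
    fin_cases i
    exacts [ha.1, (ha.mul hV).neg.1, hb.neg.1, (hU.mul hb).1, hV.1, hU.neg.1]
  · rw [Fin.sum_univ_six]
    simp only [Matrix.cons_val_zero, Matrix.cons_val_one, Matrix.cons_val]
    linear_combination hdet
  · intro v i
    set A := max 1 (max (P.abv v a) (P.abv v b))
    set B := max 1 (max (P.abv v U) (P.abv v V))
    have hA1 : 1 ≤ A := le_max_left _ _
    have hB1 : 1 ≤ B := le_max_left _ _
    have hAa : P.abv v a ≤ A := (le_max_left _ _).trans (le_max_right _ _)
    have hAb : P.abv v b ≤ A := (le_max_right _ _).trans (le_max_right _ _)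
    have hBU : P.abv v U ≤ B := (le_max_left _ _).trans (le_max_right _ _)
    have hBV : P.abv v V ≤ B := (le_max_right _ _).trans (le_max_right _ _)
    have hA0 : 0 ≤ A := zero_le_one.trans hA1
    have hB0 : 0 ≤ B := zero_le_one.trans hB1
    have l1 : A ≤ A * B := le_mul_of_one_le_right hA0 hB1
    have l2 : B ≤ A * B := le_mul_of_one_le_left hB0 hA1
    fin_cases i
    · exact hAa.trans l1
    · change P.abv v (-(a * V)) ≤ _
      rw [AbsoluteValue.map_neg, map_mul]
      exact mul_le_mul hAa hBV ((P.abv v).nonneg _) hA0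
    · change P.abv v (-b) ≤ _
      rw [AbsoluteValue.map_neg]
      exact hAb.trans l1
    · change P.abv v (U * b) ≤ _
      rw [map_mul, mul_comm]
      exact mul_le_mul hAb hBU ((P.abv v).nonneg _) hA0
    · exact hBV.trans l2
    · change P.abv v (-U) ≤ _
      rw [AbsoluteValue.map_neg]
      exact hBU.trans l2
  · have hpos : ∀ (s t : L) (v : P.V), 0 < max 1 (max (P.abv v s) (P.abv v t)) := fun _ _ _ =>
      lt_max_of_lt_left one_pos
    have hexp : ∏ v, (max 1 (max (P.abv v a) (P.abv v b)) *
        max 1 (max (P.abv v U) (P.abv v V))) ^ P.w v = Real.exp (P.ht a b + P.ht U V) := by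
      rw [ht, ht, ← Finset.sum_add_distrib, Real.exp_sum]
      refine Finset.prod_congr rfl fun v _ => ?_
      rw [← mul_add, ← Real.log_mul (hpos _ _ _).ne' (hpos _ _ _).ne', mul_comm (P.w v),
        Real.rpow_def_of_pos (mul_pos (hpos _ _ _) (hpos _ _ _))]
    rw [hexp]
    have h1 : Real.exp (P.ht a b + P.ht U V) ≤ Real.exp ε := Real.exp_le_exp.2 hsmall
    have h2 := pow_le_pow_left₀ (Real.exp_pos _).le h1 (1 + 6 * Nat.factorial 6)
    push_cast
    linarith

theorem card_le_of_small [DecidableEq L]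
    (hB : ∀ p ≤ 1 + 6 * Nat.factorial 6, p.Prime → P.IsU (p : L)) {ε : ℝ}
    (hε : 6 * Real.exp ε ^ (1 + 6 * Nat.factorial 6) < 7)
    (S : Finset (L × L)) (hS : ∀ x ∈ S, P.IsSol x)
    (h : ∀ x ∈ S, ∀ y ∈ S, ∑ p, |P.lvec y.1 p - P.lvec x.1 p| +
      ∑ p, |P.lvec y.2 p - P.lvec x.2 p| ≤ ε) : S.card ≤ 4 * Nat.factorial 6 + 1 := by
  rcases le_or_gt S.card 1 with h1 | h1
  · exact h1.trans (Nat.le_add_left _ _)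
  obtain ⟨x, hx, z, hz, hxz⟩ := Finset.one_lt_card.1 h1
  have hfac : 0 < Nat.factorial 6 := Nat.factorial_pos 6
  have hht : ∀ y ∈ S, P.ht (y.1 / x.1) (y.2 / x.2) ≤ ε / 2 := by
    intro y hy
    have h1 := two_mul_ht_le ((hS y hy).1.div (hS x hx).1) ((hS y hy).2.1.div (hS x hx).2.1)
    have h2 := lsize_div_pow (hS x hx).1 (hS x hx).2.1 (hS y hy).1 (hS y hy).2.1 1
    simp only [pow_one, Nat.cast_one, one_mul] at h2
    rw [h2] at h1
    have := h x hx y hy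
    linarith
  have hroot : ∀ (f : L × L → L) (c : L), (∀ y ∈ S, ∀ y' ∈ S, f y = f y' → y = y') →
      (S.filter fun y => f y ^ Nat.factorial 6 = c).card ≤ Nat.factorial 6 := by
    intro f c hf
    refine (Finset.card_le_card_of_injOn (t := (Polynomial.nthRoots (Nat.factorial 6) c).toFinset)
      f ?_ ?_).trans ((Multiset.toFinset_card_le _).trans (Polynomial.card_nthRoots _ _))
    · intro y hy
      rw [Finset.mem_coe, Finset.mem_filter] at hy
      rw [Finset.mem_coe, Multiset.mem_toFinset, Polynomial.mem_nthRoots hfac]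
      exact hy.2
    · intro y hy y' hy' hyy
      rw [Finset.mem_coe, Finset.mem_filter] at hy hy'
      exact hf y hy.1 y' hy'.1 hyy
  have inj1 : ∀ y ∈ S, ∀ y' ∈ S, y.1 = y'.1 → y = y' := fun y hy y' hy' e =>
    Prod.ext e (by
      have := (hS y hy).2.2.trans (hS y' hy').2.2.symm
      rw [e] at this
      exact add_left_cancel this)
  have inj2 : ∀ y ∈ S, ∀ y' ∈ S, y.2 = y'.2 → y = y' := fun y hy y' hy' e =>
    Prod.ext (by
      have := (hS y hy).2.2.trans (hS y' hy').2.2.symm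
      rw [e] at this
      exact add_right_cancel this) e
  have hx1 := (hS x hx).1.1
  have hx2 := (hS x hx).2.1.1
  have hz1 := ((hS z hz).1.div (hS x hx).1).1
  have hz2 := ((hS z hz).2.1.div (hS x hx).2.1).1
  set c := (z.1 / x.1) ^ Nat.factorial 6
  have hsub : S ⊆ ((S.filter fun y => (y.1 / x.1) ^ Nat.factorial 6 = c) ∪
      (S.filter fun y => (y.1 / x.1 * (z.2 / x.2)) ^ Nat.factorial 6 = c)) ∪
      ((S.filter fun y => (y.2 / x.2) ^ Nat.factorial 6 = c) ∪
      (S.filter fun y => (z.1 / x.1 * (y.2 / x.2)) ^ Nat.factorial 6 = c)) := by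
    intro y hy
    have := pow_cases_of_small hB (hS x hx) (hS y hy) (hS z hz) hxz hε
      (by linarith [hht y hy, hht z hz])
    simp only [Finset.mem_union, Finset.mem_filter, hy, true_and]
    tauto
  refine (Finset.card_le_card hsub).trans ((Finset.card_union_le _ _).trans ?_)
  have c1 := hroot (fun y => y.1 / x.1) c fun y hy y' hy' e =>
    inj1 y hy y' hy' ((div_left_inj' hx1).1 e)
  have c2 := hroot (fun y => y.1 / x.1 * (z.2 / x.2)) c fun y hy y' hy' e =>
    inj1 y hy y' hy' ((div_left_inj' hx1).1 (mul_right_cancel₀ hz2 e))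
  have c3 := hroot (fun y => y.2 / x.2) c fun y hy y' hy' e =>
    inj2 y hy y' hy' ((div_left_inj' hx2).1 e)
  have c4 := hroot (fun y => z.1 / x.1 * (y.2 / x.2)) c fun y hy y' hy' e =>
    inj2 y hy y' hy' ((div_left_inj' hx2).1 (mul_left_cancel₀ hz1 e))
  have d1 := Finset.card_union_le (S.filter fun y => (y.1 / x.1) ^ Nat.factorial 6 = c)
    (S.filter fun y => (y.1 / x.1 * (z.2 / x.2)) ^ Nat.factorial 6 = c)
  have d2 := Finset.card_union_le (S.filter fun y => (y.2 / x.2) ^ Nat.factorial 6 = c)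
    (S.filter fun y => (z.1 / x.1 * (y.2 / x.2)) ^ Nat.factorial 6 = c)
  omega

end PlaceSystem

namespace PlaceSystem

theorem exists_lvec_coords {L : Type u} [Field L] {P : PlaceSystem L} {ρ : ℕ} {g : Fin ρ → L}
    (hg : ∀ i, P.IsU (g i)) {a : L} (ha : P.IsU a) (h : RankLE g a) :
    ∃ q : Fin ρ → ℝ, ∀ v, P.lvec a v = ∑ i, q i * P.lvec (g i) v := by
  obtain ⟨q, hq⟩ := exists_log_coords hg ha h
  refine ⟨q, fun v => ?_⟩
  rw [lvec, hq, Finset.mul_sum]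
  exact Finset.sum_congr rfl fun i _ => by rw [lvec]; ring

/-- If a scaling of the logarithmic vectors is bounded, and any part of `S` on which the scaled
vectors are close to each other has at most `c` elements, then `S` is bounded. -/
theorem exists_card_le_of_scaled (ρ : ℕ) (δ R : ℝ) (hδ : 0 < δ) (c : ℕ) : ∃ N : ℕ,
    ∀ (L : Type u) [Field L] (P : PlaceSystem L) (g : Fin ρ → L), (∀ i, P.IsU (g i)) →
      ∀ (S : Finset (L × L)) (s : L × L → ℝ),
      (∀ x ∈ S, P.IsSol x ∧ RankLE g x.1 ∧ RankLE g x.2) →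
      (∀ x ∈ S, ∑ p, |s x * P.lvec x.1 p| ≤ R ∧ ∑ p, |s x * P.lvec x.2 p| ≤ R) →
      (∀ T ⊆ S, (∀ x ∈ T, ∀ y ∈ T, ∑ p, |s y * P.lvec y.1 p - s x * P.lvec x.1 p| ≤ δ ∧
        ∑ p, |s y * P.lvec y.2 p - s x * P.lvec x.2 p| ≤ δ) → T.card ≤ c) → S.card ≤ N := by
  classical
  obtain ⟨K, hK⟩ := exists_packing.{u} ρ δ R hδ
  let D : Finset (Fin ρ → ℤ) := Fintype.piFinset fun _ => Finset.Icc (-K : ℤ) K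
  refine ⟨c * (D ×ˢ D).card, fun L _ P g hg S s hS hR hT => ?_⟩
  obtain ⟨Λ, h1, h2⟩ := hK P.V fun j p => P.lvec (g j) p
  have hcoord : ∀ {a : L}, P.IsU a → RankLE g a → ∀ t : ℝ, ∃ q : Fin ρ → ℝ,
      (fun p => t * P.lvec a p) = fun p => ∑ i, q i * P.lvec (g i) p := by
    intro a ha har t
    obtain ⟨q, hq⟩ := exists_lvec_coords hg ha har
    refine ⟨fun i => t * q i, funext fun p => ?_⟩
    rw [hq, Finset.mul_sum]
    exact Finset.sum_congr rfl fun i _ => by ring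
  refine Finset.card_le_mul_card_image_of_maps_to
    (f := fun x => (Λ fun p => s x * P.lvec x.1 p, Λ fun p => s x * P.lvec x.2 p)) ?_ c ?_
  · intro x hx
    exact Finset.mem_product.2 ⟨h1 _ (hR x hx).1, h1 _ (hR x hx).2⟩
  · intro b _
    refine hT _ (Finset.filter_subset _ _) fun x hx y hy => ?_
    rw [Finset.mem_filter] at hx hy
    have hxy := hy.2.trans hx.2.symm
    rw [Prod.mk.injEq] at hxy
    have aux : ∀ {a b : L}, P.IsU a → P.IsU b → RankLE g a → RankLE g b → ∀ t t' : ℝ,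
        Λ (fun p => t * P.lvec a p) = Λ (fun p => t' * P.lvec b p) →
        ∑ p, |t * P.lvec a p - t' * P.lvec b p| ≤ δ := by
      intro a b ha hb har hbr t t' hΛ
      obtain ⟨q, hq⟩ := hcoord ha har t
      obtain ⟨q', hq'⟩ := hcoord hb hbr t'
      rw [hq, hq'] at hΛ
      have := h2 q q' hΛ
      refine le_of_eq_of_le (Finset.sum_congr rfl fun p _ => ?_) this
      rw [← congrFun hq p, ← congrFun hq' p]
    obtain ⟨hxs, hx1, hx2⟩ := hS x hx.1
    obtain ⟨hys, hy1, hy2⟩ := hS y hy.1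
    exact ⟨aux hys.1 hxs.1 hy1 hx1 _ _ hxy.1, aux hys.2.1 hxs.2.1 hy2 hx2 _ _ hxy.2⟩

theorem exists_card_sol_le (ρ : ℕ) : ∃ B N : ℕ, ∀ (L : Type u) [Field L] [CharZero L]
    (P : PlaceSystem L) (g : Fin ρ → L), (∀ p ≤ B, p.Prime → P.IsU (p : L)) →
      (∀ i, P.IsU (g i)) → ∀ S : Finset (L × L),
      (∀ x ∈ S, P.IsSol x ∧ RankLE g x.1 ∧ RankLE g x.2) → S.card ≤ N := by
  classical
  set k := 1 + 6 * Nat.factorial 6 with hk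
  set ε := Real.log (13 / 12) / k with hε
  have hk0 : (0 : ℝ) < k := by rw [hk]; positivity
  have hε0 : 0 < ε := div_pos (Real.log_pos (by norm_num)) hk0
  have hεk : 6 * Real.exp ε ^ k < 7 := by
    rw [← Real.exp_nat_mul, hε, mul_div_cancel₀ _ hk0.ne', Real.exp_log (by norm_num)]
    norm_num
  obtain ⟨N₁, h1⟩ := exists_card_le_of_scaled.{u} ρ (1 / 200) 1 (by norm_num) 16
  obtain ⟨N₂, h2⟩ := exists_card_le_of_scaled.{u} ρ (ε / 2) 2000 (by positivity)
    (4 * Nat.factorial 6 + 1)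
  refine ⟨k, N₁ + N₂, fun L _ _ P g hB hg S hS => ?_⟩
  rw [← Finset.card_filter_add_card_filter_not (s := S) fun x => 2000 ≤ P.lsize x.1 x.2]
  have habs : ∀ a : L, 0 ≤ ∑ p, |P.lvec a p| := fun a => Finset.sum_nonneg fun _ _ => abs_nonneg _
  refine add_le_add ?_ ?_
  · refine h1 L P g hg _ (fun x => (P.lsize x.1 x.2)⁻¹)
      (fun x hx => hS x (Finset.mem_filter.1 hx).1) ?_ ?_
    · intro x hx
      have hn := (Finset.mem_filter.1 hx).2
      have hn0 : 0 < P.lsize x.1 x.2 := by linarith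
      simp only [abs_mul, abs_of_pos (inv_pos.2 hn0), ← Finset.mul_sum]
      rw [inv_mul_le_iff₀ hn0, inv_mul_le_iff₀ hn0, mul_one, lsize]
      exact ⟨le_add_of_nonneg_right (habs _), le_add_of_nonneg_left (habs _)⟩
    · intro T hT hnear
      refine card_le_of_near (P := P) T (fun x hx => (hS x (Finset.mem_filter.1 (hT hx)).1).1)
        (fun x hx => (Finset.mem_filter.1 (hT hx)).2) fun x hx y hy => ?_
      obtain ⟨h3, h4⟩ := hnear y hy x hx
      rw [Near]
      simp only [div_eq_inv_mul]
      linarith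
  · refine h2 L P g hg _ (fun _ => 1) (fun x hx => hS x (Finset.mem_filter.1 hx).1) ?_ ?_
    · intro x hx
      have hn := not_le.1 (Finset.mem_filter.1 hx).2
      rw [lsize] at hn
      simp only [one_mul]
      exact ⟨by linarith [habs x.2], by linarith [habs x.1]⟩
    · intro T hT hnear
      refine card_le_of_small (P := P) hB hεk T
        (fun x hx => (hS x (Finset.mem_filter.1 (hT hx)).1).1) fun x hx y hy => ?_
      have := hnear x hx y hy
      simp only [one_mul] at this
      linarith

end PlaceSystem

theorem exists_card_unit_pairs_le (ρ : ℕ) : ∃ N : ℕ, ∀ (K : Type u) [Field K] [CharZero K]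
    (g : Fin ρ → K) (S : Finset (K × K)), (∀ i, g i ≠ 0) →
      (∀ x ∈ S, x.1 ≠ 0 ∧ x.2 ≠ 0 ∧ x.1 + x.2 = 1 ∧ RankLE g x.1 ∧ RankLE g x.2) →
      S.card ≤ N := by
  classical
  obtain ⟨B, N, h⟩ := PlaceSystem.exists_card_sol_le.{u} ρ
  refine ⟨N, fun K _ _ g S hg hS => ?_⟩
  let F : Finset K := (S.image Prod.fst ∪ S.image Prod.snd ∪ Finset.univ.image g ∪
    (S ×ˢ S).image fun p => p.1.1 - p.2.1).erase 0
  obtain ⟨L, _, _, P, R, σ, hσ, hp⟩ := exists_specialization F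
    (fun x hx => Finset.ne_of_mem_erase hx) B
  have h1F : ∀ x ∈ S, x.1 ∈ F := fun x hx => by
    simp only [F, Finset.mem_erase, Finset.mem_union]
    exact ⟨(hS x hx).1, Or.inl (Or.inl (Or.inl (Finset.mem_image_of_mem _ hx)))⟩
  have h2F : ∀ x ∈ S, x.2 ∈ F := fun x hx => by
    simp only [F, Finset.mem_erase, Finset.mem_union]
    exact ⟨(hS x hx).2.1, Or.inl (Or.inl (Or.inr (Finset.mem_image_of_mem _ hx)))⟩
  have hgF : ∀ i, g i ∈ F := fun i => by simp [F, hg i]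
  let f : K → L := fun a => if h : a ∈ R then σ ⟨a, h⟩ else 0
  have hf : ∀ a (h : a ∈ R), f a = σ ⟨a, h⟩ := fun a h => dif_pos h
  have hR : ∀ a ∈ F, a ∈ R := fun a ha => (hσ a ha).1
  have hfU : ∀ a ∈ F, P.IsU (f a) := fun a ha => by
    rw [hf _ (hR a ha)]; exact (hσ a ha).2
  have hfr : ∀ a ∈ F, RankLE g a → RankLE (fun i => f (g i)) (f a) := fun a ha har => by
    have := har.map σ (fun i => hR _ (hgF i)) (hR a ha)
    simpa only [hf _ (hR a ha), hf _ (hR _ (hgF _))] using this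
  have hinj : Set.InjOn (fun x : K × K => (f x.1, f x.2)) (S : Set (K × K)) := by
    intro x hx y hy hxy
    have e := congrArg Prod.fst hxy
    change f x.1 = f y.1 at e
    have h1 : x.1 = y.1 := by
      by_contra hne
      have hd : x.1 - y.1 ∈ F := by
        simp only [F, Finset.mem_erase, sub_ne_zero.2 hne, Finset.mem_union, ne_eq,
          not_false_eq_true, true_and]
        exact Or.inr (Finset.mem_image.2 ⟨(x, y), Finset.mem_product.2 ⟨hx, hy⟩, rfl⟩)
      refine (hfU _ hd).1 ?_
      have hx1 := hR _ (h1F x hx)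
      have hy1 := hR _ (h1F y hy)
      have : (⟨x.1 - y.1, hR _ hd⟩ : R) = ⟨x.1, hx1⟩ - ⟨y.1, hy1⟩ := rfl
      rw [hf _ (hR _ hd), this, map_sub, ← hf, ← hf, e, sub_self]
    have h2 := (hS x hx).2.2.1.trans (hS y hy).2.2.1.symm
    rw [h1] at h2
    exact Prod.ext h1 (add_left_cancel h2)
  rw [← Finset.card_image_of_injOn hinj]
  refine h L P (fun i => f (g i)) (fun p hpB hpp => hp p hpp.ne_zero hpB)
    (fun i => hfU _ (hgF i)) _ fun y hy => ?_
  obtain ⟨x, hx, rfl⟩ := Finset.mem_image.1 hy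
  obtain ⟨_, _, h3, h4, h5⟩ := hS x hx
  refine ⟨⟨hfU _ (h1F x hx), hfU _ (h2F x hx), ?_⟩, hfr _ (h1F x hx) h4, hfr _ (h2F x hx) h5⟩
  have : (⟨x.1, hR _ (h1F x hx)⟩ : R) + ⟨x.2, hR _ (h2F x hx)⟩ = 1 := Subtype.ext h3
  change f x.1 + f x.2 = 1
  rw [hf _ (hR _ (h1F x hx)), hf _ (hR _ (h2F x hx)), ← map_add, this, map_one]

theorem rankLE_gen {K : Type*} [Field K] {ρ : ℕ} (g : Fin ρ → K) (i : Fin ρ) : RankLE g (g i) := by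
  classical
  refine ⟨1, one_pos, 0, Pi.single i 1, ?_⟩
  rw [Finset.prod_eq_single_of_mem (f := fun j => g j ^ (Pi.single i 1 : Fin ρ → ℕ) j) i
    (Finset.mem_univ i) fun j _ hj => by simp [Pi.single_eq_of_ne hj]]
  simp

theorem RankLE.mul {K : Type*} [Field K] {ρ : ℕ} {g : Fin ρ → K} {a b : K} (ha : RankLE g a)
    (hb : RankLE g b) : RankLE g (a * b) := by
  obtain ⟨k, hk, e, f, h⟩ := ha
  obtain ⟨l, hl, e', f', h'⟩ := hb
  refine ⟨k * l, Nat.mul_pos hk hl, fun i => e i * l + e' i * k, fun i => f i * l + f' i * k, ?_⟩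
  simp only [pow_add, pow_mul, Finset.prod_mul_distrib, Finset.prod_pow]
  rw [← h, ← h', mul_pow, mul_pow, mul_pow, ← pow_mul]
  ring

theorem RankLE.inv {K : Type*} [Field K] {ρ : ℕ} {g : Fin ρ → K} {a : K} (h0 : a ≠ 0)
    (ha : RankLE g a) : RankLE g a⁻¹ := by
  obtain ⟨k, hk, e, f, h⟩ := ha
  refine ⟨k, hk, f, e, ?_⟩
  rw [← h, ← mul_assoc, ← mul_pow, inv_mul_cancel₀ h0, one_pow, one_mul]

theorem RankLE.cons {K : Type*} [Field K] {ρ : ℕ} {g : Fin ρ → K} {a : K} (ha : RankLE g a)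
    (c : K) : RankLE (Fin.cons c g : Fin (ρ + 1) → K) a := by
  obtain ⟨k, hk, e, f, h⟩ := ha
  refine ⟨k, hk, Fin.cons 0 e, Fin.cons 0 f, ?_⟩
  simpa [Fin.prod_univ_succ] using h

/-- The projective line through two coordinates meets a set of bounded rank in few points. -/
theorem exists_ternary_count_bound (ρ : ℕ) : ∃ N : ℕ, ∀ (K : Type u) [Field K] [CharZero K]
    [DecidableEq K] (g : Fin ρ → K) (A : Finset K), (∀ i, g i ≠ 0) →
      (∀ a ∈ A, a ≠ 0 ∧ RankLE g a) → ∀ c d : K, c ≠ 0 → d ≠ 0 →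
      ((A ×ˢ A).filter fun x => c * x.1 + d * x.2 ∈ A).card ≤ N * A.card := by
  classical
  obtain ⟨N, h⟩ := exists_card_unit_pairs_le.{u} (ρ + 1 + 1)
  refine ⟨N, fun K _ _ _ g A hg hA c d hc hd => ?_⟩
  set S := (A ×ˢ A).filter fun x => c * x.1 + d * x.2 ∈ A
  let F : K × K → (K × K) × K := fun x =>
    ((c * x.1 * (c * x.1 + d * x.2)⁻¹, d * x.2 * (c * x.1 + d * x.2)⁻¹), c * x.1 + d * x.2)
  let G : Fin (ρ + 1 + 1) → K := Fin.cons c (Fin.cons d g : Fin (ρ + 1) → K)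
  have hG : ∀ {a : K}, RankLE g a → RankLE G a := fun h => (h.cons d).cons c
  have hGc : RankLE G c := rankLE_gen G 0
  have hGd : RankLE G d := rankLE_gen G 1
  have hS : ∀ x ∈ S, x.1 ∈ A ∧ x.2 ∈ A ∧ c * x.1 + d * x.2 ∈ A := fun x hx => by
    have := Finset.mem_filter.1 hx
    exact ⟨(Finset.mem_product.1 this.1).1, (Finset.mem_product.1 this.1).2, this.2⟩
  have hT := h K G (S.image fun x => (F x).1) ?_ ?_
  · have hcard : S.card ≤ ((S.image fun x => (F x).1) ×ˢ A).card := by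
      refine Finset.card_le_card_of_injOn F ?_ ?_
      · intro x hx
        exact Finset.mem_product.2 ⟨Finset.mem_image_of_mem _ hx, (hS x hx).2.2⟩
      · intro x hx y hy hxy
        have h0 := (hA _ (hS x hx).2.2).1
        have h3 : c * x.1 + d * x.2 = c * y.1 + d * y.2 := congrArg Prod.snd hxy
        have h1 := congrArg (fun t => t.1.1) hxy
        have h2 := congrArg (fun t => t.1.2) hxy
        simp only [F, ← h3] at h1 h2
        exact Prod.ext (mul_left_cancel₀ hc (mul_right_cancel₀ (inv_ne_zero h0) h1))
          (mul_left_cancel₀ hd (mul_right_cancel₀ (inv_ne_zero h0) h2))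
    refine hcard.trans ?_
    rw [Finset.card_product]
    exact Nat.mul_le_mul_right _ hT
  · intro i
    refine Fin.cases hc (fun i => Fin.cases hd (fun i => ?_) i) i
    exact hg i
  · intro y hy
    obtain ⟨x, hx, rfl⟩ := Finset.mem_image.1 hy
    obtain ⟨h1, h2, h3⟩ := hS x hx
    have h0 := (hA _ h3).1
    refine ⟨mul_ne_zero (mul_ne_zero hc (hA _ h1).1) (inv_ne_zero h0),
      mul_ne_zero (mul_ne_zero hd (hA _ h2).1) (inv_ne_zero h0), ?_,
      (hGc.mul (hG (hA _ h1).2)).mul ((hG (hA _ h3).2).inv h0),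
      (hGd.mul (hG (hA _ h2).2)).mul ((hG (hA _ h3).2).inv h0)⟩
    simp only [F]
    rw [← add_mul, mul_inv_cancel₀ h0]

/-- The properties of a finite set of bounded multiplicative rank that matter for counting
matrices. -/
structure SmallRank {K : Type*} [Field K] [DecidableEq K] (N : ℕ) (C : ℝ) (A : Finset K) :
    Prop where
  zero_notMem : (0 : K) ∉ A
  nonempty : A.Nonempty
  one_le : 1 ≤ C
  lin : ∀ (ι : Type) [Fintype ι] [DecidableEq ι], Fintype.card ι ≤ N → ∀ (c : ι → K),
    (∀ i, c i ≠ 0) → ∀ v : K,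
      (((Fintype.piFinset fun _ : ι => A).filter fun x => ∑ i, c i * x i = v).card : ℝ) ≤
        C * √(A.card) ^ Fintype.card ι
  tern : ∀ c d : K, c ≠ 0 → d ≠ 0 →
    (((A ×ˢ A).filter fun x => c * x.1 + d * x.2 ∈ A).card : ℝ) ≤ C * A.card

theorem exists_rankLE_of_finRank {K : Type*} [Field K] {Γ : Subgroup Kˣ} {ρ : ℕ}
    (hΓ : FinRank Γ ρ) : ∃ g : Fin ρ → K, (∀ i, g i ≠ 0) ∧ ∀ u ∈ Γ, RankLE g (u : K) := by
  classical
  obtain ⟨S, hS, -, h⟩ := hΓ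
  let e := (S.equivFinOfCardEq hS).symm
  refine ⟨fun i => ((e i : Kˣ) : K), fun i => Units.ne_zero _, fun u hu => ?_⟩
  obtain ⟨k, hk, hx⟩ := h u hu
  have key : ∀ x ∈ Subgroup.closure (S : Set Kˣ), ∃ p q : Fin ρ → ℕ,
      x * ∏ i, (e i : Kˣ) ^ p i = ∏ i, (e i : Kˣ) ^ q i := by
    intro x hx
    induction hx using Subgroup.closure_induction with
    | mem x hx =>
      refine ⟨0, Pi.single (e.symm ⟨x, hx⟩) 1, ?_⟩
      rw [Finset.prod_eq_single_of_mem
        (f := fun j => (e j : Kˣ) ^ (Pi.single (e.symm ⟨x, hx⟩) 1 : Fin ρ → ℕ) j) (e.symm ⟨x, hx⟩)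
        (Finset.mem_univ _) fun j _ hj => by simp [Pi.single_eq_of_ne hj]]
      simp
    | one => exact ⟨0, 0, by simp⟩
    | mul x y _ _ hx hy =>
      obtain ⟨p, q, h⟩ := hx
      obtain ⟨p', q', h'⟩ := hy
      refine ⟨p + p', q + q', ?_⟩
      simp only [Pi.add_apply, pow_add, Finset.prod_mul_distrib]
      rw [← h, ← h', mul_mul_mul_comm]
    | inv x _ hx =>
      obtain ⟨p, q, h⟩ := hx
      exact ⟨q, p, by rw [← h, inv_mul_cancel_left]⟩
  obtain ⟨p, q, hpq⟩ := key _ hx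
  refine ⟨k, hk, p, q, ?_⟩
  have := congrArg (fun x : Kˣ => (x : K)) hpq
  simpa only [Units.val_mul, Units.val_pow_eq_pow_val, Units.coe_prod] using this

theorem exists_smallRank (N ρ : ℕ) : ∃ C : ℝ, ∀ (K : Type u) [Field K] [CharZero K]
    [DecidableEq K] (Γ : Subgroup Kˣ), FinRank Γ ρ → ∀ A : Finset K, A.Nonempty →
      (∀ a ∈ A, ∃ u : Kˣ, u ∈ Γ ∧ (u : K) = a) → SmallRank N C A := by
  obtain ⟨C, hC, h⟩ := exists_linear_count_bound.{u} N ρ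
  obtain ⟨M, hM⟩ := exists_ternary_count_bound.{u} ρ
  refine ⟨max C M, fun K _ _ _ Γ hΓ A hne hA => ?_⟩
  obtain ⟨g, hg, hgΓ⟩ := exists_rankLE_of_finRank hΓ
  have hA' : ∀ a ∈ A, a ≠ 0 ∧ RankLE g a := fun a ha => by
    obtain ⟨u, hu, rfl⟩ := hA a ha
    exact ⟨u.ne_zero, hgΓ u hu⟩
  refine ⟨fun h0 => (hA' 0 h0).1 rfl, hne, hC.trans (le_max_left _ _), ?_, ?_⟩
  · intro ι _ _ hι c hc v
    exact (h K g A hg hA' ι hι c hc v).trans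
      (mul_le_mul_of_nonneg_right (le_max_left _ _) (by positivity))
  · intro c d hc hd
    calc _ ≤ ((M * A.card : ℕ) : ℝ) := by exact_mod_cast hM K g A hg hA' c d hc hd
      _ ≤ _ := by
        rw [Nat.cast_mul]
        exact mul_le_mul_of_nonneg_right (le_max_right _ _) (Nat.cast_nonneg _)

theorem ncard_prod_le {α β : Type*} [Finite α] [Finite β] (S : Set (α × β)) (T : Set α) {c : ℝ}
    (hT : ∀ p ∈ S, p.1 ∈ T) (hc : ∀ x ∈ T, ({y | (x, y) ∈ S}.ncard : ℝ) ≤ c) :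
    (S.ncard : ℝ) ≤ T.ncard * c := by
  classical
  have := Fintype.ofFinite α
  have := Fintype.ofFinite β
  have hS : S.ncard = ∑ x ∈ T.toFinset, {y | (x, y) ∈ S}.ncard := by
    rw [Set.ncard_eq_toFinset_card' S, Finset.card_eq_sum_card_fiberwise (f := Prod.fst)
      (t := T.toFinset) (fun p hp => by simpa using hT p (by simpa using hp))]
    refine Finset.sum_congr rfl fun x _ => ?_
    rw [Set.ncard_eq_toFinset_card']
    refine Finset.card_bij' (fun p _ => p.2) (fun y _ => (x, y)) ?_ ?_ ?_ ?_
    · rintro ⟨x', y⟩ h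
      simp only [Finset.mem_filter, Set.mem_toFinset] at h ⊢
      obtain ⟨h, rfl⟩ := h
      exact h
    · intro y h
      simpa using h
    · rintro ⟨x', y⟩ h
      simp only [Finset.mem_filter] at h
      exact Prod.ext h.2.symm rfl
    · intro y h
      rfl
  rw [hS, Nat.cast_sum, Set.ncard_eq_toFinset_card' T, ← nsmul_eq_mul]
  exact Finset.sum_le_card_nsmul _ _ _ fun x hx => hc x (by simpa using hx)

theorem ncard_pi_le {ι α : Type*} [Fintype ι] [Finite α] (S : Set (ι → α)) (T : ι → Set α) {c : ℝ}
    (hT : ∀ x ∈ S, ∀ i, x i ∈ T i) (hc : ∀ i, ((T i).ncard : ℝ) ≤ c) :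
    (S.ncard : ℝ) ≤ c ^ Fintype.card ι := by
  classical
  have := Fintype.ofFinite α
  have h1 : S.ncard ≤ ∏ i, (T i).ncard := by
    simp only [Set.ncard_eq_toFinset_card']
    rw [← Fintype.card_piFinset]
    refine Finset.card_le_card fun x hx => Fintype.mem_piFinset.2 fun i => ?_
    simpa using hT x (by simpa using hx) i
  calc (S.ncard : ℝ) ≤ ∏ i, ((T i).ncard : ℝ) := by exact_mod_cast h1
    _ ≤ ∏ _i : ι, c := Finset.prod_le_prod (fun _ _ => Nat.cast_nonneg _) fun i _ => hc i
    _ = _ := by simp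

theorem ncard_le_sum_of_subset {α β : Type*} [Fintype β] [Finite α] (S : Set α) (T : β → Set α)
    (h : ∀ x ∈ S, ∃ i, x ∈ T i) : (S.ncard : ℝ) ≤ ∑ i, ((T i).ncard : ℝ) := by
  classical
  have := Fintype.ofFinite α
  have h1 : S.ncard ≤ ∑ i, (T i).ncard := by
    simp only [Set.ncard_eq_toFinset_card']
    refine le_trans (Finset.card_le_card fun x hx => ?_) Finset.card_biUnion_le
    obtain ⟨i, hi⟩ := h x (by simpa using hx)
    exact Finset.mem_biUnion.2 ⟨i, Finset.mem_univ _, by simpa using hi⟩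
  exact_mod_cast h1

theorem ncard_le_card_mul_of_subset {α β : Type*} [Fintype β] [Finite α] (S : Set α)
    (T : β → Set α) {c : ℝ} (h : ∀ x ∈ S, ∃ i, x ∈ T i) (hc : ∀ i, ((T i).ncard : ℝ) ≤ c) :
    (S.ncard : ℝ) ≤ Fintype.card β * c := by
  refine (ncard_le_sum_of_subset S T h).trans ?_
  rw [← nsmul_eq_mul]
  exact Finset.sum_le_card_nsmul _ _ _ fun i _ => hc i

theorem ncard_le_of_injOn {α β : Type*} [Finite β] (S : Set α) (T : Set β) (f : α → β)
    (h : ∀ x ∈ S, f x ∈ T) (hf : Set.InjOn f S) : (S.ncard : ℝ) ≤ T.ncard := by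
  exact_mod_cast Set.ncard_le_ncard_of_injOn f h hf (Set.toFinite _)

theorem ncard_univ_pi {K : Type*} (A : Finset K) (ι : Type*) [Fintype ι] :
    ((Set.univ : Set (ι → A)).ncard : ℝ) = (A.card : ℝ) ^ Fintype.card ι := by
  classical
  rw [Set.ncard_univ, Nat.card_eq_fintype_card, Fintype.card_fun, Fintype.card_coe, Nat.cast_pow]

/-- A family of functionals separating the points of a subspace contains a separating subfamily
with at most as many members as the dimension. -/
theorem exists_separating_subset {K V ι : Type*} [Field K] [AddCommGroup V] [Module K V]
    [Module.Finite K V] [DecidableEq ι] (φ : ι → V →ₗ[K] K) (n : ℕ) (W : Submodule K V)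
    (hW : Module.finrank K W ≤ n) (h : ∀ w ∈ W, (∀ i, φ i w = 0) → w = 0) :
    ∃ R : Finset ι, R.card ≤ n ∧ ∀ w ∈ W, (∀ i ∈ R, φ i w = 0) → w = 0 := by
  induction n generalizing W with
  | zero =>
    refine ⟨∅, le_rfl, fun w hw _ => ?_⟩
    rw [Submodule.finrank_eq_zero.1 (Nat.le_zero.1 hW)] at hw
    simpa using hw
  | succ n ih =>
    by_cases h0 : ∀ w ∈ W, ∀ i, φ i w = 0
    · exact ⟨∅, Nat.zero_le _, fun w hw _ => h w hw (h0 w hw)⟩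
    push Not at h0
    obtain ⟨w, hw, i, hi⟩ := h0
    have hlt : W ⊓ LinearMap.ker (φ i) < W :=
      lt_of_le_of_ne inf_le_left fun he => hi (LinearMap.mem_ker.1 (inf_eq_left.1 he hw))
    obtain ⟨R, hR, h'⟩ := ih (W ⊓ LinearMap.ker (φ i))
      (Nat.le_of_lt_succ ((Submodule.finrank_lt_finrank_of_lt hlt).trans_le hW))
      fun w hw => h w hw.1
    refine ⟨insert i R, (Finset.card_insert_le _ _).trans (Nat.succ_le_succ hR),
      fun w hw hw' => h' w ⟨hw, hw' i (Finset.mem_insert_self _ _)⟩ fun j hj =>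
        hw' j (Finset.mem_insert_of_mem hj)⟩

theorem exists_separating_subset_mem {K V ι : Type*} [Field K] [AddCommGroup V] [Module K V]
    [Module.Finite K V] [DecidableEq ι] (φ : ι → V →ₗ[K] K) (W : Submodule K V)
    (h : ∀ w ∈ W, (∀ i, φ i w = 0) → w = 0) (i : ι) {w₀ : V} (hw₀ : w₀ ∈ W) (hi : φ i w₀ ≠ 0) :
    ∃ R : Finset ι, R.card ≤ Module.finrank K W ∧ i ∈ R ∧
      ∀ w ∈ W, (∀ i ∈ R, φ i w = 0) → w = 0 := by
  have hlt : W ⊓ LinearMap.ker (φ i) < W :=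
    lt_of_le_of_ne inf_le_left fun he => hi (LinearMap.mem_ker.1 (inf_eq_left.1 he hw₀))
  have h1 := Submodule.finrank_lt_finrank_of_lt hlt
  obtain ⟨R, hR, h'⟩ := exists_separating_subset φ _ (W ⊓ LinearMap.ker (φ i)) le_rfl
    fun w hw => h w hw.1
  exact ⟨insert i R, (Finset.card_insert_le _ _).trans (by omega), Finset.mem_insert_self _ _,
    fun w hw hw' => h' w ⟨hw, hw' i (Finset.mem_insert_self _ _)⟩ fun j hj =>
        hw' j (Finset.mem_insert_of_mem hj)⟩

theorem sqrt_card_pow {K : Type*} (A : Finset K) (n : ℕ) :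
    √(A.card : ℝ) ^ (2 * n) = (A.card : ℝ) ^ n := by
  rw [pow_mul, Real.sq_sqrt (Nat.cast_nonneg _)]

section SmallRank

variable {K : Type*} [Field K] [DecidableEq K] {N : ℕ} {C : ℝ} {A : Finset K}

theorem SmallRank.one_le_sqrt (hA : SmallRank N C A) : 1 ≤ √(A.card : ℝ) := by
  rw [Real.one_le_sqrt]
  exact_mod_cast hA.nonempty.card_pos

theorem SmallRank.ne_zero (hA : SmallRank N C A) (x : A) : (x : K) ≠ 0 :=
  fun h => hA.zero_notMem (h ▸ x.2)

theorem SmallRank.ncard_linear_le (hA : SmallRank N C A) {ι : Type} [Fintype ι]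
    (hι : Fintype.card ι ≤ N) (c : ι → K) (hc : ∀ i, c i ≠ 0) (v : K) :
    ({x : ι → A | ∑ i, c i * (x i : K) = v}.ncard : ℝ) ≤ C * √(A.card) ^ Fintype.card ι := by
  classical
  refine le_trans ?_ (hA.lin ι hι c hc v)
  rw [← Set.ncard_coe_finset]
  refine Nat.cast_le.2 (Set.ncard_le_ncard_of_injOn (fun x i => (x i : K)) (fun x hx => ?_)
    (fun x _ y _ h => ?_) (Finset.finite_toSet _))
  · simpa using hx
  · exact funext fun i => Subtype.ext (congrFun h i)

/-- The number of vectors mapped into `A` by a functional with support of size `t`. -/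
theorem SmallRank.ncard_functional_le (hA : SmallRank N C A) {τ : Type} [Fintype τ]
    (hτ : Fintype.card τ + 1 ≤ N) (w : τ → K) :
    ({x : τ → A | ∑ j, w j * (x j : K) ∈ A}.ncard : ℝ) ≤
      C * √(A.card) ^ (2 * Fintype.card τ + 1 - (Finset.univ.filter fun j => w j ≠ 0).card) := by
  classical
  have h1 : ({x : τ → A | ∑ j, w j * (x j : K) ∈ A}.ncard : ℝ) ≤
      ((Set.univ : Set ({j // w j = 0} → A)) ×ˢ {y : Option {j // w j ≠ 0} → A |
        ∑ o, (o.elim (-1) fun j => w j) * (y o : K) = 0}).ncard := by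
    have hex : ∀ x : τ → A, ∃ z : A, (∑ j, w j * (x j : K) ∈ A) → (z : K) = ∑ j, w j * (x j : K) :=
      fun x => by
        by_cases h : ∑ j, w j * (x j : K) ∈ A
        · exact ⟨⟨_, h⟩, fun _ => rfl⟩
        · exact ⟨⟨_, hA.nonempty.choose_spec⟩, fun h' => absurd h' h⟩
    choose z hz using hex
    refine ncard_le_of_injOn _ _ (fun x => (fun j => x j, fun o => o.elim (z x) fun j => x j)) ?_ ?_
    · intro x hx
      refine ⟨Set.mem_univ _, ?_⟩
      have h2 : ∑ j, w j * (x j : K) = ∑ j : {j // w j ≠ 0}, w j * (x j : K) := by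
        rw [← Fintype.sum_subtype_add_sum_subtype (fun j => w j = 0), add_eq_right]
        exact Finset.sum_eq_zero fun j _ => by rw [j.2, zero_mul]
      simp only [Set.mem_ofPred_eq, Fintype.sum_option, Option.elim_none, Option.elim_some]
      rw [hz x hx, h2]
      ring
    · intro x hx y hy hxy
      funext j
      by_cases hj : w j = 0
      · exact congrFun (congrArg Prod.fst hxy) ⟨j, hj⟩
      · exact congrFun (congrArg Prod.snd hxy) (some ⟨j, hj⟩)
  have hcard : Fintype.card {j // w j ≠ 0} = (Finset.univ.filter fun j => w j ≠ 0).card :=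
    Fintype.card_subtype _
  have hcard' : Fintype.card {j // w j = 0} + Fintype.card {j // w j ≠ 0} = Fintype.card τ := by
    rw [Fintype.card_subtype_compl, ← Nat.add_sub_assoc (Fintype.card_subtype_le _),
      Nat.add_sub_cancel_left]
  rw [Set.ncard_prod, Nat.cast_mul, ncard_univ_pi] at h1
  refine h1.trans ?_
  have h3 := hA.ncard_linear_le (ι := Option {j // w j ≠ 0})
    (by rw [Fintype.card_option]; omega) (fun o => o.elim (-1) fun j => w j)
    (by rintro (_ | j); exacts [by simp, j.2]) 0
  refine (mul_le_mul_of_nonneg_left h3 (by positivity)).trans ?_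
  rw [← sqrt_card_pow, mul_left_comm, ← pow_add, Fintype.card_option, ← hcard]
  apply le_of_eq
  congr 2
  omega

/-- The number of linear combinations over `A` with coefficients supported in `T`. -/
theorem SmallRank.ncard_image_le (hA : SmallRank N C A) {ι τ : Type*} [Fintype ι] [Fintype τ]
    (D : τ → ι → K) (hD : ∀ w : τ → K, (∀ i, ∑ j, w j * D j i = 0) → w = 0) (i₀ : ι)
    (h0 : ∀ j, D j i₀ ≠ 0) (S : Set A) (T : Finset τ) (hT : T.Nonempty) :
    ({y : ι → A | y i₀ ∈ S ∧ ∃ w : τ → K, (∀ j ∉ T, w j = 0) ∧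
      ∀ i, (y i : K) = ∑ j, w j * D j i}.ncard : ℝ) ≤ S.ncard * (A.card : ℝ) ^ (T.card - 1) := by
  classical
  let φ : ι → (τ → K) →ₗ[K] K := fun i => ∑ j, D j i • LinearMap.proj j
  have hφ : ∀ i w, φ i w = ∑ j, w j * D j i := fun i w => by simp [φ, mul_comm]
  let W : Submodule K (τ → K) := ⨅ j : {j // j ∉ T}, LinearMap.ker (LinearMap.proj (j : τ))
  have hW : ∀ w, w ∈ W ↔ ∀ j ∉ T, w j = 0 := fun w => by simp [W, Submodule.mem_iInf]
  have hWT : Module.finrank K W ≤ T.card := by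
    have : Function.Injective ((LinearMap.funLeft K K (Subtype.val : T → τ)).comp W.subtype) := by
      rw [← LinearMap.ker_eq_bot, LinearMap.ker_eq_bot']
      rintro ⟨w, hw⟩ h
      refine Subtype.ext (funext fun j => ?_)
      by_cases hj : j ∈ T
      · exact congrFun h ⟨j, hj⟩
      · exact (hW w).1 hw j hj
    simpa using LinearMap.finrank_le_finrank_of_injective this
  obtain ⟨j₀, hj₀⟩ := hT
  obtain ⟨R, hR, hi, hsep⟩ := exists_separating_subset_mem φ W
    (fun w _ h => hD w fun i => (hφ i w).symm.trans (h i)) i₀ (w₀ := Pi.single j₀ 1)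
    ((hW _).2 fun j hj => Pi.single_eq_of_ne (by rintro rfl; exact hj hj₀) _)
    (by rw [hφ]; simpa [Pi.single_apply] using h0 j₀)
  have h1 : ({y : ι → A | y i₀ ∈ S ∧ ∃ w : τ → K, (∀ j ∉ T, w j = 0) ∧
      ∀ i, (y i : K) = ∑ j, w j * D j i}.ncard : ℝ) ≤
      (S ×ˢ (Set.univ : Set ({i // i ∈ R.erase i₀} → A))).ncard := by
    refine ncard_le_of_injOn _ _ (fun y => (y i₀, fun i => y i)) ?_ ?_
    · intro y hy
      exact ⟨hy.1, Set.mem_univ _⟩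
    · rintro y ⟨-, w, hw, hyw⟩ y' ⟨-, w', hw', hyw'⟩ h
      have hw'' : w - w' = 0 := by
        refine hsep _ (W.sub_mem ((hW w).2 hw) ((hW w').2 hw')) fun i hiR => ?_
        rw [map_sub, hφ, hφ, ← hyw, ← hyw', sub_eq_zero]
        by_cases hii : i = i₀
        · rw [hii]
          exact congrArg _ (congrArg Prod.fst h)
        · exact congrArg _ (congrFun (congrArg Prod.snd h) ⟨i, Finset.mem_erase.2 ⟨hii, hiR⟩⟩)
      rw [sub_eq_zero] at hw''
      subst hw''
      exact funext fun i => Subtype.ext ((hyw i).trans (hyw' i).symm)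
  refine h1.trans ?_
  rw [Set.ncard_prod, Nat.cast_mul, ncard_univ_pi, Fintype.card_coe, Finset.card_erase_of_mem hi]
  refine mul_le_mul_of_nonneg_left (pow_le_pow_right₀ ?_ (by omega)) (Nat.cast_nonneg _)
  exact_mod_cast hA.nonempty.card_pos

end SmallRank

/-- Linear independence of a family of vectors over `A`, spelled out. -/
def IndepRows {K : Type*} [Field K] {ι τ : Type*} [Fintype τ] {A : Finset K} (D : τ → ι → A) :
    Prop :=
  ∀ w : τ → K, (∀ i, ∑ j, w j * (D j i : K) = 0) → w = 0

/-- The vector `y` is the combination of the vectors `D j` with coefficients `w j`. -/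
def IsComb {K : Type*} [Field K] {ι τ : Type*} [Fintype τ] {A : Finset K} (D : τ → ι → A)
    (w : τ → K) (y : ι → A) : Prop :=
  ∀ i, (y i : K) = ∑ j, w j * (D j i : K)

/-- The size of the support. -/
def suppCard {K : Type*} [Field K] [DecidableEq K] {τ : Type*} [Fintype τ] (w : τ → K) : ℕ :=
  (Finset.univ.filter fun j => w j ≠ 0).card

theorem IndepRows.comb_unique {K : Type*} [Field K] {ι τ : Type*} [Fintype τ] {A : Finset K}
    {D : τ → ι → A} (hD : IndepRows D) {w w' : τ → K} {y : ι → A} (h : IsComb D w y)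
    (h' : IsComb D w' y) : w = w' := by
  refine sub_eq_zero.1 (hD _ fun i => ?_)
  simp only [Pi.sub_apply, sub_mul, Finset.sum_sub_distrib]
  rw [← h i, ← h' i, sub_self]

theorem suppCard_le {K : Type*} [Field K] [DecidableEq K] {τ : Type*} [Fintype τ] (w : τ → K) :
    suppCard w ≤ Fintype.card τ := Finset.card_le_univ _

theorem ncard_coord_le {K ι : Type*} [Fintype ι] {A : Finset K} (i₀ : ι) (S : Set A) :
    ({v : ι → A | v i₀ ∈ S}.ncard : ℝ) ≤ S.ncard * (A.card : ℝ) ^ (Fintype.card ι - 1) := by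
  classical
  have h1 : ({v : ι → A | v i₀ ∈ S}.ncard : ℝ) ≤
      (S ×ˢ (Set.univ : Set ({i // i ≠ i₀} → A))).ncard := by
    refine ncard_le_of_injOn _ _ (fun v => (v i₀, fun i => v i))
      (fun v hv => ⟨hv, Set.mem_univ _⟩) ?_
    intro v _ v' _ h
    funext i
    by_cases hi : i = i₀
    · rw [hi]
      exact congrArg Prod.fst h
    · exact congrFun (congrArg Prod.snd h) ⟨i, hi⟩
  rw [Set.ncard_prod, Nat.cast_mul, ncard_univ_pi] at h1
  simpa using h1

section SmallRank

variable {K : Type*} [Field K] [DecidableEq K] {N : ℕ} {C : ℝ} {A : Finset K}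

theorem SmallRank.one_le_card (hA : SmallRank N C A) : (1 : ℝ) ≤ A.card := by
  exact_mod_cast hA.nonempty.card_pos

theorem SmallRank.suppCard_pos (hA : SmallRank N C A) {ι τ : Type*} [Fintype τ] [Nonempty ι]
    {D : τ → ι → A} {w : τ → K} {y : ι → A} (h : IsComb D w y) : 0 < suppCard w := by
  rw [suppCard, Finset.card_pos, Finset.nonempty_iff_ne_empty]
  intro h0
  obtain ⟨i⟩ := ‹Nonempty ι›
  refine hA.ne_zero (y i) ((h i).trans (Finset.sum_eq_zero fun j _ => ?_))
  have : j ∉ (∅ : Finset τ) := Finset.notMem_empty j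
  rw [← h0] at this
  rw [show w j = 0 by simpa using this, zero_mul]

/-- Combinations over `A` of fixed independent vectors, by the size of the support. -/
theorem SmallRank.ncard_comb_le (hA : SmallRank N C A) {ι τ : Type*} [Fintype ι] [Fintype τ]
    {D : τ → ι → A} (hD : IndepRows D) (i₀ : ι) (S : Set A) (t : ℕ) :
    ({y : ι → A | y i₀ ∈ S ∧ ∃ w, IsComb D w y ∧ suppCard w ≤ t}.ncard : ℝ) ≤
      2 ^ Fintype.card τ * (S.ncard * (A.card : ℝ) ^ (t - 1)) := by
  classical
  have : Nonempty ι := ⟨i₀⟩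
  refine (ncard_le_card_mul_of_subset (β := Finset τ) _ (fun T => {y : ι → A | (y i₀ ∈ S ∧
    ∃ w : τ → K, (∀ j ∉ T, w j = 0) ∧ ∀ i, (y i : K) = ∑ j, w j * (D j i : K)) ∧ T.Nonempty ∧
      T.card ≤ t})
    (c := S.ncard * (A.card : ℝ) ^ (t - 1)) ?_ ?_).trans_eq (by simp)
  · rintro y ⟨hy, w, hw, hwt⟩
    exact ⟨Finset.univ.filter fun j => w j ≠ 0, ⟨hy, w, fun j hj => by simpa using hj, hw⟩,
      Finset.card_pos.1 (hA.suppCard_pos hw), hwt⟩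
  · intro T
    by_cases hT : T.Nonempty ∧ T.card ≤ t
    · simp only [hT, and_true]
      refine (hA.ncard_image_le (fun j i => (D j i : K)) hD i₀ (fun j => hA.ne_zero _) S T
        hT.1).trans ?_
      exact mul_le_mul_of_nonneg_left (pow_le_pow_right₀ hA.one_le_card (by omega))
        (Nat.cast_nonneg _)
    · simp only [hT, and_false]
      rw [Set.ofPred_false, Set.ncard_empty, Nat.cast_zero]
      have := hA.one_le_card
      positivity

theorem SmallRank.ncard_block_le (hA : SmallRank N C A) {ι κ ε : Type*} {τ : Type} [Fintype ι]
    [Fintype κ] [Fintype ε] [Fintype τ] (hτ : Fintype.card τ + 1 ≤ N) (i₀ : ι) (S : Set A)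
    (t : ℕ) :
    ({p : (τ → ι → A) × (κ → ι → A) × (ε → τ → A) | (∀ j, p.1 j i₀ ∈ S) ∧
      (∀ i, p.2.1 i i₀ ∈ S) ∧ IndepRows p.1 ∧ ∃ w : κ → τ → K, (∀ i, IsComb p.1 (w i) (p.2.1 i)) ∧
        (∀ i, suppCard (w i) ≤ t) ∧ (∃ i, suppCard (w i) = t) ∧
        ∀ l i, ∑ j, w i j * (p.2.2 l j : K) ∈ A}.ncard : ℝ) ≤
      (S.ncard * (A.card : ℝ) ^ (Fintype.card ι - 1)) ^ Fintype.card τ *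
        ((2 ^ Fintype.card τ * (S.ncard * (A.card : ℝ) ^ (t - 1))) ^ Fintype.card κ *
          (C * √(A.card) ^ (2 * Fintype.card τ + 1 - t)) ^ Fintype.card ε) := by
  classical
  have hC := hA.one_le
  have ha := hA.one_le_card
  refine (ncard_prod_le _ {D | (∀ j, D j i₀ ∈ S) ∧ IndepRows D}
    (c := (2 ^ Fintype.card τ * (S.ncard * (A.card : ℝ) ^ (t - 1))) ^ Fintype.card κ *
          (C * √(A.card) ^ (2 * Fintype.card τ + 1 - t)) ^ Fintype.card ε)
    (fun p hp => ⟨hp.1, hp.2.2.1⟩) ?_).trans ?_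
  · rintro D ⟨-, hD⟩
    refine (ncard_prod_le _ {y : κ → ι → A | (∀ i, y i i₀ ∈ S) ∧ ∃ w : κ → τ → K,
      (∀ i, IsComb D (w i) (y i)) ∧ (∀ i, suppCard (w i) ≤ t) ∧ ∃ i, suppCard (w i) = t}
      (c := (C * √(A.card) ^ (2 * Fintype.card τ + 1 - t)) ^ Fintype.card ε) ?_ ?_).trans ?_
    · rintro ⟨y, x⟩ ⟨-, hy, -, w, h1, h2, h3, -⟩
      exact ⟨hy, w, h1, h2, h3⟩
    · rintro y ⟨-, w, hw, -, i, hi⟩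
      refine ncard_pi_le _ (fun _ => {x : τ → A | ∑ j, w i j * (x j : K) ∈ A}) ?_ ?_
      · rintro x ⟨-, -, -, w', hw', -, -, h⟩ l
        have := h l i
        rwa [hD.comb_unique (hw' i) (hw i)] at this
      · intro _
        refine (hA.ncard_functional_le hτ (w i)).trans_eq ?_
        rw [← hi]
        rfl
    · refine mul_le_mul_of_nonneg_right ?_ (by positivity)
      refine ncard_pi_le _ (fun _ => {y : ι → A | y i₀ ∈ S ∧ ∃ w, IsComb D w y ∧
        suppCard w ≤ t}) ?_ fun _ => hA.ncard_comb_le hD i₀ S t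
      rintro y ⟨hy, w, h1, h2, -⟩ i
      exact ⟨hy i, w i, h1 i, h2 i⟩
  · refine mul_le_mul_of_nonneg_right ?_ (by positivity)
    exact ncard_pi_le _ (fun _ => {v : ι → A | v i₀ ∈ S}) (fun D hD j => hD.1 j)
      fun _ => ncard_coord_le i₀ S

end SmallRank

theorem ncard_triple_le {α β γ : Type*} [Finite α] [Finite β] [Finite γ] (S : Set (α × β × γ))
    (T : Set α) (U : α → Set β) {c₁ c₂ c₃ : ℝ} (h₂ : 0 ≤ c₂) (h₃ : 0 ≤ c₃)
    (hS : ∀ x y z, (x, y, z) ∈ S → x ∈ T ∧ y ∈ U x) (hT : (T.ncard : ℝ) ≤ c₁)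
    (hU : ∀ x ∈ T, ((U x).ncard : ℝ) ≤ c₂)
    (hc : ∀ x ∈ T, ∀ y ∈ U x, ({z | (x, y, z) ∈ S}.ncard : ℝ) ≤ c₃) :
    (S.ncard : ℝ) ≤ c₁ * (c₂ * c₃) := by
  refine (ncard_prod_le S T (fun p hp => (hS p.1 p.2.1 p.2.2 hp).1) fun x hx => ?_).trans
    (mul_le_mul_of_nonneg_right hT (mul_nonneg h₂ h₃))
  exact (ncard_prod_le {y | (x, y) ∈ S} (U x) (fun p hp => (hS x p.1 p.2 hp).2) (hc x hx)).trans
    (mul_le_mul_of_nonneg_right (hU x hx) h₃)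

section

variable {K : Type*} [Field K] {A : Finset K}

theorem IndepRows.isUnit {r : ℕ} {D : Fin r → Fin r → A} (hD : IndepRows D) :
    IsUnit (Matrix.of fun i j => (D i j : K)) := by
  rw [← Matrix.vecMul_injective_iff_isUnit]
  intro w w' h
  refine sub_eq_zero.1 (hD _ fun i => ?_)
  have := congrFun h i
  simp only [Matrix.vecMul, dotProduct, Matrix.of_apply] at this
  simp only [Pi.sub_apply, sub_mul, Finset.sum_sub_distrib, this, sub_self]

theorem IndepRows.transpose {r : ℕ} {D : Fin r → Fin r → A} (hD : IndepRows D) :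
    IndepRows (fun j i => D i j) := by
  intro w h
  refine (Matrix.mulVec_injective_iff_isUnit.2 hD.isUnit) ?_
  funext i
  simpa [Matrix.mulVec, dotProduct, mul_comm] using h i

theorem IndepRows.exists_comb {r : ℕ} {D : Fin r → Fin r → A} (hD : IndepRows D) (x : Fin r → A) :
    ∃ v : Fin r → K, IsComb D v x := by
  obtain ⟨v, hv⟩ := (Matrix.vecMul_surjective_iff_isUnit.2 hD.isUnit) fun i => (x i : K)
  refine ⟨v, fun i => ?_⟩
  rw [← congrFun hv i]
  simp [Matrix.vecMul, dotProduct]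

end

section SmallRank

variable {K : Type*} [Field K] [DecidableEq K] {N : ℕ} {C : ℝ} {A : Finset K}

/-- Matrices of rank `r` over `A`, cut into an invertible `r × r` block `D`, the remaining parts `y`
of the rows meeting no row of `D`, and the remaining parts `x` of the columns meeting no column
of `D`; `w` expresses the rows `y` in terms of the rows of `D`, and `t` is the maximal size of the
support of its rows. -/
def modelSet (A : Finset K) (r p p' t : ℕ) :
    Set ((Fin r → Fin r → A) × (Fin p → Fin r → A) × (Fin p' → Fin r → A)) :=
  {q | IndepRows q.1 ∧ ∃ w : Fin p → Fin r → K, (∀ i, IsComb q.1 (w i) (q.2.1 i)) ∧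
    (∀ i, suppCard (w i) ≤ t) ∧ (∃ i, suppCard (w i) = t) ∧
      ∀ l i, ∑ j, w i j * (q.2.2 l j : K) ∈ A}

theorem SmallRank.ncard_modelSet_le (hA : SmallRank N C A) {r p p' t : ℕ} (hr : 0 < r)
    (hN : r + 1 ≤ N) (ht : 0 < t) : ((modelSet A r p p' t).ncard : ℝ) ≤
      (2 ^ r) ^ p * C ^ p' * √(A.card) ^ (2 * (r * r) + 2 * (t * p) + (2 * r + 1 - t) * p') := by
  have h := hA.ncard_block_le (ι := Fin r) (κ := Fin p) (ε := Fin p') (τ := Fin r)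
    (by simpa using hN) ⟨0, hr⟩ Set.univ t
  have h1 : ((Set.univ : Set A).ncard : ℝ) = A.card := by
    rw [Set.ncard_univ, Nat.card_eq_fintype_card, Fintype.card_coe]
  simp only [Set.mem_univ, implies_true, true_and, Fintype.card_fin, h1, ← pow_succ',
    Nat.sub_add_cancel hr, Nat.sub_add_cancel ht] at h
  refine h.trans_eq ?_
  rw [← sqrt_card_pow, ← sqrt_card_pow, mul_pow, mul_pow, ← pow_mul, ← pow_mul (√(A.card : ℝ)),
    ← pow_mul (√(A.card : ℝ)), pow_add, pow_add, ← mul_assoc 2 r r, ← mul_assoc 2 t p]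
  ring

theorem SmallRank.ncard_modelSet_two_le (hA : SmallRank N C A) {p p' : ℕ} :
    ((modelSet A 2 p p' 2).ncard : ℝ) ≤
      (2 ^ 2) ^ p * C ^ p' * √(A.card) ^ (8 + 4 * p + 2 * p') := by
  classical
  have hC := hA.one_le
  have ha := hA.one_le_card
  refine (ncard_triple_le (modelSet A 2 p p' 2) {D | IndepRows D} (fun D => {y |
    ∃ w : Fin p → Fin 2 → K, (∀ i, IsComb D (w i) (y i)) ∧ (∃ i, suppCard (w i) = 2)})
    (c₁ := (A.card : ℝ) ^ 4) (c₂ := (2 ^ 2 * (A.card : ℝ) ^ 2) ^ p) (c₃ := (C * A.card) ^ p')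
    (by positivity) (by positivity) ?_ ?_ ?_ ?_).trans_eq ?_
  · rintro D y x ⟨hD, w, h1, -, h3, -⟩
    exact ⟨hD, w, h1, h3⟩
  · refine (ncard_pi_le _ (fun _ => Set.univ) (fun _ _ _ => Set.mem_univ _)
      (fun _ => (ncard_univ_pi A (Fin 2)).le)).trans_eq ?_
    simp only [Fintype.card_fin]
    ring
  · intro D hD
    refine (ncard_pi_le _ (fun _ => {y : Fin 2 → A | y 0 ∈ Set.univ ∧ ∃ w, IsComb D w y ∧
        suppCard w ≤ 2}) ?_ fun _ => hA.ncard_comb_le hD 0 Set.univ 2).trans_eq ?_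
    · rintro y ⟨w, h1, -⟩ i
      exact ⟨Set.mem_univ _, w i, h1 i, suppCard_le _⟩
    · rw [Set.ncard_univ, Nat.card_eq_fintype_card, Fintype.card_coe, Fintype.card_fin,
        Fintype.card_fin]
      ring
  · rintro D hD y ⟨w, hw, i, hi⟩
    have hw0 : ∀ j, w i j ≠ 0 := by
      have : (Finset.univ.filter fun j => w i j ≠ 0) = Finset.univ :=
        Finset.eq_univ_of_card _ (by simpa [suppCard] using hi)
      intro j
      have hj := Finset.mem_univ j
      rw [← this] at hj
      simpa using hj
    refine (ncard_pi_le _ (fun _ => {x : Fin 2 → A | ∑ j, w i j * (x j : K) ∈ A}) ?_ ?_).trans_eq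
      (by rw [Fintype.card_fin])
    · rintro x ⟨-, w', hw', -, -, h⟩ l
      have := h l i
      rwa [hD.comb_unique (hw' i) (hw i)] at this
    · intro _
      refine le_trans ?_ (hA.tern _ _ (hw0 0) (hw0 1))
      rw [← Set.ncard_coe_finset]
      refine Nat.cast_le.2 (Set.ncard_le_ncard_of_injOn (fun x => ((x 0 : K), (x 1 : K)))
        (fun x hx => ?_) (fun x _ y _ h => ?_) (Finset.finite_toSet _))
      · simpa [Fin.sum_univ_two] using hx
      · funext j
        fin_cases j
        · exact Subtype.ext (congrArg Prod.fst h)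
        · exact Subtype.ext (congrArg Prod.snd h)
  · rw [← sqrt_card_pow, ← sqrt_card_pow, ← Real.sq_sqrt (Nat.cast_nonneg A.card),
      Real.sqrt_sq (Real.sqrt_nonneg _)]
    ring

end SmallRank

section SmallRank

variable {K : Type*} [Field K] [DecidableEq K] {N : ℕ} {C : ℝ} {A : Finset K}

theorem SmallRank.ncard_star_le (hA : SmallRank N C A) {r p p' : ℕ} (hr : 0 < r)
    (hN : r + 1 ≤ N) (i₀ : Fin p) (τ : ℕ) (hτ : 0 < τ) :
    ({q : (Fin r → Fin r → A) × (Fin p → Fin r → A) × (Fin p' → Fin r → A) | IndepRows q.1 ∧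
      (∃ w : Fin p → Fin r → K, (∀ i, IsComb q.1 (w i) (q.2.1 i)) ∧ suppCard (w i₀) = r ∧
        ∀ l i, ∑ j, w i j * (q.2.2 l j : K) ∈ A) ∧
      ∃ v : Fin p' → Fin r → K, (∀ l, IsComb (fun j i => q.1 i j) (v l) (q.2.2 l)) ∧
        (∀ l, suppCard (v l) ≤ τ) ∧ ∃ l, suppCard (v l) = τ}.ncard : ℝ) ≤
      (2 ^ r * C) ^ p' * C ^ p * √(A.card) ^ (2 * (r * r) + 2 * r +
        (if 2 * τ ≤ r then 2 * τ else r + 1) * p' + (2 * r + 1 - τ) * (p - 1)) := by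
  classical
  have hC := hA.one_le
  have ha := hA.one_le_card
  have hs := hA.one_le_sqrt
  set μ := if 2 * τ ≤ r then 2 * τ else r + 1 with hμ
  set S := {q : (Fin r → Fin r → A) × (Fin p → Fin r → A) × (Fin p' → Fin r → A) | IndepRows q.1 ∧
      (∃ w : Fin p → Fin r → K, (∀ i, IsComb q.1 (w i) (q.2.1 i)) ∧ suppCard (w i₀) = r ∧
        ∀ l i, ∑ j, w i j * (q.2.2 l j : K) ∈ A) ∧
      ∃ v : Fin p' → Fin r → K, (∀ l, IsComb (fun j i => q.1 i j) (v l) (q.2.2 l)) ∧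
        (∀ l, suppCard (v l) ≤ τ) ∧ ∃ l, suppCard (v l) = τ} with hSdef
  let S' : Set (((Fin r → Fin r → A) × (Fin r → A)) × (Fin p' → Fin r → A) ×
      ({i // i ≠ i₀} → Fin r → A)) := {q | IndepRows q.1.1 ∧
    (∃ w : Fin r → K, IsComb q.1.1 w q.1.2 ∧ suppCard w = r ∧
      ∀ l, ∑ j, w j * (q.2.1 l j : K) ∈ A) ∧
    ∃ v : Fin p' → Fin r → K, (∀ l, IsComb (fun j i => q.1.1 i j) (v l) (q.2.1 l)) ∧
        (∀ l, suppCard (v l) ≤ τ) ∧ (∃ l, suppCard (v l) = τ) ∧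
          ∀ i l, ∑ j, v l j * (q.2.2 i j : K) ∈ A}
  have h1 : (S.ncard : ℝ) ≤ S'.ncard := by
    refine ncard_le_of_injOn S S' (fun q => ((q.1, q.2.1 i₀), q.2.2, fun i => q.2.1 i)) ?_ ?_
    · rintro ⟨D, y, x⟩ ⟨hD, ⟨w, hw, hw0, hwx⟩, v, hv, hv1, hv2⟩
      refine ⟨hD, ⟨w i₀, hw i₀, hw0, fun l => hwx l i₀⟩, v, hv, hv1, hv2, fun i l => ?_⟩
      convert hwx l i using 1
      have hv' : ∀ j, (x l j : K) = ∑ i, v l i * (D j i : K) := hv l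
      have hw' : ∀ j, (y i j : K) = ∑ k, w i k * (D k j : K) := hw i
      simp only [hv', hw', Finset.mul_sum]
      rw [Finset.sum_comm]
      exact Finset.sum_congr rfl fun _ _ => Finset.sum_congr rfl fun _ _ => by ring
    · rintro ⟨D, y, x⟩ - ⟨D', y', x'⟩ - h
      simp only [Prod.mk.injEq] at h ⊢
      obtain ⟨⟨h1, h2⟩, h3, h4⟩ := h
      refine ⟨h1, funext fun i => ?_, h3⟩
      by_cases hi : i = i₀
      · rw [hi, h2]
      · exact congrFun h4 ⟨i, hi⟩
  refine h1.trans ((ncard_triple_le S' {q | IndepRows q.1} (fun q => {x | ∃ w : Fin r → K,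
    IsComb q.1 w q.2 ∧ suppCard w = r ∧ (∀ l, ∑ j, w j * (x l j : K) ∈ A) ∧
      ∃ v : Fin p' → Fin r → K, (∀ l, IsComb (fun j i => q.1 i j) (v l) (x l)) ∧
        (∀ l, suppCard (v l) ≤ τ) ∧ ∃ l, suppCard (v l) = τ})
    (c₁ := (A.card : ℝ) ^ (r * r + r)) (c₂ := (2 ^ r * C * √(A.card) ^ μ) ^ p')
    (c₃ := (C * √(A.card) ^ (2 * r + 1 - τ)) ^ (p - 1))
    (by positivity) (by positivity) ?_ ?_ ?_ ?_).trans ?_)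
  · rintro ⟨D, y⟩ x z ⟨hD, ⟨w, h1, h2, h3⟩, v, h4, h5, h6, -⟩
    exact ⟨hD, w, h1, h2, h3, v, h4, h5, h6⟩
  · refine (ncard_le_of_injOn _ Set.univ id (fun _ _ => Set.mem_univ _)
      (Set.injOn_id _)).trans_eq ?_
    rw [Set.ncard_univ, Nat.card_eq_fintype_card]
    simp only [Fintype.card_prod, Fintype.card_fun, Fintype.card_fin, Fintype.card_coe]
    push_cast
    ring
  · rintro ⟨D, y⟩ hD
    refine (ncard_pi_le _ (fun l => {x : Fin r → A | ∃ w : Fin r → K, IsComb D w y ∧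
      suppCard w = r ∧ ∑ j, w j * (x j : K) ∈ A ∧ ∃ v, IsComb (fun j i => D i j) v x ∧
        suppCard v ≤ τ}) (c := 2 ^ r * C * √(A.card) ^ μ) ?_ fun l => ?_).trans_eq
        (by rw [Fintype.card_fin])
    · rintro x ⟨w, h1, h2, h3, v, h4, h5, -⟩ l
      exact ⟨w, h1, h2, h3 l, v l, h4 l, h5 l⟩
    · by_cases h : 2 * τ ≤ r
      · rw [if_pos h] at hμ
        refine (ncard_le_of_injOn _ {x : Fin r → A | x ⟨0, hr⟩ ∈ Set.univ ∧ ∃ v,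
          IsComb (fun j i => D i j) v x ∧ suppCard v ≤ τ} id ?_ (Set.injOn_id _)).trans
          ((hA.ncard_comb_le hD.transpose _ _ _).trans ?_)
        · rintro x ⟨w, -, -, -, h⟩
          exact ⟨Set.mem_univ _, h⟩
        · rw [Set.ncard_univ, Nat.card_eq_fintype_card, Fintype.card_coe, ← pow_succ',
            Nat.sub_add_cancel hτ, hμ, sqrt_card_pow, Fintype.card_fin]
          refine mul_le_mul_of_nonneg_right (le_mul_of_one_le_right (by positivity) hC)
            (by positivity)
      · rw [if_neg h] at hμ
        by_cases hw : ∃ w : Fin r → K, IsComb D w y ∧ suppCard w = r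
        · obtain ⟨w, hw, hwr⟩ := hw
          refine (ncard_le_of_injOn _ {x : Fin r → A | ∑ j, w j * (x j : K) ∈ A} id ?_
            (Set.injOn_id _)).trans ((hA.ncard_functional_le (by simpa using hN) w).trans ?_)
          · rintro x ⟨w', hw', -, h, -⟩
            rwa [hD.comb_unique hw' hw] at h
          · rw [Fintype.card_fin, show (Finset.univ.filter fun j => w j ≠ 0).card = r from hwr, hμ,
              show 2 * r + 1 - r = r + 1 by omega]
            exact mul_le_mul_of_nonneg_right (le_mul_of_one_le_left (by positivity)
              (one_le_pow₀ one_le_two)) (by positivity)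
        · rw [Set.eq_empty_of_forall_notMem (s := {x : Fin r → A | _}), Set.ncard_empty,
            Nat.cast_zero]
          · positivity
          · rintro x ⟨w, h1, h2, -⟩
            exact hw ⟨w, h1, h2⟩
  · rintro ⟨D, y⟩ hD x ⟨-, -, -, -, v, hv, -, l, hl⟩
    refine (ncard_pi_le _ (fun _ => {z : Fin r → A | ∑ j, v l j * (z j : K) ∈ A})
      (c := C * √(A.card) ^ (2 * r + 1 - τ)) ?_
      fun _ => ?_).trans_eq (by simp)
    · rintro z ⟨-, -, v', hv', -, -, h⟩ i
      have := h i l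
      rwa [(IndepRows.transpose hD).comb_unique (hv' l) (hv l)] at this
    · refine (hA.ncard_functional_le (by simpa using hN) (v l)).trans_eq ?_
      rw [Fintype.card_fin, ← hl]
      rfl
  · rw [← sqrt_card_pow, mul_pow (2 ^ r * C), mul_pow C, ← pow_mul, ← pow_mul, mul_add, pow_add,
      pow_add _ _ (_ * (p - 1)), pow_add _ _ (μ * p'), pow_add]
    have hCp : C ^ (p - 1) ≤ C ^ p := pow_le_pow_right₀ hC (by omega)
    calc _ = (2 ^ r * C) ^ p' * C ^ (p - 1) * (√(A.card : ℝ) ^ (2 * (r * r)) *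
          √(A.card : ℝ) ^ (2 * r) * √(A.card : ℝ) ^ (μ * p') *
          √(A.card : ℝ) ^ ((2 * r + 1 - τ) * (p - 1))) := by ring
      _ ≤ _ := by gcongr

theorem SmallRank.ncard_modelSet_self_le (hA : SmallRank N C A) {r p p' E : ℕ} (hr : 0 < r)
    (hN : r + 1 ≤ N) (hp' : 0 < p') (hE : ∀ τ, 0 < τ → τ ≤ r → 2 * (r * r) + 2 * r +
      (if 2 * τ ≤ r then 2 * τ else r + 1) * p' + (2 * r + 1 - τ) * (p - 1) ≤ E) :
    ((modelSet A r p p' r).ncard : ℝ) ≤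
      p * r * ((2 ^ r * C) ^ p' * C ^ p) * √(A.card) ^ E := by
  have hC := hA.one_le
  have : Nonempty (Fin r) := ⟨⟨0, hr⟩⟩
  have : Nonempty (Fin p') := ⟨⟨0, hp'⟩⟩
  have h := ncard_le_card_mul_of_subset (β := Fin p × Fin r) (modelSet A r p p' r) _
    (c := (2 ^ r * C) ^ p' * C ^ p * √(A.card) ^ E) ?_ fun i =>
      (hA.ncard_star_le (p' := p') hr hN i.1 (i.2 + 1) (Nat.succ_pos _)).trans
        (mul_le_mul_of_nonneg_left (pow_le_pow_right₀ hA.one_le_sqrt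
          (hE _ (Nat.succ_pos _) i.2.2)) (by positivity))
  · refine h.trans_eq ?_
    simp only [Fintype.card_prod, Fintype.card_fin]
    push_cast
    ring
  · rintro ⟨D, y, x⟩ ⟨hD, w, h1, -, ⟨i, hi⟩, h4⟩
    choose v hv using fun l => hD.transpose.exists_comb (x l)
    obtain ⟨l, hl⟩ := Finite.exists_max fun l => suppCard (v l)
    have hpos := hA.suppCard_pos (hv l)
    have hle : suppCard (v l) ≤ r := by simpa using suppCard_le (v l)
    exact ⟨(i, ⟨suppCard (v l) - 1, by omega⟩), hD, ⟨w, h1, hi, h4⟩, v, hv,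
      fun l' => by simpa [Nat.sub_add_cancel hpos] using hl l',
      l, by simp [Nat.sub_add_cancel hpos]⟩

end SmallRank

/-- The elements `x` of `A` with `l * x ∈ A`. -/
def ratioSet {K : Type*} [Field K] (A : Finset K) (l : K) : Set A := {x | l * x ∈ A}

/-- Vectors over `A` whose first two coordinates have ratio `l`. -/
def HasRatio {K : Type*} [Field K] {A : Finset K} {d : ℕ} (l : K) (v : Fin (d + 2) → A) : Prop :=
  (v 0 : K) = l * v 1

/-- Independent `q`-tuples with a further vector in their span, all with ratio `l`. -/
def depSet {K : Type*} [Field K] (A : Finset K) (d q : ℕ) (l : K) :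
    Set ((Fin q → Fin (d + 2) → A) × (Fin (d + 2) → A)) :=
  {p | (∀ j, HasRatio l (p.1 j)) ∧ HasRatio l p.2 ∧ IndepRows p.1 ∧ ∃ w, IsComb p.1 w p.2}

section SmallRank

variable {K : Type*} [Field K] [DecidableEq K] {N : ℕ} {C : ℝ} {A : Finset K}

theorem SmallRank.exists_indepRows_subset (hA : SmallRank N C A) {ι : Type*} [Fintype ι]
    [DecidableEq ι] {q : ℕ} (hq : 0 < q) {D : Fin q → ι → A} (hD : IndepRows D) (i₀ : ι) :
    ∃ R : Finset ι, R.card = q ∧ i₀ ∈ R ∧ IndepRows fun j (i : R) => D j i := by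
  let φ : ι → (Fin q → K) →ₗ[K] K := fun i => ∑ j, (D j i : K) • LinearMap.proj j
  have hφ : ∀ i w, φ i w = ∑ j, w j * (D j i : K) := fun i w => by simp [φ, mul_comm]
  obtain ⟨R, hR, hi, h⟩ := exists_separating_subset_mem φ ⊤
    (fun w _ h => hD w fun i => (hφ i w).symm.trans (h i)) i₀ (w₀ := Pi.single ⟨0, hq⟩ 1)
    trivial (by rw [hφ]; simpa [Pi.single_apply] using hA.ne_zero _)
  have hind : IndepRows fun j (i : R) => D j i := fun w hw =>
    h w trivial fun i hi => (hφ i w).trans (hw ⟨i, hi⟩)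
  refine ⟨R, le_antisymm (hR.trans (by simp)) ?_, hi, hind⟩
  have hinj : Function.Injective (LinearMap.pi fun i : R => φ i) := by
    rw [← LinearMap.ker_eq_bot, LinearMap.ker_eq_bot']
    exact fun w hw => h w trivial fun i hi => congrFun hw ⟨i, hi⟩
  simpa using LinearMap.finrank_le_finrank_of_injective hinj

theorem SmallRank.ncard_depSet_le (hA : SmallRank N C A) {d q : ℕ} (hq : 0 < q) (hqN : q + 1 ≤ N)
    (l : K) {E : ℕ} (hE : ∀ t, 0 < t → t ≤ q →
      2 * ((q - 1) * q) + 2 * (t - 1) + (2 * q + 1 - t) * (d + 1 - q) ≤ E) :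
    ((depSet A d q l).ncard : ℝ) ≤ 2 ^ (d + 1) * q * (2 ^ q * C ^ (d + 1 - q)) *
      ((ratioSet A l).ncard ^ (q + 1) * √(A.card) ^ E) := by
  classical
  have hC := hA.one_le
  have hs := hA.one_le_sqrt
  have key : ∀ i : {R : Finset (Fin (d + 1)) // R.card = q ∧ 0 ∈ R} × Fin q,
      ({p : (Fin q → Fin (d + 2) → A) × (Fin (d + 2) → A) | p ∈ depSet A d q l ∧
        IndepRows (fun j (k : i.1.1) => p.1 j k.1.succ) ∧
        ∃ w, IsComb p.1 w p.2 ∧ suppCard w = i.2 + 1}.ncard : ℝ) ≤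
      2 ^ q * C ^ (d + 1 - q) * ((ratioSet A l).ncard ^ (q + 1) * √(A.card) ^ E) := by
    rintro ⟨⟨R, hR, h0⟩, t⟩
    have hb := hA.ncard_block_le (ι := R) (κ := Unit) (ε := {k // k ∉ R}) (τ := Fin q)
      (by simpa using hqN) ⟨0, h0⟩ (ratioSet A l) (t + 1)
    have hmem : ∀ v : Fin (d + 2) → A, HasRatio l v → v 1 ∈ ratioSet A l := fun v hv => by
      rw [ratioSet, Set.mem_ofPred_eq, ← hv]
      exact (v 0).2
    refine le_trans (ncard_le_of_injOn _ _ (fun p => (fun j k => p.1 j k.1.succ,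
      fun _ k => p.2 k.1.succ, fun k j => p.1 j k.1.succ)) ?_ ?_) (hb.trans ?_)
    · rintro ⟨z, y⟩ ⟨⟨hz, hy, -, -⟩, hind, w, hw, hwt⟩
      refine ⟨fun j => hmem _ (hz j), fun _ => hmem _ hy, hind, fun _ => w, fun _ k => hw _,
        fun _ => hwt.le, ⟨(), hwt⟩, fun k _ => ?_⟩
      have := hw k.1.succ
      simp only at this ⊢
      rw [← this]
      exact (y _).2
    · rintro ⟨z, y⟩ ⟨⟨hz, hy, -, -⟩, hind, w, hw, -⟩ ⟨z', y'⟩ ⟨⟨hz', hy', -, -⟩, -, w', hw', -⟩ h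
      simp only [Prod.mk.injEq] at h hz hy hz' hy' hw hw' hind ⊢
      obtain ⟨h1, h2, h3⟩ := h
      have ext : ∀ v v' : Fin (d + 2) → A, HasRatio l v → HasRatio l v' →
          (∀ k : Fin (d + 1), v k.succ = v' k.succ) → v = v' := by
        intro v v' hv hv' h
        refine funext fun k => Fin.cases ?_ h k
        have h01 : v 1 = v' 1 := h 0
        exact Subtype.ext (hv.trans (by rw [h01]; exact hv'.symm))
      have hzz : z = z' := funext fun j => ext _ _ (hz j) (hz' j) fun k => by
        by_cases hk : k ∈ R
        · exact congrFun (congrFun h1 j) ⟨k, hk⟩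
        · exact congrFun (congrFun h3 ⟨k, hk⟩) j
      subst hzz
      have hww : w = w' := by
        refine hind.comb_unique (y := fun k => y k.1.succ) (fun k => hw _) fun k => ?_
        have := congrFun (congrFun h2 ()) k
        exact (congrArg _ this).trans (hw' _)
      subst hww
      exact ⟨rfl, funext fun k => Subtype.ext ((hw k).trans (hw' k).symm)⟩
    · have hcard : Fintype.card {k // k ∉ R} = d + 1 - q := by
        rw [Fintype.card_subtype_compl, Fintype.card_coe, hR, Fintype.card_fin]
      rw [hcard, Fintype.card_coe, hR, Fintype.card_fin, Fintype.card_unit, pow_one,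
        ← sqrt_card_pow, ← sqrt_card_pow, mul_pow, mul_pow, ← pow_mul, ← pow_mul]
      have hEt := hE (t + 1) (Nat.succ_pos _) t.2
      calc _ = 2 ^ q * C ^ (d + 1 - q) * ((ratioSet A l).ncard ^ (q + 1) * √(A.card) ^
            (2 * ((q - 1) * q) + 2 * (t + 1 - 1) + (2 * q + 1 - (t + 1)) * (d + 1 - q))) := by
            rw [pow_add, pow_add]
            ring
        _ ≤ _ := by gcongr
  refine (ncard_le_card_mul_of_subset (depSet A d q l) _ ?_ key).trans ?_
  · rintro ⟨z, y⟩ hp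
    have hp' := hp
    obtain ⟨hz, hy, hind, w, hw⟩ := hp'
    have hind' : IndepRows fun j (k : Fin (d + 1)) => z j k.succ := fun w hw => hind w fun k => by
      refine Fin.cases ?_ hw k
      have h1 : ∑ j, w j * (z j 1 : K) = 0 := hw 0
      have h2 : ∀ j, (z j 0 : K) = l * z j 1 := hz
      simp only [h2, mul_left_comm _ l, ← Finset.mul_sum, h1, mul_zero]
    obtain ⟨R, hR, h0, hRi⟩ := hA.exists_indepRows_subset hq hind' 0
    have hpos := hA.suppCard_pos hw
    have hle : suppCard w ≤ q := by simpa using suppCard_le w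
    exact ⟨(⟨R, hR, h0⟩, ⟨suppCard w - 1, by omega⟩), hp, hRi, w, hw,
      by simp [Nat.sub_add_cancel hpos]⟩
  · have hcard : (Fintype.card ({R : Finset (Fin (d + 1)) // R.card = q ∧ 0 ∈ R} × Fin q) : ℝ) ≤
        2 ^ (d + 1) * q := by
      rw [Fintype.card_prod, Fintype.card_fin, Nat.cast_mul]
      have : Fintype.card {R : Finset (Fin (d + 1)) // R.card = q ∧ 0 ∈ R} ≤ 2 ^ (d + 1) := by
        refine (Fintype.card_subtype_le _).trans_eq (by simp)
      gcongr
      exact_mod_cast this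
    rw [mul_assoc (2 ^ (d + 1) * (q : ℝ))]
    exact mul_le_mul_of_nonneg_right hcard (by positivity)

end SmallRank

/-- A subspace can be enlarged to the span of a family containing it by adding members of the
family. -/
theorem exists_extend_to_span {K V κ : Type*} [Field K] [AddCommGroup V] [Module K V]
    [Module.Finite K V] (B : κ → V) (e : ℕ) (W : Submodule K V)
    (hW : W ≤ Submodule.span K (Set.range B))
    (he : Module.finrank K W + e = Module.finrank K (Submodule.span K (Set.range B))) :
    ∃ f : Fin e → κ, Function.Injective f ∧ (∀ i, B (f i) ∉ W) ∧
      W ⊔ Submodule.span K (Set.range (B ∘ f)) = Submodule.span K (Set.range B) := by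
  induction e generalizing W with
  | zero =>
    refine ⟨Fin.elim0, fun i => i.elim0, fun i => i.elim0, ?_⟩
    rw [Set.range_eq_empty, Submodule.span_empty, sup_bot_eq]
    exact Submodule.eq_of_le_of_finrank_eq hW (by simpa using he)
  | succ e ih =>
    have hex : ∃ i, B i ∉ W := by
      by_contra! h
      have : Submodule.span K (Set.range B) ≤ W :=
        Submodule.span_le.2 (by rintro _ ⟨i, rfl⟩; exact h i)
      have := Submodule.finrank_mono this
      omega
    obtain ⟨i, hi⟩ := hex
    have hBi : B i ∈ Submodule.span K (Set.range B) := Submodule.subset_span ⟨i, rfl⟩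
    have h0 : B i ≠ 0 := fun h => hi (h ▸ W.zero_mem)
    have hinf : W ⊓ Submodule.span K {B i} = ⊥ := by
      rw [← disjoint_iff, Submodule.disjoint_span_singleton' h0]
      exact hi
    have hfin := Submodule.finrank_sup_add_finrank_inf_eq W (Submodule.span K {B i})
    rw [hinf, finrank_bot, finrank_span_singleton h0] at hfin
    obtain ⟨f, hf, hfW, hfs⟩ := ih (W ⊔ Submodule.span K {B i})
      (sup_le hW ((Submodule.span_singleton_le_iff_mem _ _).2 hBi)) (by omega)
    refine ⟨Fin.cons i f, ?_, ?_, ?_⟩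
    · rw [Fin.cons_injective_iff]
      refine ⟨?_, hf⟩
      rintro ⟨j, hj⟩
      refine hfW j (hj ▸ ?_)
      exact Submodule.mem_sup_right (Submodule.mem_span_singleton_self _)
    · intro j
      refine Fin.cases hi (fun j => ?_) j
      exact fun h => hfW j (Submodule.mem_sup_left h)
    · rw [← hfs, sup_assoc, ← Submodule.span_union, Fin.comp_cons, Fin.range_cons,
        Set.singleton_union]

section

variable {K : Type*} [Field K] {A : Finset K}

/-- The span of a family of vectors over `A`. -/
def rowSpan {ι τ : Type*} (B : τ → ι → A) : Submodule K (ι → K) :=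
  Submodule.span K (Set.range fun j i => (B j i : K))

/-- The vectors over `A` in a subspace. -/
def pointsOf {ι : Type*} (A : Finset K) (H : Submodule K (ι → K)) : Set (ι → A) :=
  {v | (fun i => (v i : K)) ∈ H}

/-- Hyperplanes whose normal vector has full support. -/
def FullHyperplane {ι : Type*} [Fintype ι] (H : Submodule K (ι → K)) : Prop :=
  ∃ c : ι → K, (∀ i, c i ≠ 0) ∧ ∀ v, v ∈ H ↔ ∑ i, c i * v i = 0

theorem IndepRows.linearIndependent {ι τ : Type*} [Fintype τ] {D : τ → ι → A} (hD : IndepRows D) :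
    LinearIndependent K fun j i => (D j i : K) := by
  rw [Fintype.linearIndependent_iff]
  intro g hg j
  refine congrFun (hD g fun i => ?_) j
  simpa [Finset.sum_apply] using congrFun hg i

theorem FullHyperplane.finrank_add_one {ι : Type*} [Fintype ι] [Nonempty ι]
    {H : Submodule K (ι → K)} (hH : FullHyperplane H) :
    Module.finrank K H + 1 = Fintype.card ι := by
  classical
  obtain ⟨c, hc, h⟩ := hH
  let f : (ι → K) →ₗ[K] K := ∑ i, c i • LinearMap.proj i
  have hf : ∀ v, f v = ∑ i, c i * v i := fun v => by simp [f]
  have hH : H = LinearMap.ker f := by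
    ext v
    rw [h, LinearMap.mem_ker, hf]
  obtain ⟨i⟩ := ‹Nonempty ι›
  have hf0 : f ≠ 0 := fun h0 => by
    have := hf (Pi.single i 1)
    rw [h0] at this
    simp [Pi.single_apply] at this
    exact hc i this.symm
  rw [hH, Module.Dual.finrank_ker_add_one_of_ne_zero hf0, Module.finrank_fintype_fun_eq_card]

theorem finrank_rowSpan {ι τ : Type*} [Fintype τ] {D : τ → ι → A} (hD : IndepRows D) :
    Module.finrank K (rowSpan D) = Fintype.card τ :=
  finrank_span_eq_card hD.linearIndependent

open Classical in
/-- Exchange: members of a spanning family may be traded for a given independent tuple. -/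
theorem sum_rowSpan_le_of_indepRows {d q e : ℕ} (hqe : q + e = d + 1) {z : Fin q → Fin (d + 2) → A}
    (hz : IndepRows z) (F : Submodule K (Fin (d + 2) → K) → ℝ) (hF : ∀ H, 0 ≤ F H) :
    ∑ B : Fin (d + 1) → Fin (d + 2) → A with
        FullHyperplane (rowSpan B) ∧ ∀ j, z j ∈ pointsOf A (rowSpan B),
      F (rowSpan B) / (pointsOf A (rowSpan B)).ncard ^ q ≤
    (d + 1) ^ e * ∑ x : Fin e → Fin (d + 2) → A with FullHyperplane (rowSpan z ⊔ rowSpan x),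
      F (rowSpan z ⊔ rowSpan x) := by
  have hex : ∀ B : Fin (d + 1) → Fin (d + 2) → A, ∃ f : Fin e → Fin (d + 1),
      (FullHyperplane (rowSpan B) ∧ ∀ j, z j ∈ pointsOf A (rowSpan B)) →
        Function.Injective f ∧ rowSpan z ⊔ rowSpan (B ∘ f) = rowSpan B := by
    intro B
    by_cases h : FullHyperplane (rowSpan B) ∧ ∀ j, z j ∈ pointsOf A (rowSpan B)
    · have h1 := h.1.finrank_add_one
      obtain ⟨f, hf, -, hs⟩ := exists_extend_to_span (fun j i => (B j i : K)) e (rowSpan z)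
        (Submodule.span_le.2 (by rintro _ ⟨j, rfl⟩; exact h.2 j)) (by
          rw [finrank_rowSpan hz, Fintype.card_fin]
          rw [Fintype.card_fin] at h1
          change _ = Module.finrank K (rowSpan B)
          omega)
      exact ⟨f, fun _ => ⟨hf, hs⟩⟩
    · exact ⟨fun _ => 0, fun h' => absurd h' h⟩
  choose f hf using hex
  set 𝓑 := Finset.univ.filter fun B : Fin (d + 1) → Fin (d + 2) → A =>
    FullHyperplane (rowSpan B) ∧ ∀ j, z j ∈ pointsOf A (rowSpan B)
  set 𝓧 := Finset.univ.filter fun x : Fin e → Fin (d + 2) → A =>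
    FullHyperplane (rowSpan z ⊔ rowSpan x)
  have hmaps : ∀ B ∈ 𝓑, (f B, B ∘ f B) ∈ (Finset.univ : Finset (Fin e → Fin (d + 1))) ×ˢ 𝓧 := by
    intro B hB
    have hB' := (Finset.mem_filter.1 hB).2
    refine Finset.mem_product.2 ⟨Finset.mem_univ _, Finset.mem_filter.2 ⟨Finset.mem_univ _, ?_⟩⟩
    rw [(hf B hB').2]
    exact hB'.1
  rw [← Finset.sum_fiberwise_of_maps_to hmaps]
  have hinner : ∀ p ∈ (Finset.univ : Finset (Fin e → Fin (d + 1))) ×ˢ 𝓧,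
      ∑ B ∈ 𝓑 with (f B, B ∘ f B) = p, F (rowSpan B) / (pointsOf A (rowSpan B)).ncard ^ q ≤
        F (rowSpan z ⊔ rowSpan p.2) := by
    rintro ⟨g, x⟩ -
    set H := rowSpan z ⊔ rowSpan x
    have hprop : ∀ B ∈ 𝓑.filter fun B => (f B, B ∘ f B) = (g, x), Function.Injective g ∧
        B ∘ g = x ∧ rowSpan B = H := by
      intro B hB
      obtain ⟨hB', h⟩ := Finset.mem_filter.1 hB
      obtain ⟨rfl, rfl⟩ := Prod.mk.inj h
      obtain ⟨h1, h2⟩ := hf B (Finset.mem_filter.1 hB').2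
      exact ⟨h1, rfl, h2.symm⟩
    have hcard : ((𝓑.filter fun B => (f B, B ∘ f B) = (g, x)).card : ℝ) ≤
        ((pointsOf A H).ncard : ℝ) ^ q := by
      by_cases hne : (𝓑.filter fun B => (f B, B ∘ f B) = (g, x)).Nonempty
      · obtain ⟨B₀, hB₀⟩ := hne
        have hg := (hprop B₀ hB₀).1
        have hcq : Fintype.card {i // i ∉ Set.range g} = q := by
          have := Fintype.card_congr (Equiv.ofInjective g hg)
          rw [Fintype.card_fin] at this
          rw [Fintype.card_subtype_compl, Fintype.card_fin]
          change _ - Fintype.card (Set.range g) = q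
          omega
        rw [← Set.ncard_coe_finset]
        refine (ncard_le_of_injOn _ {y : {i // i ∉ Set.range g} → Fin (d + 2) → A |
          ∀ i, y i ∈ pointsOf A H} (fun B i => B i) ?_ ?_).trans
          ((ncard_pi_le _ (fun _ => pointsOf A H) (fun y hy => hy) fun _ => le_rfl).trans_eq
            (by rw [hcq]))
        · intro B hB i
          have := (hprop B hB).2.2
          rw [← this]
          exact Submodule.subset_span ⟨i, rfl⟩
        · intro B hB B' hB' h
          funext i
          by_cases hi : i ∈ Set.range g
          · obtain ⟨j, rfl⟩ := hi
            exact congrFun ((hprop B hB).2.1.trans (hprop B' hB').2.1.symm) j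
          · exact congrFun h ⟨i, hi⟩
      · rw [Finset.not_nonempty_iff_eq_empty.1 hne]
        simp
    calc _ = ∑ B ∈ 𝓑 with (f B, B ∘ f B) = (g, x), F H / (pointsOf A H).ncard ^ q :=
          Finset.sum_congr rfl fun B hB => by rw [(hprop B hB).2.2]
      _ = (𝓑.filter fun B => (f B, B ∘ f B) = (g, x)).card *
          (F H / (pointsOf A H).ncard ^ q) := by rw [Finset.sum_const, nsmul_eq_mul]
      _ ≤ (pointsOf A H).ncard ^ q * (F H / (pointsOf A H).ncard ^ q) :=
          mul_le_mul_of_nonneg_right hcard (div_nonneg (hF _) (by positivity))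
      _ = F H * ((pointsOf A H).ncard ^ q / (pointsOf A H).ncard ^ q) := by ring
      _ ≤ F H := mul_le_of_le_one_right (hF _) (div_self_le_one _)
  refine (Finset.sum_le_sum hinner).trans_eq ?_
  rw [Finset.sum_product]
  simp only [Finset.sum_const, Finset.card_univ, Fintype.card_fun, Fintype.card_fin, nsmul_eq_mul]
  push_cast
  ring

end

/-- A pigeonhole and Hölder argument for sums whose terms satisfy one of several power bounds. -/
theorem sum_le_sum_div_pow {κ J : Type*} [Fintype J] {Λ : Finset κ} (e : J → ℕ) {n b : κ → ℝ}
    {G : J → κ → ℝ} {c : ℝ} (hc : 0 ≤ c) (hb : ∀ l ∈ Λ, 0 < b l) (hn : ∀ l ∈ Λ, 0 ≤ n l)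
    (hG : ∀ j, ∀ l ∈ Λ, 0 ≤ G j l) (h : ∀ l ∈ Λ, ∃ j, n l ^ (e j + 1) ≤ c * G j l)
    (hpos : 0 < ∑ l ∈ Λ, n l) :
    ∑ l ∈ Λ, n l ≤ ∑ j, Fintype.card J ^ (e j + 1) * c * ((∑ l ∈ Λ, b l) ^ e j *
      ∑ l ∈ Λ, G j l / b l ^ e j / (∑ l ∈ Λ, n l) ^ e j) := by
  classical
  set S := ∑ l ∈ Λ, n l
  set M := ∑ l ∈ Λ, b l
  have hΛ : Λ.Nonempty := by
    by_contra hne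
    rw [Finset.not_nonempty_iff_eq_empty] at hne
    simp [S, hne] at hpos
  have hM : 0 < M := Finset.sum_pos hb hΛ
  have hJ : Nonempty J := ⟨(h _ hΛ.choose_spec).choose⟩
  choose! cl hcl using h
  obtain ⟨j, -, hj⟩ : ∃ j ∈ (Finset.univ : Finset J),
      S / Fintype.card J ≤ ∑ l ∈ Λ with cl l = j, n l := by
    refine Finset.exists_le_of_sum_le Finset.univ_nonempty ?_
    simp only [Finset.sum_filter]
    rw [Finset.sum_comm]
    simp only [Finset.sum_ite_eq, Finset.mem_univ, if_true]
    rw [Finset.sum_const, Finset.card_univ, nsmul_eq_mul]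
    exact (mul_div_cancel₀ _ (by positivity)).le
  have hcard : (0 : ℝ) < Fintype.card J := by positivity
  have holder := Real.pow_arith_mean_le_arith_mean_pow Λ (fun l => b l / M)
    (fun l => if cl l = j then n l * M / b l else 0)
    (fun l hl => (div_pos (hb l hl) hM).le)
    (by rw [← Finset.sum_div]; exact div_self hM.ne')
    (fun l hl => by
      split_ifs
      · exact div_nonneg (mul_nonneg (hn l hl) hM.le) (hb l hl).le
      · exact le_rfl) (e j + 1)
  have h1 : ∑ l ∈ Λ, b l / M * (if cl l = j then n l * M / b l else 0) =
      ∑ l ∈ Λ with cl l = j, n l := by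
    rw [Finset.sum_filter]
    refine Finset.sum_congr rfl fun l hl => ?_
    have := (hb l hl).ne'
    split_ifs
    · field_simp
    · simp
  have h2 : ∑ l ∈ Λ, b l / M * (if cl l = j then n l * M / b l else 0) ^ (e j + 1) ≤
      c * (M ^ e j * ∑ l ∈ Λ, G j l / b l ^ e j) := by
    rw [Finset.mul_sum, Finset.mul_sum]
    refine Finset.sum_le_sum fun l hl => ?_
    have hbl := hb l hl
    split_ifs with hjl
    · have := hcl l hl
      rw [hjl] at this
      calc b l / M * (n l * M / b l) ^ (e j + 1) =
          n l ^ (e j + 1) * (M ^ e j / b l ^ e j) := by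
            rw [div_pow, mul_pow, pow_succ M, pow_succ (b l)]
            field_simp
        _ ≤ c * G j l * (M ^ e j / b l ^ e j) := by gcongr
        _ = _ := by ring
    · rw [zero_pow (by omega), mul_zero]
      have := hG j l hl
      positivity
  rw [h1] at holder
  have key : S ^ (e j + 1) ≤ Fintype.card J ^ (e j + 1) *
      (c * (M ^ e j * ∑ l ∈ Λ, G j l / b l ^ e j)) := by
    calc S ^ (e j + 1) = Fintype.card J ^ (e j + 1) * (S / Fintype.card J) ^ (e j + 1) := by
          rw [← mul_pow, mul_div_cancel₀ _ hcard.ne']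
      _ ≤ Fintype.card J ^ (e j + 1) * (∑ l ∈ Λ with cl l = j, n l) ^ (e j + 1) := by gcongr
      _ ≤ _ := by gcongr; exact holder.trans h2
  have hS : 0 < S ^ e j := by positivity
  calc S = S ^ (e j + 1) / S ^ e j := by rw [pow_succ]; field_simp
    _ ≤ Fintype.card J ^ (e j + 1) * (c * (M ^ e j * ∑ l ∈ Λ, G j l / b l ^ e j)) / S ^ e j := by
        gcongr
    _ = Fintype.card J ^ (e j + 1) * c * (M ^ e j * ∑ l ∈ Λ, G j l / b l ^ e j / S ^ e j) := by
        rw [← Finset.sum_div]; ring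
    _ ≤ _ := Finset.single_le_sum (f := fun j => (Fintype.card J : ℝ) ^ (e j + 1) * c * (M ^ e j *
          ∑ l ∈ Λ, G j l / b l ^ e j / S ^ e j)) (fun i _ => by
            have : 0 ≤ ∑ l ∈ Λ, G i l / b l ^ e i / S ^ e i := Finset.sum_nonneg fun l hl => by
              have := hG i l hl
              have := hb l hl
              positivity
            positivity) (Finset.mem_univ j)

section

variable {K : Type*} [Field K] {A : Finset K}

/-- Independent `q`-tuples from a set of vectors over `A`. -/
def indepTuples {ι : Type*} (P : Set (ι → A)) (q : ℕ) : Set (Fin q → ι → A) :=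
  {z | (∀ j, z j ∈ P) ∧ IndepRows z}

/-- Independent `q`-tuples from a set of vectors, with a further member in their span. -/
def depTuples {ι : Type*} (P : Set (ι → A)) (q : ℕ) : Set ((Fin q → ι → A) × (ι → A)) :=
  {p | (∀ j, p.1 j ∈ P) ∧ p.2 ∈ P ∧ IndepRows p.1 ∧ ∃ w, IsComb p.1 w p.2}

theorem IndepRows.snoc {ι : Type*} {q : ℕ} {z : Fin q → ι → A} (hz : IndepRows z) {y : ι → A}
    (hy : ¬ ∃ w, IsComb z w y) : IndepRows (Fin.snoc z y : Fin (q + 1) → ι → A) := by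
  intro w hw
  simp only [Fin.sum_univ_castSucc, Fin.snoc_castSucc, Fin.snoc_last] at hw
  have hlast : w (Fin.last q) = 0 := by
    by_contra h0
    refine hy ⟨fun j => -w j.castSucc / w (Fin.last q), fun i => ?_⟩
    have := hw i
    have h1 : w (Fin.last q) * y i = -∑ j, w j.castSucc * (z j i : K) := by linear_combination this
    rw [show ∑ j, -w j.castSucc / w (Fin.last q) * (z j i : K) =
      (-∑ j, w j.castSucc * (z j i : K)) / w (Fin.last q) by
        rw [← Finset.sum_neg_distrib, Finset.sum_div]
        exact Finset.sum_congr rfl fun j _ => by ring, ← h1]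
    field_simp
  have hcast := hz (fun j => w j.castSucc) fun i => by simpa [hlast] using hw i
  funext j
  refine Fin.lastCases hlast (fun j => congrFun hcast j) j

theorem ncard_indepTuples_mul_le {ι : Type*} [Fintype ι] (P : Set (ι → A)) (q : ℕ) :
    ((indepTuples P q).ncard : ℝ) * P.ncard ≤
      (indepTuples P (q + 1)).ncard + (depTuples P q).ncard := by
  classical
  have hsub : indepTuples P q ×ˢ P ⊆ (fun p : (Fin q → ι → A) × (ι → A) =>
      (Fin.snoc p.1 p.2 : Fin (q + 1) → ι → A)) ⁻¹' indepTuples P (q + 1) ∪ depTuples P q := by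
    rintro ⟨z, y⟩ ⟨⟨hz, hzi⟩, hy⟩
    by_cases h : ∃ w, IsComb z w y
    · exact Or.inr ⟨hz, hy, hzi, h⟩
    · refine Or.inl ⟨fun j => ?_, hzi.snoc h⟩
      refine Fin.lastCases ?_ (fun j => ?_) j
      · simpa using hy
      · simpa using hz j
  have h1 := Set.ncard_le_ncard hsub (Set.toFinite _)
  rw [Set.ncard_prod] at h1
  have h2 : (((fun p : (Fin q → ι → A) × (ι → A) =>
      (Fin.snoc p.1 p.2 : Fin (q + 1) → ι → A)) ⁻¹' indepTuples P (q + 1)).ncard : ℝ) ≤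
      (indepTuples P (q + 1)).ncard :=
    ncard_le_of_injOn _ _ _ (fun p hp => hp) fun p _ p' _ h => by
      have := Fin.snoc_injective2 h
      exact Prod.ext this.1 this.2
  have h3 := h1.trans (Set.ncard_union_le _ _)
  refine le_trans (b := (((fun p : (Fin q → ι → A) × (ι → A) => (Fin.snoc p.1 p.2 :
    Fin (q + 1) → ι → A)) ⁻¹' indepTuples P (q + 1)).ncard : ℝ) + (depTuples P q).ncard) ?_
      (by gcongr)
  exact_mod_cast h3

theorem exists_pow_ncard_le {ι : Type*} [Fintype ι] [Nonempty ι] (h0 : (0 : K) ∉ A)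
    (P : Set (ι → A)) (d : ℕ) :
    (∃ j < d, (P.ncard : ℝ) ^ (j + 2) ≤ 2 ^ d * (depTuples P (j + 1)).ncard) ∨
      (P.ncard : ℝ) ^ (d + 1) ≤ 2 ^ d * (indepTuples P (d + 1)).ncard := by
  induction d with
  | zero =>
    right
    rw [pow_zero, one_mul, zero_add, pow_one]
    refine ncard_le_of_injOn _ _ (fun v _ => v) (fun v hv => ⟨fun _ => hv, fun w hw => ?_⟩)
      fun v _ v' _ h => congrFun h 0
    obtain ⟨i⟩ := ‹Nonempty ι›
    have := hw i
    have hv : (v i : K) ≠ 0 := fun h => h0 (h ▸ (v i).2)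
    funext j
    simpa [hv, Subsingleton.elim j 0] using this
  | succ d ih =>
    rcases ih with ⟨j, hj, h⟩ | h
    · exact Or.inl ⟨j, by omega, h.trans (by gcongr <;> norm_num)⟩
    · have h1 := ncard_indepTuples_mul_le P (d + 1)
      have h2 : (P.ncard : ℝ) ^ (d + 2) ≤ 2 ^ d * (indepTuples P (d + 1 + 1)).ncard +
          2 ^ d * (depTuples P (d + 1)).ncard := by
        rw [pow_succ, ← mul_add]
        refine le_trans (mul_le_mul_of_nonneg_right h (by positivity)) ?_
        rw [mul_assoc]
        gcongr
      rw [pow_succ (2 : ℝ)]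
      by_cases h3 : (2 : ℝ) ^ d * (indepTuples P (d + 1 + 1)).ncard ≤
          2 ^ d * (depTuples P (d + 1)).ncard
      · exact Or.inl ⟨d, by omega, by linarith⟩
      · exact Or.inr (by linarith)

open Classical in
theorem sum_mul_ncard_le {γ : Type*} [Fintype γ] {d q e : ℕ} (hqe : q + e = d + 1) (S : Set γ)
    (z : γ → Fin q → Fin (d + 2) → A) (hz : ∀ p ∈ S, IndepRows (z p))
    (F : Submodule K (Fin (d + 2) → K) → ℝ) (hF : ∀ H, 0 ≤ F H) {c : γ → ℝ}
    (hc : ∀ p ∈ S, ∑ x : Fin e → Fin (d + 2) → A with FullHyperplane (rowSpan (z p) ⊔ rowSpan x),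
      F (rowSpan (z p) ⊔ rowSpan x) ≤ c p) :
    ∑ B : Fin (d + 1) → Fin (d + 2) → A with FullHyperplane (rowSpan B),
      F (rowSpan B) / (pointsOf A (rowSpan B)).ncard ^ q *
        {p ∈ S | ∀ j, z p j ∈ pointsOf A (rowSpan B)}.ncard ≤
      (d + 1) ^ e * ∑ p with p ∈ S, c p := by
  have hcard : ∀ B : Fin (d + 1) → Fin (d + 2) → A,
      ({p ∈ S | ∀ j, z p j ∈ pointsOf A (rowSpan B)}.ncard : ℝ) =
        ∑ p with p ∈ S, if ∀ j, z p j ∈ pointsOf A (rowSpan B) then 1 else 0 := by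
    intro B
    rw [← Finset.sum_filter, Finset.filter_filter, Finset.sum_const, nsmul_eq_mul, mul_one,
      ← Set.ncard_coe_finset]
    congr 2
    ext p
    simp
  simp only [hcard, Finset.mul_sum]
  rw [Finset.sum_comm]
  refine Finset.sum_le_sum fun p hp => ?_
  have hp := (Finset.mem_filter.1 hp).2
  refine le_trans ?_ ((sum_rowSpan_le_of_indepRows hqe (hz p hp) F hF).trans
    (mul_le_mul_of_nonneg_left (hc p hp) (by positivity)))
  rw [← Finset.filter_filter, Finset.sum_filter (fun B => ∀ j, z p j ∈ pointsOf A (rowSpan B))]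
  refine le_of_eq (Finset.sum_congr rfl fun B _ => ?_)
  split_ifs <;> simp

end

theorem ncard_eq_sum_fiber {α κ : Type*} [Finite α] (S : Set α) (f : α → κ) (Λ : Finset κ)
    (h : ∀ x ∈ S, f x ∈ Λ) : (S.ncard : ℝ) = ∑ l ∈ Λ, ({x ∈ S | f x = l}.ncard : ℝ) := by
  classical
  have := Fintype.ofFinite α
  have h1 := Finset.card_eq_sum_card_fiberwise (s := S.toFinset) (f := f) (t := Λ)
    fun x hx => h x (by simpa using hx)
  rw [← Set.ncard_eq_toFinset_card'] at h1
  rw [h1]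
  push_cast
  refine Finset.sum_congr rfl fun l _ => ?_
  rw [← Set.ncard_coe_finset]
  congr 2
  ext x
  simp

section

variable {K : Type*} [Field K] {A : Finset K}

theorem mem_pointsOf_rowSpan_iff {ι τ : Type*} [Fintype τ] {D : τ → ι → A} {y : ι → A} :
    y ∈ pointsOf A (rowSpan D) ↔ ∃ w, IsComb D w y := by
  rw [pointsOf, Set.mem_ofPred_eq, rowSpan, Submodule.mem_span_range_iff_exists_fun]
  refine exists_congr fun w => ?_
  rw [funext_iff]
  refine forall_congr' fun i => ?_
  simp [Finset.sum_apply, eq_comm]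

theorem ncard_ratioSet_le (l : K) : ((ratioSet A l).ncard : ℝ) ≤ A.card := by
  have := Set.ncard_le_card (ratioSet A l)
  rw [Nat.card_eq_fintype_card, Fintype.card_coe] at this
  exact_mod_cast this

theorem HasRatio.of_isComb {d : ℕ} {τ : Type*} [Fintype τ] {l : K} {z : τ → Fin (d + 2) → A}
    (hz : ∀ j, HasRatio l (z j)) {w : τ → K} {y : Fin (d + 2) → A} (h : IsComb z w y) :
    HasRatio l y := by
  rw [HasRatio, h 0, h 1, Finset.mul_sum]
  refine Finset.sum_congr rfl fun j _ => ?_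
  rw [hz j]
  ring

/-- In a hyperplane with normal of full support, spanned by vectors `z` with ratio `l` and another
vector `x`, a vector outside the span of `z` is a multiple of `x` modulo the span of `z`, and both
do not have ratio `l`. -/
theorem exists_mul_of_fullHyperplane {d : ℕ} (hd : 0 < d) {l : K} {z : Fin d → Fin (d + 2) → A}
    (hz : ∀ j, HasRatio l (z j)) {x : Fin 1 → Fin (d + 2) → A}
    (hx : FullHyperplane (rowSpan z ⊔ rowSpan x)) {y : Fin (d + 2) → A}
    (hy : y ∈ pointsOf A (rowSpan z ⊔ rowSpan x)) (hyz : ¬ ∃ w, IsComb z w y) :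
    ∃ α : K, (x 0 0 : K) - l * x 0 1 ≠ 0 ∧ (y 0 : K) - l * y 1 ≠ 0 ∧
      ((y 0 : K) - l * y 1 = α * (x 0 0 - l * x 0 1)) ∧
      ∀ c : Fin (d + 2) → K, (∀ j, ∑ i, c i * (z j i : K) = 0) →
        ∑ i, c i * (y i : K) = α * ∑ i, c i * (x 0 i : K) := by
  let φ : (Fin (d + 2) → K) → (Fin (d + 2) → K) →ₗ[K] K := fun c => ∑ i, c i • LinearMap.proj i
  have hφ : ∀ c v, φ c v = ∑ i, c i * v i := fun c v => by simp [φ]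
  let ψ : (Fin (d + 2) → K) →ₗ[K] K := LinearMap.proj 0 - l • LinearMap.proj 1
  have hψ : ∀ v, ψ v = v 0 - l * v 1 := fun v => by simp [ψ]
  have hzψ : rowSpan z ≤ LinearMap.ker ψ := Submodule.span_le.2 (by
    rintro _ ⟨j, rfl⟩
    rw [SetLike.mem_coe, LinearMap.mem_ker, hψ]
    exact sub_eq_zero.2 (hz j))
  have hspan : rowSpan x = Submodule.span K {fun i => (x 0 i : K)} := by
    rw [rowSpan, Set.range_unique]
    rfl
  obtain ⟨u, hu, v, hv, huv⟩ := Submodule.mem_sup.1 hy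
  rw [hspan, Submodule.mem_span_singleton] at hv
  obtain ⟨α, rfl⟩ := hv
  have hα : α ≠ 0 := fun h => hyz (mem_pointsOf_rowSpan_iff.1 (by
    rw [pointsOf, Set.mem_ofPred_eq, ← huv, h, zero_smul, add_zero]
    exact hu))
  have hyx : ψ (fun i => (y i : K)) = α * ψ (fun i => (x 0 i : K)) := by
    rw [← huv, map_add, map_smul, LinearMap.mem_ker.1 (hzψ hu), zero_add, smul_eq_mul]
  have hx0 : ψ (fun i => (x 0 i : K)) ≠ 0 := by
    intro h
    have hle : rowSpan z ⊔ rowSpan x ≤ LinearMap.ker ψ := sup_le hzψ (by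
      rw [hspan, Submodule.span_singleton_le_iff_mem]
      exact h)
    have hψ0 : ψ ≠ 0 := fun h => by
      have := hψ (Pi.single 0 1)
      rw [h] at this
      simp at this
    have h1 := Module.Dual.finrank_ker_add_one_of_ne_zero hψ0
    have h2 := hx.finrank_add_one
    rw [Module.finrank_fintype_fun_eq_card] at h1
    have heq := Submodule.eq_of_le_of_finrank_eq hle (by
      change _ = Module.finrank K (LinearMap.ker ψ)
      omega)
    obtain ⟨c, hc, hc'⟩ := hx
    have hmem : (Pi.single (Fin.last (d + 1)) 1 : Fin (d + 2) → K) ∈ LinearMap.ker ψ := by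
      rw [LinearMap.mem_ker, hψ, Pi.single_eq_of_ne, Pi.single_eq_of_ne]
      · simp
      · simp [Fin.ext_iff]; omega
      · simp [Fin.ext_iff]
    rw [← heq, hc'] at hmem
    simp [Pi.single_apply] at hmem
    exact hc _ hmem
  refine ⟨α, by rwa [hψ] at hx0, ?_, by rw [hψ, hψ] at hyx; exact hyx, fun c hc => ?_⟩
  · rw [hψ, hψ] at hyx
    rw [hyx]
    rw [hψ] at hx0
    exact mul_ne_zero hα hx0
  · have hzc : rowSpan z ≤ LinearMap.ker (φ c) := Submodule.span_le.2 (by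
      rintro _ ⟨j, rfl⟩
      rw [SetLike.mem_coe, LinearMap.mem_ker, hφ]
      exact hc j)
    have := congrArg (φ c) huv
    rw [map_add, map_smul, LinearMap.mem_ker.1 (hzc hu), zero_add, smul_eq_mul, hφ, hφ] at this
    exact this.symm

variable [DecidableEq K]

/-- The quotients of members of `A`. -/
def ratios (A : Finset K) : Finset K := Finset.univ.image fun p : A × A => (p.1 : K) / p.2

theorem ratioSet_pos (h0 : (0 : K) ∉ A) {l : K} (hl : l ∈ ratios A) :
    0 < ((ratioSet A l).ncard : ℝ) := by
  obtain ⟨⟨x, y⟩, -, rfl⟩ := Finset.mem_image.1 hl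
  have hy : (y : K) ≠ 0 := fun h => h0 (h ▸ y.2)
  rw [Nat.cast_pos, Set.ncard_pos (Set.toFinite _)]
  refine ⟨y, ?_⟩
  rw [ratioSet, Set.mem_ofPred_eq, div_mul_cancel₀ _ hy]
  exact x.2

theorem sum_ratioSet_le (h0 : (0 : K) ∉ A) :
    ∑ l ∈ ratios A, ((ratioSet A l).ncard : ℝ) ≤ (A.card : ℝ) ^ 2 := by
  have h := ncard_eq_sum_fiber (Set.univ : Set (A × A)) (fun p => (p.1 : K) / p.2) (ratios A)
    fun p _ => Finset.mem_image_of_mem _ (Finset.mem_univ p)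
  rw [Set.ncard_univ, Nat.card_eq_fintype_card, Fintype.card_prod, Fintype.card_coe, Nat.cast_mul,
    ← sq] at h
  rw [h]
  refine Finset.sum_le_sum fun l _ => ?_
  have : ∀ x : A, (x : K) ≠ 0 := fun x hx => h0 (hx ▸ x.2)
  classical
  refine ncard_le_of_injOn _ _ (fun x => if hx : l * x ∈ A then (⟨l * x, hx⟩, x) else (x, x))
    (fun x hx => ?_) (fun x hx x' hx' h => ?_)
  · rw [ratioSet, Set.mem_ofPred_eq] at hx
    rw [dif_pos hx]
    exact ⟨trivial, mul_div_cancel_right₀ _ (this x)⟩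
  · rw [ratioSet, Set.mem_ofPred_eq] at hx hx'
    simp only [dif_pos hx, dif_pos hx'] at h
    exact congrArg Prod.snd h

theorem ncard_eq_sum_hasRatio (h0 : (0 : K) ∉ A) {d : ℕ} (P : Set (Fin (d + 2) → A)) :
    (P.ncard : ℝ) = ∑ l ∈ ratios A, ({v ∈ P | HasRatio l v}.ncard : ℝ) := by
  rw [ncard_eq_sum_fiber P (fun v => (v 0 : K) / v 1) (ratios A)
    fun v _ => Finset.mem_image.2 ⟨(v 0, v 1), Finset.mem_univ _, rfl⟩]
  refine Finset.sum_congr rfl fun l _ => ?_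
  congr 2
  ext v
  have hv : (v 1 : K) ≠ 0 := fun h => h0 (h ▸ (v 1).2)
  simp only [Set.mem_ofPred_eq, HasRatio, div_eq_iff hv]

variable {N : ℕ} {C : ℝ}

theorem SmallRank.ncard_pairs_le (hA : SmallRank N C A) {d : ℕ} (hd : 0 < d) (hdN : 2 * d ≤ N)
    {l : K} {z : Fin d → Fin (d + 2) → A} (hz : ∀ j, HasRatio l (z j)) :
    ({p : (Fin 1 → Fin (d + 2) → A) × (Fin (d + 2) → A) |
      FullHyperplane (rowSpan z ⊔ rowSpan p.1) ∧ p.2 ∈ pointsOf A (rowSpan z ⊔ rowSpan p.1) ∧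
        ¬ ∃ w, IsComb z w p.2}.ncard : ℝ) ≤ C * √(A.card) ^ (2 * (d + 4)) := by
  have hC := hA.one_le
  set S := {p : (Fin 1 → Fin (d + 2) → A) × (Fin (d + 2) → A) |
      FullHyperplane (rowSpan z ⊔ rowSpan p.1) ∧ p.2 ∈ pointsOf A (rowSpan z ⊔ rowSpan p.1) ∧
        ¬ ∃ w, IsComb z w p.2} with hS
  have key : ∀ t : (A × A) × (A × A),
      ({p ∈ S | ((p.1 0 0, p.1 0 1), (p.2 0, p.2 1)) = t}.ncard : ℝ) ≤
      C * √(A.card) ^ (2 * d) := by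
    rintro ⟨⟨x₀, x₁⟩, ⟨y₀, y₁⟩⟩
    by_cases hne : {p ∈ S | ((p.1 0 0, p.1 0 1), (p.2 0, p.2 1)) = ((x₀, x₁), (y₀, y₁))}.Nonempty
    swap
    · rw [Set.not_nonempty_iff_eq_empty.1 hne, Set.ncard_empty, Nat.cast_zero]
      positivity
    obtain ⟨⟨x, y⟩, ⟨hx, hy, hyz⟩, hxy⟩ := hne
    obtain ⟨⟨rfl, rfl⟩, rfl, rfl⟩ : (x 0 0 = x₀ ∧ x 0 1 = x₁) ∧ y 0 = y₀ ∧ y 1 = y₁ := by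
      simpa using hxy
    obtain ⟨-, hX, hY, -, -⟩ := exists_mul_of_fullHyperplane hd hz hx hy hyz
    obtain ⟨c, hc, hcH⟩ := hx
    have hcz : ∀ j, ∑ i, c i * (z j i : K) = 0 := fun j =>
      (hcH _).1 (Submodule.mem_sup_left (Submodule.subset_span ⟨j, rfl⟩))
    set X : K := x 0 0 - l * x 0 1
    set Y : K := y 0 - l * y 1
    have hlin := hA.ncard_linear_le (ι := Fin d ⊕ Fin d) (by simpa [two_mul] using hdN)
      (Sum.elim (fun i => Y * c i.succ.succ) fun i => -X * c i.succ.succ)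
      (by rintro (i | i) <;> simp [hX, hY, hc])
      (X * (c 0 * y 0 + c 1 * y 1) - Y * (c 0 * x 0 0 + c 1 * x 0 1))
    rw [Fintype.card_sum, Fintype.card_fin, ← two_mul] at hlin
    refine (ncard_le_of_injOn _ _ (fun p => Sum.elim (fun i => p.1 0 i.succ.succ)
      fun i => p.2 i.succ.succ) ?_ ?_).trans hlin
    · rintro ⟨x', y'⟩ ⟨⟨hx', hy', hyz'⟩, h⟩
      simp only [Prod.mk.injEq] at h hx' hy' hyz'
      obtain ⟨α, -, -, hα, hcα⟩ := exists_mul_of_fullHyperplane hd hz hx' hy' hyz'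
      have h1 := hcα c hcz
      rw [h.1.1, h.1.2, h.2.1, h.2.2] at hα
      change Y = α * X at hα
      rw [Fin.sum_univ_succ, Fin.sum_univ_succ, Fin.sum_univ_succ (fun i => c i * (x' 0 i : K)),
        Fin.sum_univ_succ (fun i : Fin (d + 1) => c i.succ * (x' 0 i.succ : K))] at h1
      simp only [Fin.succ_zero_eq_one, h.1.1, h.1.2, h.2.1, h.2.2] at h1
      rw [Set.mem_ofPred_eq, Fintype.sum_sum_type]
      simp only [Sum.elim_inl, Sum.elim_inr, mul_assoc, ← Finset.mul_sum]
      rw [hα]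
      linear_combination -X * h1
    · rintro ⟨x', y'⟩ ⟨-, h⟩ ⟨x'', y''⟩ ⟨-, h'⟩ he
      simp only [Prod.mk.injEq] at h h' ⊢
      refine ⟨funext fun t => ?_, ?_⟩
      · rw [Subsingleton.elim t 0]
        refine funext fun i => Fin.cases (h.1.1.trans h'.1.1.symm) (fun i => Fin.cases
          (h.1.2.trans h'.1.2.symm) (fun i => congrFun he (Sum.inl i)) i) i
      · refine funext fun i => Fin.cases (h.2.1.trans h'.2.1.symm) (fun i => Fin.cases
          (h.2.2.trans h'.2.2.symm) (fun i => congrFun he (Sum.inr i)) i) i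
  refine (ncard_le_card_mul_of_subset S (fun t =>
      {p ∈ S | ((p.1 0 0, p.1 0 1), (p.2 0, p.2 1)) = t})
    (fun p hp => ⟨_, hp, rfl⟩) key).trans_eq ?_
  rw [sqrt_card_pow, sqrt_card_pow]
  simp only [Fintype.card_prod, Fintype.card_coe]
  push_cast
  ring

end

theorem card_filter_mem_eq_ncard {γ : Type*} [Fintype γ] (S : Set γ) [DecidablePred (· ∈ S)] :
    (Finset.univ.filter (· ∈ S)).card = S.ncard := by
  rw [← Set.ncard_coe_finset]
  congr 1
  ext p
  simp

section

variable {K : Type*} [Field K] {A : Finset K}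

open Classical in
theorem sum_depTuples_le (d q e : ℕ) (hqe : q + e = d + 1) (l : K) :
    ∑ B : Fin (d + 1) → Fin (d + 2) → A with FullHyperplane (rowSpan B),
      ((depTuples {v ∈ pointsOf A (rowSpan B) | HasRatio l v} q).ncard : ℝ) /
        (pointsOf A (rowSpan B)).ncard ^ q ≤
      (d + 1) ^ e * ((depSet A d q l).ncard * √(A.card) ^ (2 * ((d + 2) * e))) := by
  have h := sum_mul_ncard_le hqe (depSet A d q l) (fun p => p.1) (fun p hp => hp.2.2.1)
    (fun _ => 1) (fun _ => zero_le_one) (c := fun _ => √(A.card) ^ (2 * ((d + 2) * e)))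
    (fun p _ => by
      rw [Finset.sum_const, nsmul_eq_mul, mul_one, sqrt_card_pow]
      refine (Nat.cast_le.2 (Finset.card_filter_le _ _)).trans_eq ?_
      simp [pow_mul])
  rw [Finset.sum_const, nsmul_eq_mul, card_filter_mem_eq_ncard] at h
  refine le_trans (Finset.sum_le_sum fun B _ => ?_) h
  rw [one_div, div_eq_inv_mul]
  refine mul_le_mul_of_nonneg_left ?_ (by positivity)
  refine Nat.cast_le.2 (Set.ncard_le_ncard ?_ (Set.toFinite _))
  rintro p ⟨hz, hy, hi, hw⟩
  exact ⟨⟨fun j => (hz j).2, hy.2, hi, hw⟩, fun j => (hz j).1⟩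

theorem ncard_indep_hasRatio_le (d : ℕ) (l : K) :
    ({z : Fin d → Fin (d + 2) → A | (∀ j, HasRatio l (z j)) ∧ IndepRows z}.ncard : ℝ) ≤
      (ratioSet A l).ncard ^ d * √(A.card) ^ (2 * (d * d)) := by
  have h1 : ({v : Fin (d + 2) → A | HasRatio l v}.ncard : ℝ) ≤
      (ratioSet A l).ncard * (A.card : ℝ) ^ d := by
    have hpr := ncard_univ_pi A (Fin d)
    rw [Fintype.card_fin] at hpr
    rw [← hpr, ← Nat.cast_mul, ← Set.ncard_prod]
    refine ncard_le_of_injOn _ _ (fun v => (v 1, fun i => v i.succ.succ)) (fun v hv => ?_) ?_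
    · refine ⟨?_, trivial⟩
      rw [ratioSet, Set.mem_ofPred_eq, ← hv]
      exact (v 0).2
    · intro v hv v' hv' h
      simp only [Prod.mk.injEq] at h
      refine funext fun i => Fin.cases ?_ (fun i => Fin.cases h.1 (fun i => congrFun h.2 i) i) i
      exact Subtype.ext (hv.trans (by rw [h.1]; exact hv'.symm))
  refine (ncard_pi_le _ (fun _ => {v : Fin (d + 2) → A | HasRatio l v}) (fun z hz => hz.1)
    fun _ => h1).trans_eq ?_
  rw [Fintype.card_fin, mul_pow, ← pow_mul, sqrt_card_pow]

variable [DecidableEq K] {N : ℕ} {C : ℝ}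

open Classical in
theorem SmallRank.sum_pointsOf_sup_le (hA : SmallRank N C A) {d : ℕ} (hd : 0 < d)
    (hdN : 2 * d ≤ N) {l : K} {z : Fin d → Fin (d + 2) → A} (hz : ∀ j, HasRatio l (z j)) :
    ∑ x : Fin 1 → Fin (d + 2) → A with FullHyperplane (rowSpan z ⊔ rowSpan x),
      ((pointsOf A (rowSpan z ⊔ rowSpan x)).ncard : ℝ) ≤
      √(A.card) ^ (2 * (d + 2)) * {y : Fin (d + 2) → A | ∃ w, IsComb z w y}.ncard +
        C * √(A.card) ^ (2 * (d + 4)) := by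
  set 𝓧 := Finset.univ.filter fun x : Fin 1 → Fin (d + 2) → A =>
    FullHyperplane (rowSpan z ⊔ rowSpan x)
  set S := {p : (Fin 1 → Fin (d + 2) → A) × (Fin (d + 2) → A) |
      FullHyperplane (rowSpan z ⊔ rowSpan p.1) ∧ p.2 ∈ pointsOf A (rowSpan z ⊔ rowSpan p.1) ∧
        ¬ ∃ w, IsComb z w p.2}
  have hpairs : (S.ncard : ℝ) ≤ C * √(A.card) ^ (2 * (d + 4)) := hA.ncard_pairs_le hd hdN hz
  rw [ncard_eq_sum_fiber S Prod.fst 𝓧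
    fun p hp => Finset.mem_filter.2 ⟨Finset.mem_univ _, hp.1⟩] at hpairs
  have hX : (𝓧.card : ℝ) ≤ √(A.card) ^ (2 * (d + 2)) := by
    rw [sqrt_card_pow]
    refine (Nat.cast_le.2 (Finset.card_filter_le _ _)).trans_eq ?_
    simp
  refine le_trans ?_ (add_le_add (mul_le_mul_of_nonneg_right hX (Nat.cast_nonneg _)) hpairs)
  rw [← nsmul_eq_mul, ← Finset.sum_const, ← Finset.sum_add_distrib]
  refine Finset.sum_le_sum fun x hx => ?_
  have hx := (Finset.mem_filter.1 hx).2
  have hsub : pointsOf A (rowSpan z ⊔ rowSpan x) ⊆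
      {y | ∃ w, IsComb z w y} ∪ {y | (x, y) ∈ S} := by
    intro y hy
    by_cases h : ∃ w, IsComb z w y
    · exact Or.inl h
    · exact Or.inr ⟨hx, hy, h⟩
  have h1 := (Set.ncard_le_ncard hsub (Set.toFinite _)).trans (Set.ncard_union_le _ _)
  have h2 : ({y | (x, y) ∈ S}.ncard : ℝ) ≤ {p ∈ S | p.1 = x}.ncard :=
    ncard_le_of_injOn _ _ (fun y => (x, y)) (fun y hy => ⟨hy, rfl⟩)
      fun y _ y' _ h => congrArg Prod.snd h
  calc ((pointsOf A (rowSpan z ⊔ rowSpan x)).ncard : ℝ) ≤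
      {y | ∃ w, IsComb z w y}.ncard + {y | (x, y) ∈ S}.ncard := by exact_mod_cast h1
    _ ≤ _ := by gcongr

open Classical in
theorem SmallRank.sum_indepTuples_le (hA : SmallRank N C A) {d : ℕ} (hd : 0 < d)
    (hdN : 2 * d ≤ N) (l : K) :
    ∑ B : Fin (d + 1) → Fin (d + 2) → A with FullHyperplane (rowSpan B),
      ((indepTuples {v ∈ pointsOf A (rowSpan B) | HasRatio l v} d).ncard : ℝ) /
        (pointsOf A (rowSpan B)).ncard ^ (d - 1) ≤
      (d + 1) * (√(A.card) ^ (2 * (d + 2)) * (depSet A d d l).ncard +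
        (ratioSet A l).ncard ^ d * √(A.card) ^ (2 * (d * d)) *
          (C * √(A.card) ^ (2 * (d + 4)))) := by
  set S := {z : Fin d → Fin (d + 2) → A | (∀ j, HasRatio l (z j)) ∧ IndepRows z}
  have hC := hA.one_le
  have h := sum_mul_ncard_le (e := 1) rfl S (fun p => p) (fun p hp => hp.2)
    (fun H => ((pointsOf A H).ncard : ℝ)) (fun _ => Nat.cast_nonneg _)
    (fun z hz => hA.sum_pointsOf_sup_le hd hdN hz.1)
  rw [Finset.sum_add_distrib, Finset.sum_const, nsmul_eq_mul, card_filter_mem_eq_ncard,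
    ← Finset.mul_sum, pow_one] at h
  have hdep : ∑ z with z ∈ S, ({y : Fin (d + 2) → A | ∃ w, IsComb z w y}.ncard : ℝ) ≤
      (depSet A d d l).ncard := by
    rw [ncard_eq_sum_fiber (depSet A d d l) Prod.fst (Finset.univ.filter fun z => z ∈ S)
      fun p hp => Finset.mem_filter.2 ⟨Finset.mem_univ _, hp.1, hp.2.2.1⟩]
    refine Finset.sum_le_sum fun z hz => ?_
    have hz := (Finset.mem_filter.1 hz).2
    refine ncard_le_of_injOn _ _ (fun y => (z, y)) ?_ fun y _ y' _ h => congrArg Prod.snd h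
    rintro y ⟨w, hw⟩
    exact ⟨⟨hz.1, HasRatio.of_isComb hz.1 hw, hz.2, w, hw⟩, rfl⟩
  refine le_trans (Finset.sum_le_sum fun B hB => ?_) (h.trans ?_)
  · set H := rowSpan B
    have hsub : ((indepTuples {v ∈ pointsOf A H | HasRatio l v} d).ncard : ℝ) ≤
        {p ∈ S | ∀ j, p j ∈ pointsOf A H}.ncard := by
      refine Nat.cast_le.2 (Set.ncard_le_ncard ?_ (Set.toFinite _))
      rintro z ⟨hz, hi⟩
      exact ⟨⟨fun j => (hz j).2, hi⟩, fun j => (hz j).1⟩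
    have hpos : 0 < ((pointsOf A H).ncard : ℝ) := by
      rw [Nat.cast_pos, Set.ncard_pos (Set.toFinite _)]
      exact ⟨B 0, Submodule.subset_span ⟨0, rfl⟩⟩
    have hd1 : ((pointsOf A H).ncard : ℝ) ^ d =
        (pointsOf A H).ncard ^ (d - 1) * (pointsOf A H).ncard := by
      rw [← pow_succ, Nat.sub_add_cancel hd]
    have hq : ((pointsOf A H).ncard : ℝ) / (pointsOf A H).ncard ^ d =
        1 / (pointsOf A H).ncard ^ (d - 1) := by
      rw [hd1]
      field_simp
    rw [hq, div_eq_mul_one_div, mul_comm]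
    gcongr
  · have hSc : (S.ncard : ℝ) ≤ _ := ncard_indep_hasRatio_le d l
    gcongr
    refine le_of_eq_of_le (Finset.sum_congr ?_ fun _ _ => rfl) hdep
    ext
    simp

end

section

variable {K : Type*} [Field K] [DecidableEq K] {N : ℕ} {C : ℝ} {A : Finset K}

open Classical in
theorem SmallRank.sum_sum_depTuples_le (hA : SmallRank N C A) {d q : ℕ} (hd : 3 ≤ d) (hq : 0 < q)
    (hqd : q < d) (hdN : 2 * d ≤ N) :
    (∑ l ∈ ratios A, ((ratioSet A l).ncard : ℝ)) ^ q * ∑ l ∈ ratios A,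
      (∑ B : Fin (d + 1) → Fin (d + 2) → A with FullHyperplane (rowSpan B),
        ((depTuples {v ∈ pointsOf A (rowSpan B) | HasRatio l v} q).ncard : ℝ) /
          (pointsOf A (rowSpan B)).ncard ^ q) / (ratioSet A l).ncard ^ q ≤
      (d + 1) ^ d * (2 ^ (d + 1) * d * (2 ^ d * C ^ d)) *
        √(A.card) ^ (2 * ((d + 1) * (d + 2)) + (d + 1)) := by
  have hC := hA.one_le
  have hs := hA.one_le_sqrt
  set s := √(A.card : ℝ)
  have h0 := hA.zero_notMem
  have hM := sum_ratioSet_le h0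
  rw [← sqrt_card_pow] at hM
  set M := ∑ l ∈ ratios A, ((ratioSet A l).ncard : ℝ)
  have hM0 : 0 ≤ M := Finset.sum_nonneg fun _ _ => Nat.cast_nonneg _
  obtain ⟨e, he⟩ : ∃ e, q + e = d + 1 := ⟨d + 1 - q, by omega⟩
  set c := ((d : ℝ) + 1) ^ d * (2 ^ (d + 1) * d * (2 ^ d * C ^ d))
  have hd1 : (1 : ℝ) ≤ d := by exact_mod_cast (by omega : 1 ≤ d)
  have key : ∀ l ∈ ratios A, (∑ B : Fin (d + 1) → Fin (d + 2) → A with FullHyperplane (rowSpan B),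
        ((depTuples {v ∈ pointsOf A (rowSpan B) | HasRatio l v} q).ncard : ℝ) /
          (pointsOf A (rowSpan B)).ncard ^ q) / (ratioSet A l).ncard ^ q ≤
      c * s ^ (2 * d * q + 2 * ((d + 2) * e)) * (ratioSet A l).ncard := by
    intro l hl
    have hb := ratioSet_pos h0 hl
    rw [div_le_iff₀ (by positivity)]
    refine (sum_depTuples_le d q e he l).trans ?_
    have h := hA.ncard_depSet_le (d := d) hq (by omega) l (E := 2 * d * q) (by
      intro t ht htq
      obtain ⟨t, rfl⟩ := Nat.exists_eq_add_of_lt ht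
      obtain ⟨f, hf⟩ : ∃ f, d + 1 - q = f + 2 := ⟨d - 1 - q, by omega⟩
      obtain ⟨q, rfl⟩ := Nat.exists_eq_add_of_lt hq
      obtain ⟨g, rfl⟩ := Nat.exists_eq_add_of_le (show t ≤ q by omega)
      obtain rfl : d = t + g + f + 2 := by omega
      rw [hf]
      simp only [Nat.zero_add, Nat.add_sub_cancel]
      rw [show 2 * (t + g + 1) + 1 - (t + 1) = t + 2 * g + 2 by omega]
      nlinarith)
    have hcoef : (2 : ℝ) ^ (d + 1) * q * (2 ^ q * C ^ (d + 1 - q)) ≤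
        2 ^ (d + 1) * d * (2 ^ d * C ^ d) := by
      have : (q : ℝ) ≤ d := by exact_mod_cast hqd.le
      gcongr
      · norm_num
      · omega
    have hde : ((d : ℝ) + 1) ^ e ≤ (d + 1) ^ d := by
      gcongr
      · linarith
      · omega
    calc ((d : ℝ) + 1) ^ e * ((depSet A d q l).ncard * s ^ (2 * ((d + 2) * e))) ≤
        (d + 1) ^ d * (2 ^ (d + 1) * d * (2 ^ d * C ^ d) *
          ((ratioSet A l).ncard ^ (q + 1) * s ^ (2 * d * q)) * s ^ (2 * ((d + 2) * e))) := by
          gcongr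
          exact h.trans (by gcongr)
      _ = _ := by ring
  calc M ^ q * _ ≤ M ^ q * ∑ l ∈ ratios A,
        c * s ^ (2 * d * q + 2 * ((d + 2) * e)) * (ratioSet A l).ncard := by
        gcongr with l hl
        exact key l hl
    _ = c * s ^ (2 * d * q + 2 * ((d + 2) * e)) * M ^ (q + 1) := by
        rw [← Finset.mul_sum]; ring
    _ ≤ c * s ^ (2 * d * q + 2 * ((d + 2) * e)) * (s ^ (2 * 2)) ^ (q + 1) := by gcongr
    _ = c * s ^ (2 * d * q + 2 * ((d + 2) * e) + 2 * 2 * (q + 1)) := by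
        rw [← pow_mul, pow_add s (2 * d * q + 2 * ((d + 2) * e))]; ring
    _ ≤ _ := by
        refine mul_le_mul_of_nonneg_left (pow_le_pow_right₀ hs ?_) (by positivity)
        obtain ⟨f, rfl⟩ := Nat.exists_eq_add_of_lt hqd
        obtain rfl : e = f + 2 := by omega
        nlinarith

open Classical in
theorem SmallRank.sum_sum_indepTuples_le (hA : SmallRank N C A) {d : ℕ} (hd : 3 ≤ d)
    (hdN : 2 * d ≤ N) :
    (∑ l ∈ ratios A, ((ratioSet A l).ncard : ℝ)) ^ (d - 1) * ∑ l ∈ ratios A,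
      (∑ B : Fin (d + 1) → Fin (d + 2) → A with FullHyperplane (rowSpan B),
        ((indepTuples {v ∈ pointsOf A (rowSpan B) | HasRatio l v} d).ncard : ℝ) /
          (pointsOf A (rowSpan B)).ncard ^ (d - 1)) / (ratioSet A l).ncard ^ (d - 1) ≤
      (d + 1) * (2 ^ (d + 1) * d * (2 ^ d * C) + C) *
        √(A.card) ^ (2 * ((d + 1) * (d + 2)) + (d + 1)) := by
  have hC := hA.one_le
  have hs := hA.one_le_sqrt
  set s := √(A.card : ℝ) with hs_def
  have h0 := hA.zero_notMem
  have hM := sum_ratioSet_le h0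
  rw [← sqrt_card_pow] at hM
  set M := ∑ l ∈ ratios A, ((ratioSet A l).ncard : ℝ)
  have hM0 : 0 ≤ M := Finset.sum_nonneg fun _ _ => Nat.cast_nonneg _
  have key : ∀ l ∈ ratios A, (∑ B : Fin (d + 1) → Fin (d + 2) → A with FullHyperplane (rowSpan B),
        ((indepTuples {v ∈ pointsOf A (rowSpan B) | HasRatio l v} d).ncard : ℝ) /
          (pointsOf A (rowSpan B)).ncard ^ (d - 1)) / (ratioSet A l).ncard ^ (d - 1) ≤
      (d + 1) * (2 ^ (d + 1) * d * (2 ^ d * C) * s ^ (2 * d * d + 3 * d + 5) +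
        C * s ^ (2 * (d * d) + 2 * (d + 4))) * (ratioSet A l).ncard := by
    intro l hl
    have hb := ratioSet_pos h0 hl
    have hbs : ((ratioSet A l).ncard : ℝ) ≤ s ^ 2 := by
      refine (ncard_ratioSet_le l).trans_eq ?_
      rw [hs_def, Real.sq_sqrt (Nat.cast_nonneg _)]
    rw [div_le_iff₀ (by positivity)]
    refine (hA.sum_indepTuples_le (by omega) hdN l).trans ?_
    have h := hA.ncard_depSet_le (d := d) (q := d) (by omega) (by omega) l
      (E := 2 * d * d + d - 1) (by
        intro t ht htq
        obtain ⟨t, rfl⟩ := Nat.exists_eq_add_of_lt ht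
        obtain ⟨g, rfl⟩ := Nat.exists_eq_add_of_le (show t + 1 ≤ d by omega)
        simp only [Nat.zero_add, Nat.add_sub_cancel]
        rw [show 2 * (t + 1 + g) + 1 - (t + 1) = t + 2 * g + 2 by omega,
          show t + 1 + g + 1 - (t + 1 + g) = 1 by omega, show t + 1 + g - 1 = t + g by omega]
        rw [Nat.le_sub_iff_add_le (by omega)]
        nlinarith)
    rw [show d + 1 - d = 1 by omega, pow_one] at h
    obtain ⟨f, rfl⟩ : ∃ f, d = f + 1 := ⟨d - 1, by omega⟩
    simp only [Nat.add_sub_cancel]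
    have hexp : 2 * (f + 1) * (f + 1) + (f + 1) - 1 = 2 * (f + 1) * (f + 1) + f := by omega
    rw [hexp] at h
    set b := ((ratioSet A l).ncard : ℝ)
    calc (((f + 1 : ℕ) : ℝ) + 1) * (s ^ (2 * (f + 1 + 2)) * (depSet A (f + 1) (f + 1) l).ncard +
          b ^ (f + 1) * s ^ (2 * ((f + 1) * (f + 1))) * (C * s ^ (2 * (f + 1 + 4)))) ≤
        (((f + 1 : ℕ) : ℝ) + 1) * (s ^ (2 * (f + 1 + 2)) *
          (2 ^ (f + 1 + 1) * (f + 1 : ℕ) * (2 ^ (f + 1) * C) *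
            (b ^ (f + 1) * s ^ 2 * s ^ (2 * (f + 1) * (f + 1) + f))) +
          b ^ (f + 1) * s ^ (2 * ((f + 1) * (f + 1))) * (C * s ^ (2 * (f + 1 + 4)))) := by
          gcongr
          refine h.trans ?_
          rw [pow_succ b (f + 1)]
          gcongr
      _ = _ := by
          push_cast
          ring
  set c₁ := (2 : ℝ) ^ (d + 1) * d * (2 ^ d * C)
  have hd0 : (0 : ℝ) ≤ d := by positivity
  have hM' : M ^ (d - 1) * M ≤ s ^ (4 * d) := by
    rw [← pow_succ, Nat.sub_add_cancel (by omega), pow_mul]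
    gcongr
  calc M ^ (d - 1) * _ ≤ M ^ (d - 1) * ∑ l ∈ ratios A,
        (d + 1) * (c₁ * s ^ (2 * d * d + 3 * d + 5) + C * s ^ (2 * (d * d) + 2 * (d + 4))) *
          (ratioSet A l).ncard := by
        gcongr with l hl
        exact key l hl
    _ = (d + 1) * (c₁ * s ^ (2 * d * d + 3 * d + 5) + C * s ^ (2 * (d * d) + 2 * (d + 4))) *
          (M ^ (d - 1) * M) := by
        rw [← Finset.mul_sum]; ring
    _ ≤ (d + 1) * (c₁ * s ^ (2 * d * d + 3 * d + 5) + C * s ^ (2 * (d * d) + 2 * (d + 4))) *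
          s ^ (4 * d) := by gcongr
    _ = (d + 1) * (c₁ * s ^ (2 * d * d + 3 * d + 5 + 4 * d) +
          C * s ^ (2 * (d * d) + 2 * (d + 4) + 4 * d)) := by rw [pow_add, pow_add]; ring
    _ ≤ (d + 1) * (c₁ * s ^ (2 * ((d + 1) * (d + 2)) + (d + 1)) +
          C * s ^ (2 * ((d + 1) * (d + 2)) + (d + 1))) := by
        have h₁ : 2 * d * d + 3 * d + 5 + 4 * d ≤ 2 * ((d + 1) * (d + 2)) + (d + 1) := by nlinarith
        have h₂ : 2 * (d * d) + 2 * (d + 4) + 4 * d ≤ 2 * ((d + 1) * (d + 2)) + (d + 1) := by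
          nlinarith
        have := pow_le_pow_right₀ hs h₁
        have := pow_le_pow_right₀ hs h₂
        gcongr
    _ = _ := by ring

end

section

variable {K : Type*} [Field K] [DecidableEq K] {N : ℕ} {C : ℝ} {A : Finset K}

theorem SmallRank.ncard_pointsOf_le (hA : SmallRank N C A) {d : ℕ}
    (H : Submodule K (Fin (d + 3) → K))
    (hH : (pointsOf A H).Nonempty) :
    ((pointsOf A H).ncard : ℝ) ≤
      ∑ j : Fin d, (Fintype.card (Option (Fin d)) : ℝ) ^ (j + 2 : ℕ) * 2 ^ d *
        ((∑ l ∈ ratios A, ((ratioSet A l).ncard : ℝ)) ^ (j + 1 : ℕ) * ∑ l ∈ ratios A,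
          ((depTuples {v ∈ pointsOf A H | HasRatio l v} (j + 1)).ncard : ℝ) /
            (ratioSet A l).ncard ^ (j + 1 : ℕ) / (pointsOf A H).ncard ^ (j + 1 : ℕ)) +
      (Fintype.card (Option (Fin d)) : ℝ) ^ (d + 1) * 2 ^ d *
        ((∑ l ∈ ratios A, ((ratioSet A l).ncard : ℝ)) ^ d * ∑ l ∈ ratios A,
          ((indepTuples {v ∈ pointsOf A H | HasRatio l v} (d + 1)).ncard : ℝ) /
            (ratioSet A l).ncard ^ d / (pointsOf A H).ncard ^ d) := by
  have h0 := hA.zero_notMem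
  have hN := ncard_eq_sum_hasRatio h0 (d := d + 1) (pointsOf A H)
  have h := sum_le_sum_div_pow (J := Option (Fin d)) (Λ := ratios A)
    (fun j => j.elim d fun j => (j : ℕ) + 1)
    (n := fun l => ({v ∈ pointsOf A H | HasRatio (d := d + 1) l v}.ncard : ℝ))
    (b := fun l => ((ratioSet A l).ncard : ℝ))
    (G := fun j l => j.elim ((indepTuples {v ∈ pointsOf A H | HasRatio l v} (d + 1)).ncard : ℝ)
      fun j => ((depTuples {v ∈ pointsOf A H | HasRatio l v} ((j : ℕ) + 1)).ncard : ℝ))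
    (c := 2 ^ d) (by positivity) (fun l hl => ratioSet_pos h0 hl) (fun _ _ => Nat.cast_nonneg _)
    (by rintro (_ | j) l _ <;> exact Nat.cast_nonneg _)
    (fun l _ => by
      rcases exists_pow_ncard_le h0 {v ∈ pointsOf A H | HasRatio l v} d with ⟨j, hj, h⟩ | h
      · exact ⟨some ⟨j, hj⟩, h⟩
      · exact ⟨none, h⟩)
    (by
      rw [← hN, Nat.cast_pos, Set.ncard_pos (Set.toFinite _)]
      exact hH)
  rw [← hN, Fintype.sum_option] at h
  exact h.trans_eq (add_comm _ _)

open Classical in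
/-- The number of points on hyperplanes with full support spanned by vectors over `A`. -/
theorem SmallRank.sum_ncard_pointsOf_le (hA : SmallRank N C A) {d : ℕ} (hd : 2 ≤ d)
    (hdN : 2 * (d + 1) ≤ N) :
    ∑ B : Fin (d + 2) → Fin (d + 3) → A with FullHyperplane (rowSpan B),
      ((pointsOf A (rowSpan B)).ncard : ℝ) ≤
      (d * ((d + 1) ^ (d + 1) * 2 ^ d *
          ((d + 2) ^ (d + 1) * (2 ^ (d + 2) * (d + 1) * (2 ^ (d + 1) * C ^ (d + 1))))) +
        (d + 1) ^ (d + 1) * 2 ^ d *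
          ((d + 2) * (2 ^ (d + 2) * (d + 1) * (2 ^ (d + 1) * C) + C))) *
        √(A.card) ^ (2 * ((d + 2) * (d + 3)) + (d + 2)) := by
  have hC := hA.one_le
  set s := √(A.card : ℝ)
  set 𝓑 := Finset.univ.filter fun B : Fin (d + 2) → Fin (d + 3) → A => FullHyperplane (rowSpan B)
  set M := ∑ l ∈ ratios A, ((ratioSet A l).ncard : ℝ)
  have hcard : (Fintype.card (Option (Fin d)) : ℝ) = d + 1 := by simp
  have hswap : ∀ (q : ℕ) (G : K → (Fin (d + 2) → Fin (d + 3) → A) → ℝ) (c : ℝ),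
      ∑ B ∈ 𝓑, c * (M ^ q * ∑ l ∈ ratios A, G l B / (ratioSet A l).ncard ^ q /
        (pointsOf A (rowSpan B)).ncard ^ q) =
      c * (M ^ q * ∑ l ∈ ratios A, (∑ B ∈ 𝓑, G l B / (pointsOf A (rowSpan B)).ncard ^ q) /
        (ratioSet A l).ncard ^ q) := by
    intro q G c
    rw [← Finset.mul_sum, ← Finset.mul_sum, Finset.sum_comm]
    congr 2
    refine Finset.sum_congr rfl fun l _ => ?_
    rw [Finset.sum_div]
    exact Finset.sum_congr rfl fun B _ => div_right_comm _ _ _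
  refine (Finset.sum_le_sum (s := 𝓑) fun B _ => hA.ncard_pointsOf_le (rowSpan B)
    ⟨B 0, Submodule.subset_span ⟨0, rfl⟩⟩).trans ?_
  calc _ ≤ ∑ j : Fin d, ((d : ℝ) + 1) ^ (d + 1) * 2 ^ d *
          ((d + 2) ^ (d + 1) * (2 ^ (d + 2) * (d + 1) * (2 ^ (d + 1) * C ^ (d + 1))) *
            s ^ (2 * ((d + 2) * (d + 3)) + (d + 2))) +
        (d + 1) ^ (d + 1) * 2 ^ d *
          ((d + 2) * (2 ^ (d + 2) * (d + 1) * (2 ^ (d + 1) * C) + C) *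
            s ^ (2 * ((d + 2) * (d + 3)) + (d + 2))) := by
        rw [Finset.sum_add_distrib, Finset.sum_comm, hcard]
        refine add_le_add (Finset.sum_le_sum fun j _ => ?_) ?_
        · refine (hswap (j + 1) (fun l B => ((depTuples {v ∈ pointsOf A (rowSpan B) |
            HasRatio l v} (j + 1)).ncard : ℝ)) _).le.trans ?_
          have h := hA.sum_sum_depTuples_le (d := d + 1) (q := j + 1) (by omega) (by omega)
            (by omega) hdN
          push_cast at h
          rw [show (d : ℝ) + 1 + 1 = d + 2 by ring] at h
          have hp : ((d : ℝ) + 1) ^ (j + 2 : ℕ) ≤ (d + 1) ^ (d + 1) :=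
            pow_le_pow_right₀ (by linarith [Nat.cast_nonneg (α := ℝ) d]) (by omega)
          exact mul_le_mul (mul_le_mul_of_nonneg_right hp (by positivity)) h (by positivity)
            (by positivity)
        · refine (hswap d (fun l B => ((indepTuples {v ∈ pointsOf A (rowSpan B) |
            HasRatio l v} (d + 1)).ncard : ℝ)) _).le.trans ?_
          have h := hA.sum_sum_indepTuples_le (d := d + 1) (by omega) hdN
          push_cast at h
          rw [show (d : ℝ) + 1 + 1 = d + 2 by ring] at h
          exact mul_le_mul_of_nonneg_left h (by positivity)
    _ = _ := by
        rw [Finset.sum_const, Finset.card_univ, Fintype.card_fin, nsmul_eq_mul]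
        ring

end

section

variable {K : Type*} [Field K] {A : Finset K}

theorem fullHyperplane_rowSpan_snoc {r : ℕ} {D : Fin r → Fin r → A} (hD : IndepRows D)
    {w : Fin r → K} (hw : ∀ j, w j ≠ 0) {y : Fin r → A} (hy : IsComb D w y) :
    FullHyperplane (rowSpan fun i => (Fin.snoc (fun j => D j i) (y i) : Fin (r + 1) → A)) := by
  set B : Fin r → Fin (r + 1) → A := fun i => Fin.snoc (fun j => D j i) (y i)
  have hB : IndepRows B := fun u hu => hD.transpose u fun j => by
    simpa [B] using hu j.castSucc
  set c : Fin (r + 1) → K := Fin.snoc w (-1)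
  have hc : ∀ i, c i ≠ 0 := fun i =>
    Fin.lastCases (by simp [c]) (fun j => by simpa [c] using hw j) i
  let φ : (Fin (r + 1) → K) →ₗ[K] K := ∑ i, c i • LinearMap.proj i
  have hφ : ∀ v, φ v = ∑ i, c i * v i := fun v => by simp [φ]
  have hle : rowSpan B ≤ LinearMap.ker φ := Submodule.span_le.2 (by
    rintro _ ⟨i, rfl⟩
    rw [SetLike.mem_coe, LinearMap.mem_ker, hφ, Fin.sum_univ_castSucc]
    simp [c, B, hy i])
  have hφ0 : φ ≠ 0 := fun h => by
    have := hφ (Pi.single (Fin.last r) 1)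
    rw [h] at this
    simp [Pi.single_apply, c] at this
  have h1 := Module.Dual.finrank_ker_add_one_of_ne_zero hφ0
  rw [Module.finrank_fintype_fun_eq_card, Fintype.card_fin] at h1
  have heq := Submodule.eq_of_le_of_finrank_eq hle (by
    rw [finrank_rowSpan hB, Fintype.card_fin]
    change _ = Module.finrank K (LinearMap.ker φ)
    omega)
  exact ⟨c, hc, fun v => by rw [heq, LinearMap.mem_ker, hφ]⟩

variable [DecidableEq K] {N : ℕ} {C : ℝ}

theorem suppCard_eq_card_iff {τ : Type*} [Fintype τ] {w : τ → K} :
    suppCard w = Fintype.card τ ↔ ∀ j, w j ≠ 0 := by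
  rw [suppCard, ← Finset.card_univ, Finset.card_filter_eq_iff]
  simp

open Classical in
theorem SmallRank.ncard_modelSet_one_le (hA : SmallRank N C A) (r : ℕ) :
    ((modelSet A r 1 1 r).ncard : ℝ) ≤
      ∑ B : Fin r → Fin (r + 1) → A with FullHyperplane (rowSpan B),
        ((pointsOf A (rowSpan B)).ncard : ℝ) := by
  let f : (Fin r → Fin r → A) × (Fin 1 → Fin r → A) × (Fin 1 → Fin r → A) →
      Fin r → Fin (r + 1) → A := fun q i => Fin.snoc (fun j => q.1 j i) (q.2.1 0 i)
  have hfull : ∀ q ∈ modelSet A r 1 1 r, FullHyperplane (rowSpan (f q)) ∧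
      ∃ b : A, (Fin.snoc (q.2.2 0) b : Fin (r + 1) → A) ∈ pointsOf A (rowSpan (f q)) := by
    rintro ⟨D, y, x⟩ ⟨hD, w, hw, -, ⟨i, hi⟩, hx⟩
    simp only at hD hw hx
    rw [Subsingleton.elim i 0] at hi
    have hw0 : ∀ j, w 0 j ≠ 0 := suppCard_eq_card_iff.1 (hi.trans (Fintype.card_fin r).symm)
    obtain ⟨v, hv⟩ := hD.transpose.exists_comb (x 0)
    refine ⟨fullHyperplane_rowSpan_snoc hD hw0 (hw 0), ⟨_, hx 0 0⟩,
      mem_pointsOf_rowSpan_iff.2 ⟨v, fun i => ?_⟩⟩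
    refine Fin.lastCases ?_ (fun j => ?_) i
    · simp only [Fin.snoc_last, f]
      simp only [hv _, hw 0 _, Finset.mul_sum]
      rw [Finset.sum_comm]
      exact Finset.sum_congr rfl fun _ _ => Finset.sum_congr rfl fun _ _ => by ring
    · simpa [f] using hv j
  rw [ncard_eq_sum_fiber (modelSet A r 1 1 r) f
    (Finset.univ.filter fun B => FullHyperplane (rowSpan B))
    fun q hq => Finset.mem_filter.2 ⟨Finset.mem_univ _, (hfull q hq).1⟩]
  have : Nonempty A := hA.nonempty.to_subtype
  choose! b hb using fun q hq => (hfull q hq).2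
  refine Finset.sum_le_sum fun B _ => ncard_le_of_injOn _ _
    (fun q => (Fin.snoc (q.2.2 0) (b q) : Fin (r + 1) → A)) ?_ ?_
  · rintro q ⟨hq, rfl⟩
    exact hb q hq
  · rintro ⟨D, y, x⟩ ⟨-, h⟩ ⟨D', y', x'⟩ ⟨-, h'⟩ he
    have hB := h.trans h'.symm
    have h1 : ∀ i, (fun j => D j i) = (fun j => D' j i) ∧ y 0 i = y' 0 i := fun i =>
      Fin.snoc_injective2 (congrFun hB i)
    simp only [Prod.mk.injEq]
    refine ⟨funext fun j => funext fun i => congrFun (h1 i).1 j, funext fun t => ?_,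
      funext fun t => ?_⟩
    · rw [Subsingleton.elim t 0]
      exact funext fun i => (h1 i).2
    · rw [Subsingleton.elim t 0]
      exact (Fin.snoc_injective2 he).1

end

theorem modelSet_exponent_le {m p p' τ : ℕ} (hm : 0 < m) (hpp' : p ≤ p') (hp' : p' < 2 * p)
    (h2 : 2 ≤ p') (hτ : 0 < τ) (hτr : τ ≤ 2 * m + 2) :
    2 * ((2 * m + 2) * (2 * m + 2)) + 2 * (2 * m + 2) +
      (if 2 * τ ≤ 2 * m + 2 then 2 * τ else 2 * m + 2 + 1) * p' +
        (2 * (2 * m + 2) + 1 - τ) * (p - 1) ≤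
      2 * ((2 * m + 2) * (2 * m + 2) + p' * (2 * m + 2) + p + m * (2 * p - p')) := by
  obtain ⟨q, rfl⟩ := Nat.exists_eq_add_of_le (show 1 ≤ p by omega)
  obtain ⟨f, rfl⟩ := Nat.exists_eq_add_of_le hpp'
  rw [show 2 * (1 + q) - (1 + q + f) = 1 + q - f by omega, Nat.add_sub_cancel_left]
  zify [show f ≤ 1 + q by omega, show τ ≤ 2 * (2 * m + 2) + 1 by omega]
  zify at hm hpp' hp' h2 hτ hτr
  have hq : (0 : ℤ) ≤ q := Int.natCast_nonneg q
  have hf : (0 : ℤ) ≤ f := Int.natCast_nonneg f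
  split_ifs with h
  · rcases lt_or_ge (τ : ℤ) 3 with h3 | h3
    · have : τ = 1 ∨ τ = 2 := by omega
      rcases this with rfl | rfl
      · push_cast
        nlinarith [mul_nonneg (sub_nonneg.2 hm) hq, mul_nonneg (sub_nonneg.2 hm) hf]
      · push_cast at *
        nlinarith [mul_nonneg (sub_nonneg.2 hm) hq, mul_nonneg (sub_nonneg.2 hm) hf]
    · nlinarith [mul_nonneg hq (sub_nonneg.2 h3),
        mul_nonneg (sub_nonneg.2 h2) (sub_nonneg.2 h)]
  · have h3 : (3 : ℤ) ≤ τ := by omega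
    nlinarith [mul_nonneg hq (sub_nonneg.2 h3)]

/-- The bound for the model sets. -/
theorem exists_ncard_modelSet_le (C : ℝ) {N r p p' : ℕ} (hr : 0 < r) (hp : 0 < p) (hpp' : p ≤ p')
    (hN : 2 * r + 1 ≤ N) : ∃ C' : ℝ, ∀ (K : Type u) [Field K] [DecidableEq K] (A : Finset K),
      SmallRank N C A → ∀ t, 0 < t → t ≤ r → ((modelSet A r p p' t).ncard : ℝ) ≤
        C' * √(A.card) ^ (2 * (r * r + p' * r + p + (r - 1) / 2 * (2 * p - p'))) := by
  set E := 2 * (r * r + p' * r + p + (r - 1) / 2 * (2 * p - p'))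
  have hgen : ∀ (K : Type u) [Field K] [DecidableEq K] (A : Finset K), SmallRank N C A →
      ∀ t, 0 < t → t ≤ r → (2 * p ≤ p' ∨ t - 1 ≤ 2 * ((r - 1) / 2)) →
        ((modelSet A r p p' t).ncard : ℝ) ≤
        (2 ^ r) ^ p * C ^ p' * √(A.card) ^ E := by
    intro K _ _ A hA t ht htr h
    have hC := hA.one_le
    refine (hA.ncard_modelSet_le hr (by omega) ht).trans
      (mul_le_mul_of_nonneg_left (pow_le_pow_right₀ hA.one_le_sqrt ?_) (by positivity))
    obtain ⟨t, rfl⟩ := Nat.exists_eq_add_of_lt ht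
    obtain ⟨g, rfl⟩ := Nat.exists_eq_add_of_le (show t + 1 ≤ r by omega)
    have h1 : 2 * (t + 1 + g) + 1 - (0 + t + 1) = t + 2 * g + 2 := by omega
    rw [h1]
    have hm : t ≤ 2 * ((t + 1 + g - 1) / 2) ∨ 2 * p ≤ p' := by omega
    simp only [E, Nat.zero_add]
    generalize (t + 1 + g - 1) / 2 = m at hm
    rcases le_or_gt (2 * p) p' with h2 | h2
    · rw [Nat.sub_eq_zero_of_le h2]
      nlinarith [Nat.mul_le_mul_left t h2]
    · have h3 : t ≤ 2 * m := by omega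
      obtain ⟨e, he⟩ := Nat.exists_eq_add_of_lt h2
      rw [show 2 * p - p' = e + 1 by omega]
      have h4 := Nat.mul_le_mul_right (e + 1) h3
      have h5 : t * (2 * p) = t * (p' + e + 1) := by rw [he]
      linarith
  by_cases hcase : 2 * p ≤ p' ∨ r - 1 ≤ 2 * ((r - 1) / 2)
  · exact ⟨(2 ^ r) ^ p * C ^ p', fun K _ _ A hA t ht htr => hgen K A hA t ht htr (by omega)⟩
  have htop : ∃ C' : ℝ, ∀ (K : Type u) [Field K] [DecidableEq K] (A : Finset K), SmallRank N C A →
      ((modelSet A r p p' r).ncard : ℝ) ≤ C' * √(A.card) ^ E := by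
    obtain ⟨m, rfl⟩ : ∃ m, r = 2 * m + 2 := ⟨r / 2 - 1, by omega⟩
    have hm : (2 * m + 2 - 1) / 2 = m := by omega
    rcases Nat.eq_zero_or_pos m with rfl | hm0
    · refine ⟨(2 ^ 2) ^ p * C ^ p', fun K _ _ A hA => ?_⟩
      have hC := hA.one_le
      refine hA.ncard_modelSet_two_le.trans
        (mul_le_mul_of_nonneg_left (pow_le_pow_right₀ hA.one_le_sqrt ?_) (by positivity))
      simp only [E, hm]
      omega
    · by_cases hp1 : p' = 1
      · obtain rfl : p = 1 := by omega
        subst hp1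
        have hE : E = 2 * ((2 * m + 2) * (2 * m + 3)) + (2 * m + 2) := by
          simp only [E, hm]
          ring_nf
        rw [hE]
        exact ⟨_, fun K _ _ A hA => (hA.ncard_modelSet_one_le _).trans
          (hA.sum_ncard_pointsOf_le (d := 2 * m) (by omega) (by omega))⟩
      · refine ⟨p * (2 * m + 2 : ℕ) * ((2 ^ (2 * m + 2) * C) ^ p' * C ^ p), fun K _ _ A hA =>
          hA.ncard_modelSet_self_le hr (by omega) (by omega) fun τ hτ hτr => ?_⟩
        simp only [E, hm]
        exact modelSet_exponent_le hm0 hpp' (by omega) (by omega) hτ hτr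
  obtain ⟨C', hC'⟩ := htop
  refine ⟨max C' ((2 ^ r) ^ p * C ^ p'), fun K _ _ A hA t ht htr => ?_⟩
  rcases htr.eq_or_lt with rfl | htr'
  · exact (hC' K A hA).trans (by gcongr; exact le_max_left _ _)
  · exact (hgen K A hA t ht htr (by omega)).trans (by gcongr; exact le_max_right _ _)

theorem Matrix.exists_linearIndependent_row {K m n : Type*} [Field K] [Finite m] [Fintype n]
    {r : ℕ} (X : Matrix m n K) (h : X.rank = r) :
    ∃ a : Fin r → m, Function.Injective a ∧ LinearIndependent K (X.row ∘ a) ∧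
      Submodule.span K (Set.range (X.row ∘ a)) = Submodule.span K (Set.range X.row) := by
  obtain ⟨κ, a, ha, hspan, hli⟩ := exists_linearIndependent' K X.row
  have : Finite κ := Finite.of_injective a ha
  have := Fintype.ofFinite κ
  have hcard : Fintype.card κ = r := by
    rw [← finrank_span_eq_card hli, hspan, ← X.rank_eq_finrank_span_row, h]
  let e := (Fintype.equivFinOfCardEq hcard).symm
  have hr : Set.range (X.row ∘ (a ∘ e)) = Set.range (X.row ∘ a) := by
    rw [← Function.comp_assoc, e.surjective.range_comp]
  exact ⟨a ∘ e, ha.comp e.injective, hli.comp e e.injective, by rw [hr, hspan]⟩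

section

variable {K : Type*} [Field K] {A : Finset K}

/-- A matrix of rank `r` has an invertible `r × r` block, and the rows of this block span. -/
theorem exists_indepRows_of_rank_eq {m n : Type*} [Fintype m] [Fintype n] {r : ℕ} (X : m → n → A)
    (h : (Matrix.of fun i j => (X i j : K)).rank = r) :
    ∃ a : Fin r → m, ∃ b : Fin r → n, Function.Injective a ∧ Function.Injective b ∧
      IndepRows (fun i j => X (a i) (b j)) ∧
        ∀ i, ∃ w : Fin r → K, IsComb (fun k => X (a k)) w (X i) := by
  set M : Matrix m n K := Matrix.of fun i j => (X i j : K) with hM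
  obtain ⟨a, ha, hli, hspan⟩ := M.exists_linearIndependent_row h
  have h1 : (M.submatrix a id).transpose.rank = r := by
    rw [Matrix.rank_transpose, LinearIndependent.rank_matrix (M := M.submatrix a id) hli,
      Fintype.card_fin]
  obtain ⟨b, hb, hli', -⟩ := Matrix.exists_linearIndependent_row _ h1
  refine ⟨a, b, ha, hb, IndepRows.transpose (D := fun j i => X (a i) (b j)) fun w hw => ?_,
    fun i => ?_⟩
  · refine funext (Fintype.linearIndependent_iff.1 hli' w (funext fun i => ?_))
    rw [Finset.sum_apply]
    exact hw i
  · have hi : M.row i ∈ Submodule.span K (Set.range (M.row ∘ a)) := by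
      rw [hspan]
      exact Submodule.subset_span ⟨i, rfl⟩
    obtain ⟨w, hw⟩ := (Submodule.mem_span_range_iff_exists_fun K).1 hi
    refine ⟨w, fun j => ?_⟩
    have := congrFun hw j
    rw [Finset.sum_apply] at this
    exact this.symm

/-- Matrices of rank `r` over `A`, as in `modelSet`, without a condition on the supports. -/
def fullModelSet (A : Finset K) (r p p' : ℕ) :
    Set ((Fin r → Fin r → A) × (Fin p → Fin r → A) × (Fin p' → Fin r → A)) :=
  {q | IndepRows q.1 ∧ ∃ w : Fin p → Fin r → K, (∀ i, IsComb q.1 (w i) (q.2.1 i)) ∧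
    ∀ l i, ∑ j, w i j * (q.2.2 l j : K) ∈ A}

theorem exists_equiv_sum {r m : ℕ} {a : Fin r → Fin m} (ha : Function.Injective a) :
    ∃ e : Fin r ⊕ Fin (m - r) ≃ Fin m, ∀ i, e (Sum.inl i) = a i := by
  classical
  have hc : Fintype.card ↥(Set.range a)ᶜ = m - r := by
    rw [Fintype.card_compl_set, Fintype.card_fin, Set.card_range_of_injective ha, Fintype.card_fin]
  exact ⟨((Equiv.ofInjective a ha).sumCongr (Fintype.equivFinOfCardEq hc).symm).trans
    (Equiv.Set.sumCompl (Set.range a)), fun i => by simp⟩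

theorem ncard_rank_eq_le (m n r : ℕ) :
    ({X : Matrix (Fin m) (Fin n) K | (∀ i j, X i j ∈ A) ∧ X.rank = r}.ncard : ℝ) ≤
      (m ^ r * n ^ r : ℕ) * ((fullModelSet A r (m - r) (n - r)).ncard : ℝ) := by
  have h1 : {X : Matrix (Fin m) (Fin n) K | (∀ i j, X i j ∈ A) ∧ X.rank = r} ⊆
      (fun Y : Fin m → Fin n → A => Matrix.of fun i j => (Y i j : K)) ''
        {Y | (Matrix.of fun i j => (Y i j : K)).rank = r} := fun X hX =>
    ⟨fun i j => ⟨X i j, hX.1 i j⟩, hX.2, rfl⟩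
  have h2 : ({X : Matrix (Fin m) (Fin n) K | (∀ i j, X i j ∈ A) ∧ X.rank = r}.ncard : ℝ) ≤
      {Y : Fin m → Fin n → A | (Matrix.of fun i j => (Y i j : K)).rank = r}.ncard :=
    Nat.cast_le.2 ((Set.ncard_le_ncard h1 (Set.toFinite _)).trans
      (Set.ncard_image_le (Set.toFinite _)))
  refine h2.trans ((ncard_le_card_mul_of_subset (β := (Fin r → Fin m) × (Fin r → Fin n)) _
    (fun c => {Y : Fin m → Fin n → A | Function.Injective c.1 ∧ Function.Injective c.2 ∧
      IndepRows (fun i j => Y (c.1 i) (c.2 j)) ∧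
        ∀ i, ∃ w : Fin r → K, IsComb (fun k => Y (c.1 k)) w (Y i)}) (fun Y hY => ?_)
    (c := (fullModelSet A r (m - r) (n - r)).ncard) ?_).trans_eq ?_)
  · obtain ⟨a, b, h⟩ := exists_indepRows_of_rank_eq Y hY
    exact ⟨(a, b), h⟩
  · rintro ⟨a, b⟩
    by_cases hab : Function.Injective a ∧ Function.Injective b
    · obtain ⟨e, he⟩ := exists_equiv_sum hab.1
      obtain ⟨g, hg⟩ := exists_equiv_sum hab.2
      refine ncard_le_of_injOn _ _ (fun Y => (fun i j => Y (a i) (b j),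
        fun i j => Y (e (Sum.inr i)) (b j), fun l i => Y (a i) (g (Sum.inr l)))) ?_ ?_
      · rintro Y ⟨-, -, hD, hw⟩
        choose w hw using hw
        refine ⟨hD, fun i => w (e (Sum.inr i)), fun i j => hw _ _, fun l i => ?_⟩
        rw [← hw (e (Sum.inr i)) (g (Sum.inr l))]
        exact Subtype.coe_prop _
      · rintro Y ⟨-, -, hD, hw⟩ Y' ⟨-, -, -, hw'⟩ h
        simp only [Prod.mk.injEq] at h
        obtain ⟨hDD, hy, hx⟩ := h
        have hleft : ∀ i j, Y (a i) j = Y' (a i) j := fun i j => by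
          obtain ⟨j, rfl⟩ := g.surjective j
          rcases j with j | j
          · rw [hg]
            exact congrFun (congrFun hDD i) j
          · exact congrFun (congrFun hx j) i
        funext i j
        obtain ⟨i, rfl⟩ := e.surjective i
        rcases i with i | i
        · rw [he]
          exact hleft i j
        obtain ⟨w, hw⟩ := hw (e (Sum.inr i))
        obtain ⟨w', hw'⟩ := hw' (e (Sum.inr i))
        obtain rfl : w = w' := hD.comb_unique (fun j => hw (b j)) fun j => by
          rw [congrFun (congrFun hy i) j, hw' (b j)]
          exact Finset.sum_congr rfl fun k _ => congrArg (w' k * ·) (congrArg _ (hleft k _).symm)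
        refine Subtype.ext ?_
        rw [hw j, hw' j]
        exact Finset.sum_congr rfl fun k _ => congrArg (w k * ·) (congrArg _ (hleft k j))
    · refine le_of_eq_of_le ?_ (Nat.cast_nonneg _)
      rw [Nat.cast_eq_zero, Set.ncard_eq_zero]
      exact Set.eq_empty_of_forall_notMem fun Y hY => hab ⟨hY.1, hY.2.1⟩
  · simp

end

theorem exists_ncard_fullModelSet_le (C : ℝ) {N r p p' : ℕ} (hr : 0 < r) (hpp' : p ≤ p')
    (hN : 2 * r + 1 ≤ N) : ∃ C' : ℝ, ∀ (K : Type u) [Field K] [DecidableEq K] (A : Finset K),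
      SmallRank N C A → ((fullModelSet A r p p').ncard : ℝ) ≤
        C' * (A.card : ℝ) ^ (r * r + p' * r + p + (r - 1) / 2 * (2 * p - p')) := by
  rcases Nat.eq_zero_or_pos p with rfl | hp
  · refine ⟨1, fun K _ _ A hA => (Nat.cast_le.2 (Set.ncard_le_ncard (Set.subset_univ _)
      (Set.toFinite _))).trans_eq ?_⟩
    rw [Set.ncard_univ]
    simp [Nat.card_eq_fintype_card, pow_add, ← pow_mul, mul_comm]
  · obtain ⟨C', hC'⟩ := exists_ncard_modelSet_le.{u} C hr hp hpp' hN
    refine ⟨r * C', fun K _ _ A hA => ?_⟩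
    have : Nonempty (Fin r) := ⟨⟨0, hr⟩⟩
    have : Nonempty (Fin p) := ⟨⟨0, hp⟩⟩
    refine (ncard_le_card_mul_of_subset (β := Fin r) _ (fun t => modelSet A r p p' (t + 1)) ?_
      fun t => hC' K A hA _ t.1.succ_pos t.2).trans_eq ?_
    · rintro ⟨D, y, x⟩ ⟨hD, w, hw, hx⟩
      obtain ⟨i₀, hi₀⟩ := Finite.exists_max fun i => suppCard (w i)
      have h1 := hA.suppCard_pos (hw i₀)
      have h2 := suppCard_le (w i₀)
      rw [Fintype.card_fin] at h2
      have h3 : suppCard (w i₀) - 1 + 1 = suppCard (w i₀) := Nat.sub_add_cancel h1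
      refine ⟨⟨suppCard (w i₀) - 1, by omega⟩, hD, w, hw, ?_, ⟨i₀, h3.symm⟩, hx⟩
      simpa only [h3] using hi₀
    · rw [sqrt_card_pow, Fintype.card_fin, mul_assoc]

theorem count_matrices_of_rank (m n r ρ : ℕ) (hm : 2 ≤ m) (hn : 2 ≤ n)
    (hmn : m ≤ n) (hrm : r ≤ m) (hr : 0 < r) :
    ∃ C : ℝ, 0 < C ∧ ∀ (K : Type*) [Field K] [CharZero K] (Γ : Subgroup Kˣ),
      FinRank Γ ρ →
      ∀ A : Finset K, (∀ a ∈ A, ∃ u : Kˣ, u ∈ Γ ∧ (u : K) = a) →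
      (({X : Matrix (Fin m) (Fin n) K | (∀ i j, X i j ∈ A) ∧ X.rank = r}.ncard : ℝ)) ≤
        if 2 * m ≤ n + r then C * (A.card : ℝ) ^ (n * r + m - r)
        else C * (A.card : ℝ) ^ (n * r + m - r + ((r - 1) / 2) * (2 * m - n - r)) := by
  obtain ⟨C, hC⟩ := exists_smallRank (2 * r + 1) ρ
  obtain ⟨C', hC'⟩ := exists_ncard_fullModelSet_le C hr (Nat.sub_le_sub_right hmn r) le_rfl
  refine ⟨max 1 ((m ^ r * n ^ r : ℕ) * C'), by positivity, fun K _ _ Γ hΓ A hA => ?_⟩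
  classical
  have key : ({X : Matrix (Fin m) (Fin n) K | (∀ i j, X i j ∈ A) ∧ X.rank = r}.ncard : ℝ) ≤
      max 1 ((m ^ r * n ^ r : ℕ) * C') * (A.card : ℝ) ^
        (n * r + m - r + (r - 1) / 2 * (2 * m - n - r)) := by
    rcases A.eq_empty_or_nonempty with rfl | hne
    · have hempty : {X : Matrix (Fin m) (Fin n) K | (∀ i j, X i j ∈ (∅ : Finset K)) ∧
          X.rank = r} = ∅ := Set.eq_empty_of_forall_notMem fun X hX =>
        Finset.notMem_empty _ (hX.1 ⟨0, by omega⟩ ⟨0, by omega⟩)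
      rw [hempty, Set.ncard_empty, Nat.cast_zero]
      positivity
    · obtain ⟨p, rfl⟩ := Nat.exists_eq_add_of_le hrm
      obtain ⟨q, rfl⟩ := Nat.exists_eq_add_of_le hmn
      have h1 : (r + p + q) * r + (r + p) - r + (r - 1) / 2 * (2 * (r + p) - (r + p + q) - r) =
          r * r + (r + p + q - r) * r + (r + p - r) +
            (r - 1) / 2 * (2 * (r + p - r) - (r + p + q - r)) := by
        rw [show r + p + q - r = p + q by omega, show r + p - r = p by omega,
          show 2 * (r + p) - (r + p + q) - r = 2 * p - (p + q) by omega,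
          show (r + p + q) * r + (r + p) - r = (r + p + q) * r + p by omega]
        ring
      rw [h1]
      refine (ncard_rank_eq_le _ _ _).trans ((mul_le_mul_of_nonneg_left
        (hC' K A (hC K Γ hΓ A hne hA)) (Nat.cast_nonneg _)).trans ?_)
      rw [← mul_assoc]
      gcongr
      exact le_max_right _ _
  split_ifs with h
  · rwa [show 2 * m - n - r = 0 by omega, mul_zero, add_zero] at key
  · exact key
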